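/- arXiv:1608.05458 — 2 statements merged into one kernel-verified Lean document; each statement's English description precedes it below -/
import Mathlib

section
/- Assume the ABC conjecture. Then there exists D such that for every integer d ≥ D one has N⁺(d) ≤ 1 and N⁻(d) ≤ 1. -/
/-- The ABC conjecture: for every `ε > 0` there is `K > 0` such that for all
nonzero integers `A, B, C` with `A + B = C` and `gcd(A, B) = 1`,
`max(|A|,|B|,|C|) ≤ K * rad(|ABC|)^(1+ε)`, where `rad` is the product of the
distinct primes dividing the number. -/
def ABCConjecture : Prop :=
  ∀ ε : ℝ, 0 < ε → ∃ K : ℝ, 0 < K ∧ ∀ A B C : ℤ,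
    A ≠ 0 → B ≠ 0 → C ≠ 0 → A + B = C → Int.gcd A B = 1 →
    ((max (max |A| |B|) |C| : ℤ) : ℝ) ≤
      K * ((∏ p ∈ (A * B * C).natAbs.primeFactors, p : ℕ) : ℝ) ^ (1 + ε)

/-- A pair of integers `(a, b)` is multiplicatively dependent: `ab ≠ 0` and
there is a nonzero pair of integer exponents `(k₁, k₂)` with `a^k₁ * b^k₂ = 1`
(evaluated in `ℚ`). -/
def MultDepPair (a b : ℤ) : Prop :=
  a * b ≠ 0 ∧ ∃ k : ℤ × ℤ, k ≠ 0 ∧ (a : ℚ) ^ k.1 * (b : ℚ) ^ k.2 = 1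

/-- `MSet d` is the set of multiplicatively dependent pairs `(a, b) ∈ ℤ²`
with difference `b - a = d`. -/
def MSet (d : ℤ) : Set (ℤ × ℤ) :=
  {p | MultDepPair p.1 p.2 ∧ p.2 - p.1 = d}

/-- `M d` is the number of multiplicatively dependent pairs with difference `d`. -/
noncomputable def M (d : ℤ) : ℕ := (MSet d).ncard

/-- `g` is a perfect power: `g = a ^ k` with `a ≥ 2`, `k ≥ 2`. -/
def IsPerfectPow (g : ℕ) : Prop := ∃ a k : ℕ, 2 ≤ a ∧ 2 ≤ k ∧ g = a ^ k

/-- `Nplus d` is the number of primitive solutions `(g, x, y)` of `g^y + g^x = d`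
with `g ≥ 2` not a perfect power and `y > x ≥ 1`. -/
noncomputable def Nplus (d : ℕ) : ℕ :=
  {T : ℕ × ℕ × ℕ | 2 ≤ T.1 ∧ 1 ≤ T.2.1 ∧ T.2.1 < T.2.2 ∧ ¬ IsPerfectPow T.1 ∧
    T.1 ^ T.2.2 + T.1 ^ T.2.1 = d}.ncard

/-- `Nminus d` is the number of primitive solutions `(g, x, y)` of `g^y - g^x = d`
with `g ≥ 2` not a perfect power and `y > x ≥ 1`. -/
noncomputable def Nminus (d : ℕ) : ℕ :=
  {T : ℕ × ℕ × ℕ | 2 ≤ T.1 ∧ 1 ≤ T.2.1 ∧ T.2.1 < T.2.2 ∧ ¬ IsPerfectPow T.1 ∧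
    T.1 ^ T.2.2 = T.1 ^ T.2.1 + d}.ncard

/-- A logarithmic form of the ABC conjecture that does not assume coprimality: `R` collects the
primes of `A * B`, and `C` is counted in full. -/
lemma ABCConjecture.log_le (habc : ABCConjecture) {ε : ℝ} (hε : 0 < ε) :
    ∃ κ : ℝ, 0 ≤ κ ∧ ∀ A B C : ℤ, A ≠ 0 → B ≠ 0 → C ≠ 0 → A + B = C → ∀ R : ℕ, R ≠ 0 →
      (∀ p : ℕ, p.Prime → (p : ℤ) ∣ A * B → p ∣ R) →
      Real.log |(A : ℝ)| ≤ κ + (1 + ε) * (Real.log R + Real.log |(C : ℝ)|) := by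
  obtain ⟨K, hK, h⟩ := habc ε hε
  refine ⟨max (Real.log K) 0, le_max_right _ _, fun A B C hA hB hC hABC R hR hp => ?_⟩
  obtain ⟨A', B', hco, hA', hB'⟩ :=
    Int.exists_gcd_one (Int.gcd_pos_of_ne_zero_left B hA)
  set G : ℤ := (Int.gcd A B : ℤ) with hG
  have hG1 : 1 ≤ G := by
    have := Int.gcd_pos_of_ne_zero_left B hA
    omega
  have hA0 : A' ≠ 0 := by rintro rfl; simp at hA'; exact hA hA'
  have hB0 : B' ≠ 0 := by rintro rfl; simp at hB'; exact hB hB'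
  have hC' : C = (A' + B') * G := by rw [← hABC, add_mul, ← hA', ← hB']
  have hC0 : A' + B' ≠ 0 := by intro h0; rw [h0] at hC'; simp at hC'; exact hC hC'
  have h1 := h A' B' (A' + B') hA0 hB0 hC0 rfl hco
  set C' := A' + B' with hC'def
  set P : ℕ := ∏ p ∈ (A' * B' * C').natAbs.primeFactors, p with hP
  have hRC : R * C'.natAbs ≠ 0 := mul_ne_zero hR (Int.natAbs_ne_zero.2 hC0)
  have hPle : P ≤ R * C'.natAbs := by
    have hsub : (A' * B' * C').natAbs.primeFactors ⊆ (R * C'.natAbs).primeFactors := by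
      intro p hpm
      have hpp := Nat.prime_of_mem_primeFactors hpm
      have hd := Nat.dvd_of_mem_primeFactors hpm
      refine Nat.mem_primeFactors.2 ⟨hpp, ?_, hRC⟩
      rw [Int.natAbs_mul] at hd
      rcases hpp.dvd_mul.1 hd with hd | hd
      · refine Dvd.dvd.mul_right (hp p hpp ?_) _
        refine (Int.natCast_dvd.2 hd).trans ?_
        rw [hA', hB']
        exact ⟨G * G, by ring⟩
      · exact Dvd.dvd.mul_left hd _
    exact (Finset.prod_le_prod_of_subset_of_one_le' hsub (fun p hp _ =>
      (Nat.prime_of_mem_primeFactors hp).one_lt.le)).trans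
        (Nat.le_of_dvd (Nat.pos_of_ne_zero hRC) (Nat.prod_primeFactors_dvd _))
  have hP0 : 0 < P := Finset.prod_pos fun p hp => (Nat.prime_of_mem_primeFactors hp).pos
  have hAabs : (0 : ℝ) < |(A' : ℝ)| := abs_pos.2 (by exact_mod_cast hA0)
  have hCabs : (0 : ℝ) < |(C' : ℝ)| := abs_pos.2 (by exact_mod_cast hC0)
  have h2 : |(A' : ℝ)| ≤ K * (P : ℝ) ^ (1 + ε) := by
    refine le_trans ?_ h1
    push_cast
    exact (le_max_left _ _).trans (le_max_left _ _)
  have h3 : Real.log |(A' : ℝ)| ≤ Real.log K + (1 + ε) * Real.log P := by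
    have := Real.log_le_log hAabs h2
    rwa [Real.log_mul hK.ne' (by positivity), Real.log_rpow (by exact_mod_cast hP0)] at this
  have h4 : Real.log P ≤ Real.log R + Real.log |(C' : ℝ)| := by
    rw [← Real.log_mul (by exact_mod_cast hR) hCabs.ne']
    refine Real.log_le_log (by exact_mod_cast hP0) ?_
    calc (P : ℝ) ≤ ((R * C'.natAbs : ℕ) : ℝ) := by exact_mod_cast hPle
      _ = _ := by rw [Nat.cast_mul, Nat.cast_natAbs, Int.cast_abs]
  have hG0 : (0 : ℝ) < G := by exact_mod_cast (by omega : 0 < G)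
  have hlG : 0 ≤ Real.log G := Real.log_nonneg (by exact_mod_cast hG1)
  have h5 : Real.log |(A : ℝ)| = Real.log |(A' : ℝ)| + Real.log G := by
    rw [hA', Int.cast_mul, abs_mul, abs_of_pos hG0, Real.log_mul hAabs.ne' hG0.ne']
  have h6 : Real.log |(C : ℝ)| = Real.log |(C' : ℝ)| + Real.log G := by
    rw [hC', Int.cast_mul, abs_mul, abs_of_pos hG0, Real.log_mul hCabs.ne' hG0.ne']
  have h7 := le_max_left (Real.log K) 0
  rw [h5, h6]
  nlinarith [mul_le_mul_of_nonneg_left h4 (by linarith : (0 : ℝ) ≤ 1 + ε), mul_nonneg hε.le hlG]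

/-- The curve `(1 + q t)^p (1 - p t)^q` is tangent to order two to `1` at `t = 0`. -/
lemma exists_tangent_bound (p q : ℕ) :
    ∃ K : ℝ, 1 ≤ K ∧ ∀ t : ℝ, |t| ≤ 1 →
      |1 - (1 + q * t) ^ p * (1 - p * t) ^ q| ≤ K * t ^ 2 := by
  have key : ∀ (n : ℕ) (c : ℝ), ∃ K : ℝ, 0 ≤ K ∧ ∀ t : ℝ, |t| ≤ 1 →
      |(1 + c * t) ^ n - 1 - n * c * t| ≤ K * t ^ 2 := by
    intro n c
    induction n with
    | zero => exact ⟨0, le_rfl, fun t _ => by simp⟩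
    | succ n ih =>
      obtain ⟨K, hK, h⟩ := ih
      refine ⟨K * (1 + |c|) + n * c ^ 2, by positivity, fun t ht => ?_⟩
      have e : (1 + c * t) ^ (n + 1) - 1 - ((n + 1 : ℕ) : ℝ) * c * t
          = ((1 + c * t) ^ n - 1 - n * c * t) * (1 + c * t) + n * c ^ 2 * t ^ 2 := by
        push_cast; ring
      rw [e]
      have h1 : |1 + c * t| ≤ 1 + |c| := by
        refine (abs_add_le _ _).trans ?_
        rw [abs_one, abs_mul]
        nlinarith [abs_nonneg c]
      refine (abs_add_le _ _).trans ?_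
      rw [abs_mul, abs_of_nonneg (by positivity : (0 : ℝ) ≤ n * c ^ 2 * t ^ 2)]
      have := mul_le_mul (h t ht) h1 (abs_nonneg _) (by positivity)
      nlinarith
  obtain ⟨K₁, hK₁, h₁⟩ := key p q
  obtain ⟨K₂, hK₂, h₂⟩ := key q (-p)
  refine ⟨1 + K₁ * (1 + p) ^ q + (p * q) ^ 2 + (1 + p * q) * K₂, by
    have : (0 : ℝ) ≤ K₁ * (1 + p) ^ q + (p * q) ^ 2 + (1 + p * q) * K₂ := by positivity
    linarith, fun t ht => ?_⟩
  have h1 := h₁ t ht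
  have h2 := h₂ t ht
  have e : 1 - (1 + q * t) ^ p * (1 - p * t) ^ q
      = -(((1 + q * t) ^ p - 1 - p * q * t) * (1 + -p * t) ^ q) + (p * q) ^ 2 * t ^ 2
        + -((1 + p * q * t) * ((1 + -p * t) ^ q - 1 - q * -p * t)) := by
    rw [show (1 : ℝ) - p * t = 1 + -p * t by ring]; ring
  have b1 : |(1 + -(p : ℝ) * t) ^ q| ≤ (1 + p) ^ q := by
    rw [abs_pow]
    refine pow_le_pow_left₀ (abs_nonneg _) ?_ _
    refine (abs_add_le _ _).trans ?_
    rw [abs_one, abs_mul, abs_neg, Nat.abs_cast]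
    nlinarith [(Nat.cast_nonneg p : (0 : ℝ) ≤ p)]
  have b2 : |1 + (p : ℝ) * q * t| ≤ 1 + p * q := by
    refine (abs_add_le _ _).trans ?_
    rw [abs_one, abs_mul, abs_of_nonneg (by positivity : (0 : ℝ) ≤ p * q)]
    nlinarith [(by positivity : (0 : ℝ) ≤ p * q)]
  have c1 := mul_le_mul h1 b1 (abs_nonneg _) (by positivity)
  have c2 := mul_le_mul b2 h2 (abs_nonneg _) (by positivity)
  rw [e]
  refine (abs_add_le _ _).trans ?_
  refine (add_le_add_left (abs_add_le _ _) _).trans ?_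
  rw [abs_neg, abs_neg, abs_mul, abs_mul (1 + _),
    abs_of_nonneg (by positivity : (0 : ℝ) ≤ (p * q) ^ 2 * t ^ 2)]
  nlinarith [sq_nonneg t]

/-- Weighted AM-GM: `(1 + q t)^p (1 - p t)^q < 1` for `0 < t < 1 / p`. -/
lemma tangent_lt_one {p q : ℕ} (hp : 0 < p) (hq : 0 < q) {t : ℝ} (ht : 0 < t) (hpt : p * t < 1) :
    (1 + q * t) ^ p * (1 - p * t) ^ q < 1 := by
  have hp' : (0 : ℝ) < p := by exact_mod_cast hp
  have hq' : (0 : ℝ) < q := by exact_mod_cast hq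
  have h1 : 0 < 1 + q * t := by positivity
  have h2 : 0 < 1 - p * t := by linarith
  have l1 : Real.log (1 + q * t) < q * t := by
    have := Real.log_lt_sub_one_of_pos h1 (by nlinarith [mul_pos hq' ht])
    linarith
  have l2 : Real.log (1 - p * t) ≤ -(p * t) := by
    have := Real.log_le_sub_one_of_pos h2
    linarith
  have h3 : 0 < (1 + q * t) ^ p * (1 - p * t) ^ q := by positivity
  rw [← Real.log_neg_iff h3, Real.log_mul (by positivity) (by positivity), Real.log_pow,
    Real.log_pow]
  nlinarith [mul_lt_mul_of_pos_left l1 hp', mul_le_mul_of_nonneg_left l2 hq'.le]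

/-- Under ABC, the radical of `X (X + q) (X - p)` has size at least `X ^ (2 - ε)`. -/
lemma ABCConjecture.log_le_of_middle (habc : ABCConjecture) {p q : ℕ} (hp : 0 < p) (hq : 0 < q)
    {ε : ℝ} (hε : 0 < ε) :
    ∃ κ : ℝ, 0 ≤ κ ∧ ∀ X : ℤ, (p : ℤ) < X → ∀ R : ℕ, R ≠ 0 →
      (∀ r : ℕ, r.Prime → (r : ℤ) ∣ X * (X + q) * (X - p) → r ∣ R) →
      (2 - ε) * Real.log X ≤ κ + Real.log R := by
  obtain ⟨K, hK, hbd⟩ := exists_tangent_bound p q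
  have hn : (0 : ℝ) < (p + q : ℕ) := by exact_mod_cast (by omega : 0 < p + q)
  set e := ε / (p + q : ℕ) with he
  have he0 : 0 < e := div_pos hε hn
  have hen : e * (p + q : ℕ) = ε := by rw [he]; field_simp
  obtain ⟨κ, hκ, h⟩ := habc.log_le he0
  have hlK : 0 ≤ Real.log K := Real.log_nonneg hK
  refine ⟨κ + (1 + e) * Real.log K, by positivity, fun X hX R hR hprime => ?_⟩
  have hX0 : 0 < X := by omega
  have hXr : (0 : ℝ) < X := by exact_mod_cast hX0
  have hX1 : (1 : ℝ) ≤ X := by exact_mod_cast hX0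
  have hlX : 0 ≤ Real.log X := Real.log_nonneg hX1
  have hpX : (p : ℝ) * (1 / X) < 1 := by
    rw [mul_one_div, div_lt_one hXr]; exact_mod_cast hX
  by_cases hcase : 2 * Real.log X ≤ Real.log R
  · have : 0 ≤ κ + (1 + e) * Real.log K := by positivity
    nlinarith
  push Not at hcase
  have hlt := tangent_lt_one hp hq (one_div_pos.2 hXr) hpX
  have hb := hbd (1 / X) (by
    rw [abs_of_pos (one_div_pos.2 hXr), div_le_one hXr]; exact hX1)
  set C : ℤ := X ^ (p + q) - (X + q) ^ p * (X - p) ^ q with hC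
  have hCr : (C : ℝ) = X ^ (p + q) * (1 - (1 + q * (1 / X)) ^ p * (1 - p * (1 / X)) ^ q) := by
    have a1 : (1 : ℝ) + q * (1 / X) = (X + q) / X := by field_simp
    have a2 : (1 : ℝ) - p * (1 / X) = (X - p) / X := by field_simp
    rw [a1, a2, div_pow, div_pow, hC, pow_add]
    push_cast
    field_simp
    ring
  have hCpos : (0 : ℝ) < C := by
    rw [hCr]; exact mul_pos (by positivity) (by linarith)
  have hCne : C ≠ 0 := by
    intro h0; rw [h0] at hCpos; simp at hCpos
  have hCle : (C : ℝ) * X ^ 2 ≤ K * X ^ (p + q) := by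
    have := (le_abs_self _).trans hb
    have h2 := mul_le_mul_of_nonneg_left this (by positivity : (0 : ℝ) ≤ X ^ (p + q) * X ^ 2)
    have e1 : (X : ℝ) ^ (p + q) * X ^ 2 * (K * (1 / X) ^ 2) = K * X ^ (p + q) := by field_simp
    rw [e1] at h2
    rw [hCr]
    linarith
  have hlC : Real.log C + 2 * Real.log X ≤ Real.log K + (p + q : ℕ) * Real.log X := by
    have := Real.log_le_log (by positivity) hCle
    rw [Real.log_mul (by positivity) (by positivity), Real.log_mul (by positivity) (by positivity),
      Real.log_pow, Real.log_pow] at this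
    exact_mod_cast this
  have hmain := h (X ^ (p + q)) (-((X + q) ^ p * (X - p) ^ q)) C (by positivity)
    (neg_ne_zero.2 (mul_ne_zero (pow_ne_zero _ (by omega)) (pow_ne_zero _ (by omega))))
    hCne (by rw [hC]; ring) R hR (fun r hr hd => hprime r hr (by
      have hr' : Prime (r : ℤ) := Nat.prime_iff_prime_int.1 hr
      rw [mul_neg, dvd_neg] at hd
      rcases hr'.dvd_or_dvd hd with hd | hd
      · exact ((hr'.dvd_of_dvd_pow hd).mul_right _).mul_right _
      · rcases hr'.dvd_or_dvd hd with hd | hd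
        · exact ((hr'.dvd_of_dvd_pow hd).mul_left _).mul_right _
        · exact (hr'.dvd_of_dvd_pow hd).mul_left _))
  rw [Int.cast_pow, abs_of_pos (by positivity), abs_of_pos hCpos, Real.log_pow] at hmain
  have h3 : Real.log R + Real.log C ≤
      Real.log R + (Real.log K + (p + q : ℕ) * Real.log X - 2 * Real.log X) := by linarith
  have h4 := mul_le_mul_of_nonneg_left h3 (by linarith : 0 ≤ 1 + e)
  have h5 : e * Real.log R ≤ e * (2 * Real.log X) := mul_le_mul_of_nonneg_left hcase.le he0.le
  have h6 : e * (p + q : ℕ) * Real.log X = ε * Real.log X := by rw [hen]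
  nlinarith

/-- Under ABC, the radical of `(W - a) (W - b) (W - c)` for fixed `a < b < c` has size at least
`W ^ (2 - ε)`. -/
lemma ABCConjecture.log_le_of_lt_lt (habc : ABCConjecture) {a b c : ℤ} (hab : a < b) (hbc : b < c)
    {ε : ℝ} (hε : 0 < ε) (hε2 : ε < 2) :
    ∃ κ : ℝ, 0 ≤ κ ∧ ∀ W : ℤ, 0 < W → c < W → ∀ R : ℕ, R ≠ 0 →
      (∀ r : ℕ, r.Prime → (r : ℤ) ∣ (W - a) * (W - b) * (W - c) → r ∣ R) →
      (2 - ε) * Real.log W ≤ κ + Real.log R := by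
  obtain ⟨p, hp⟩ := Int.eq_ofNat_of_zero_le (by omega : 0 ≤ c - b)
  obtain ⟨q, hq⟩ := Int.eq_ofNat_of_zero_le (by omega : 0 ≤ b - a)
  obtain ⟨κ, hκ, h⟩ := habc.log_le_of_middle (p := p) (q := q) (by omega) (by omega) hε
  have hlb : 0 ≤ Real.log (1 + |(b : ℝ)|) := Real.log_nonneg (by linarith [abs_nonneg (b : ℝ)])
  refine ⟨κ + (2 - ε) * Real.log (1 + |(b : ℝ)|),
    add_nonneg hκ (mul_nonneg (by linarith) hlb), fun W hW0 hW R hR hprime => ?_⟩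
  have h1 := h (W - b) (by omega) R hR (fun r hr hd => hprime r hr (by
    have e : (W - b) * (W - b + q) * (W - b - p) = (W - a) * (W - b) * (W - c) := by
      rw [← hp, ← hq]; ring
    rwa [e] at hd))
  have hX : (1 : ℝ) ≤ ((W - b : ℤ) : ℝ) := by exact_mod_cast (by omega : 1 ≤ W - b)
  have hW1 : (0 : ℝ) < W := by exact_mod_cast hW0
  have h2 : Real.log W ≤ Real.log ((W - b : ℤ) : ℝ) + Real.log (1 + |(b : ℝ)|) := by
    rw [← Real.log_mul (by positivity) (by positivity)]
    refine Real.log_le_log hW1 ?_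
    have e : (W : ℝ) = ((W - b : ℤ) : ℝ) + b := by push_cast; ring
    nlinarith [le_abs_self (b : ℝ), abs_nonneg (b : ℝ)]
  nlinarith [mul_le_mul_of_nonneg_left h2 (by linarith : 0 ≤ 2 - ε)]

/-- Under ABC, the radical of `W (W - A) (W - B)` for fixed distinct nonzero `A, B` has size at
least `W ^ (2 - ε)`. -/
lemma ABCConjecture.log_le_of_ne (habc : ABCConjecture) {A B : ℤ} (hA : A ≠ 0) (hB : B ≠ 0)
    (hAB : A ≠ B) {ε : ℝ} (hε : 0 < ε) (hε2 : ε < 2) :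
    ∃ κ : ℝ, 0 ≤ κ ∧ ∀ W : ℤ, 0 < W → |A| + |B| < W → ∀ R : ℕ, R ≠ 0 →
      (∀ r : ℕ, r.Prime → (r : ℤ) ∣ W * (W - A) * (W - B) → r ∣ R) →
      (2 - ε) * Real.log W ≤ κ + Real.log R := by
  have key : ∀ a b c : ℤ, a < b → b < c → c ≤ |A| + |B| →
      (∀ W : ℤ, (W - a) * (W - b) * (W - c) = W * (W - A) * (W - B)) →
      ∃ κ : ℝ, 0 ≤ κ ∧ ∀ W : ℤ, 0 < W → |A| + |B| < W → ∀ R : ℕ, R ≠ 0 →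
      (∀ r : ℕ, r.Prime → (r : ℤ) ∣ W * (W - A) * (W - B) → r ∣ R) →
      (2 - ε) * Real.log W ≤ κ + Real.log R := by
    intro a b c hab hbc hc he
    obtain ⟨κ, hκ, h⟩ := habc.log_le_of_lt_lt hab hbc hε hε2
    refine ⟨κ, hκ, fun W hW0 hW R hR hp => h W hW0 (by omega) R hR fun r hr hd => hp r hr ?_⟩
    rwa [he] at hd
  have h1 := le_abs_self A
  have h2 := le_abs_self B
  have h3 := abs_nonneg A
  have h4 := abs_nonneg B
  rcases lt_or_gt_of_ne hA with hA | hA <;> rcases lt_or_gt_of_ne hB with hB | hB <;>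
    rcases lt_or_gt_of_ne hAB with hAB | hAB
  · exact key A B 0 hAB hB (by omega) fun W => by ring
  · exact key B A 0 hAB hA (by omega) fun W => by ring
  · exact key A 0 B hA hB (by omega) fun W => by ring
  · omega
  · omega
  · exact key B 0 A hB hA (by omega) fun W => by ring
  · exact key 0 A B hA hAB (by omega) fun W => by ring
  · exact key 0 B A hB hAB (by omega) fun W => by ring

lemma strictAntiOn_mul_log_sub :
    StrictAntiOn (fun r : ℝ => r * Real.log r - (1 + r) * Real.log (1 + r)) (Set.Ioi 0) := by
  have hd : ∀ r : ℝ, 0 < r → HasDerivAt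
      (fun r : ℝ => r * Real.log r - (1 + r) * Real.log (1 + r))
      (Real.log r - Real.log (1 + r)) r := by
    intro r hr
    have h1 := (hasDerivAt_id r).mul (Real.hasDerivAt_log hr.ne')
    have h3 : HasDerivAt (fun r : ℝ => 1 + r) 1 r := (hasDerivAt_id r).const_add 1
    have h2 := h3.mul (h3.log (by positivity : 1 + r ≠ 0))
    have h4 := h1.sub h2
    refine h4.congr_deriv ?_
    have : 1 + r ≠ 0 := by positivity
    simp only [id]
    field_simp
    ring
  refine strictAntiOn_of_deriv_neg (convex_Ioi 0)
    (fun r hr => (hd r hr).continuousAt.continuousWithinAt) fun r hr => ?_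
  rw [interior_Ioi] at hr
  rw [(hd r hr).deriv, sub_neg]
  exact Real.log_lt_log hr (by linarith)

/-- The critical values of `X^x (X^k ± 1)` determine the ratio `x / k`. -/
lemma mul_eq_mul_of_critical_value_eq {x k u l : ℕ} (hx : 0 < x) (hk : 0 < k) (hu : 0 < u)
    (hl : 0 < l)
    (h : (x ^ x * k ^ k) ^ l * ((u + l) ^ (u + l)) ^ k
      = (u ^ u * l ^ l) ^ k * ((x + k) ^ (x + k)) ^ l) : x * l = u * k := by
  have hx' : (0 : ℝ) < x := by exact_mod_cast hx
  have hk' : (0 : ℝ) < k := by exact_mod_cast hk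
  have hu' : (0 : ℝ) < u := by exact_mod_cast hu
  have hl' : (0 : ℝ) < l := by exact_mod_cast hl
  have h1 : ((x : ℝ) ^ x * k ^ k) ^ l * ((u + l) ^ (u + l)) ^ k
      = (u ^ u * l ^ l) ^ k * ((x + k) ^ (x + k)) ^ l := by exact_mod_cast h
  have h2 := congrArg Real.log h1
  rw [Real.log_mul (by positivity) (by positivity), Real.log_mul (by positivity) (by positivity),
    Real.log_pow, Real.log_pow, Real.log_pow, Real.log_pow,
    Real.log_mul (by positivity) (by positivity), Real.log_mul (by positivity) (by positivity),
    Real.log_pow, Real.log_pow, Real.log_pow, Real.log_pow, Real.log_pow, Real.log_pow] at h2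
  push_cast at h2
  have e : ∀ a b : ℝ, 0 < a → 0 < b → b * (a / b * Real.log (a / b)
      - (1 + a / b) * Real.log (1 + a / b))
      = a * Real.log a + b * Real.log b - (a + b) * Real.log (a + b) := by
    intro a b ha hb
    rw [show 1 + a / b = (a + b) / b by field_simp; ring, Real.log_div ha.ne' hb.ne',
      Real.log_div (by positivity) hb.ne']
    field_simp
    ring
  have h3 : (x : ℝ) / k = u / l := by
    refine strictAntiOn_mul_log_sub.injOn (Set.mem_Ioi.2 (by positivity))
      (Set.mem_Ioi.2 (by positivity)) ?_
    have e1 := e x k hx' hk'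
    have e2 := e u l hu' hl'
    refine mul_left_cancel₀ (by positivity : (k : ℝ) * l ≠ 0) ?_
    linear_combination (l : ℝ) * e1 - (k : ℝ) * e2 + h2
  rw [div_eq_div_iff hk'.ne' hl'.ne'] at h3
  exact_mod_cast h3

lemma pow_add_sign_bounds {s : ℤ} (hs : s = 1 ∨ s = -1) {n k : ℕ} (hn : 2 ≤ n) (hk : 0 < k) :
    1 ≤ (n : ℤ) ^ k + s ∧ (n : ℤ) ^ k ≤ 2 * ((n : ℤ) ^ k + s) ∧
      (n : ℤ) ^ k + s ≤ 2 * (n : ℤ) ^ k := by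
  have h : (2 : ℤ) ≤ (n : ℤ) ^ k := by
    have := Nat.pow_le_pow_left hn k
    have h2 := Nat.pow_le_pow_right (by norm_num : 0 < 2) hk
    exact_mod_cast (by omega : 2 ≤ n ^ k)
  rcases hs with rfl | rfl <;> refine ⟨?_, ?_, ?_⟩ <;> linarith

/-- The critical points of `X^x (X^k + s)` give a square factor. -/
lemma critical_sq_dvd (s : ℤ) (x k : ℕ) (g : ℤ) (l : ℕ) (hx : 0 < x) (hk : 0 < k) :
    (((x + k : ℕ) : ℤ) * g ^ k + s * x) ^ 2 ∣
      (((x + k : ℕ) : ℤ) ^ (x + k)) ^ l * (g ^ x * (g ^ k + s)) ^ (k * l)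
        - ((-(s * x)) ^ x * (s * k) ^ k) ^ l := by
  set T := ((x + k : ℕ) : ℤ) * g ^ k + s * x with hT
  have e : ((x + k : ℕ) : ℤ) ^ (x + k) * (g ^ x * (g ^ k + s)) ^ k
      = (T + -(s * x)) ^ x * (T + s * k) ^ k := by
    have e1 : T + -(s * x) = ((x + k : ℕ) : ℤ) * g ^ k := by rw [hT]; ring
    have e2 : T + s * k = ((x + k : ℕ) : ℤ) * (g ^ k + s) := by rw [hT]; push_cast; ring
    rw [e1, e2, mul_pow, mul_pow, mul_pow, pow_add]
    ring
  have h1 : T ^ 2 ∣ (T + -(s * x)) ^ x * (T + s * k) ^ k - (-(s * x)) ^ x * (s * k) ^ k := by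
    obtain ⟨a, ha⟩ := Polynomial.powAddExpansion (-(s * x)) T x
    obtain ⟨b, hb⟩ := Polynomial.powAddExpansion (s * (k : ℤ)) T k
    obtain ⟨x, rfl⟩ := Nat.exists_eq_succ_of_ne_zero hx.ne'
    obtain ⟨k, rfl⟩ := Nat.exists_eq_succ_of_ne_zero hk.ne'
    rw [add_comm T, add_comm T, ha, hb]
    simp only [Nat.succ_sub_one, Nat.succ_eq_add_one]
    generalize ht : -(s * ((x + 1 : ℕ) : ℤ)) = P
    generalize hq : s * ((k + 1 : ℕ) : ℤ) = Q
    have hz : ((x + 1 : ℕ) : ℤ) * Q + ((k + 1 : ℕ) : ℤ) * P = 0 := by rw [← ht, ← hq]; ring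
    refine ⟨b * P ^ (x + 1) + a * Q ^ (k + 1)
      + ((x + 1 : ℕ) : ℤ) * P ^ x * (((k + 1 : ℕ) : ℤ) * Q ^ k)
      + ((x + 1 : ℕ) : ℤ) * P ^ x * T * b + ((k + 1 : ℕ) : ℤ) * Q ^ k * T * a
      + a * b * T ^ 2, ?_⟩
    linear_combination (P ^ x * Q ^ k * T) * hz
  have h2 := h1.trans (sub_dvd_pow_sub_pow ((T + -(s * x)) ^ x * (T + s * k) ^ k)
    ((-(s * x)) ^ x * (s * k) ^ k) l)
  rwa [← e, mul_pow, ← pow_mul (g ^ x * (g ^ k + s))] at h2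

lemma pow_le_critical {s : ℤ} {k : ℕ} (x : ℕ) {g : ℤ} (hk : 0 < k) (hg : 1 ≤ g)
    (h : 0 ≤ g ^ k + s) : g ^ k ≤ ((x + k : ℕ) : ℤ) * g ^ k + s * x := by
  have e : ((x + k : ℕ) : ℤ) * g ^ k + s * x = k * g ^ k + x * (g ^ k + s) := by push_cast; ring
  rw [e]
  have h1 : (1 : ℤ) ≤ k := by exact_mod_cast hk
  have h2 : 0 ≤ g ^ k := by positivity
  have h3 : 0 ≤ (x : ℤ) * (g ^ k + s) := by positivity
  nlinarith

set_option maxHeartbeats 800000 in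
/-- For fixed, non-proportional exponents, ABC shows that `h ^ l` is essentially bounded by `g`
for the solutions of `g^x (g^k + s) = h^u (h^l + s)`. -/
lemma ABCConjecture.fixed_exponents_le (habc : ABCConjecture) {s : ℤ} (hs : s = 1 ∨ s = -1)
    {x k u l : ℕ} (hx : 0 < x) (hk : 0 < k) (hu : 0 < u) (hl : 0 < l) (hne : x * l ≠ u * k)
    {ε : ℝ} (hε : 0 < ε) :
    ∃ κ : ℝ, 0 ≤ κ ∧ ∀ g h : ℕ, 2 ≤ g → 2 ≤ h →
      (g : ℤ) ^ x * ((g : ℤ) ^ k + s) = (h : ℤ) ^ u * ((h : ℤ) ^ l + s) →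
      l * Real.log h ≤ Real.log g +
        ε * Real.log (((g : ℤ) ^ x * ((g : ℤ) ^ k + s) : ℤ) : ℝ) + κ := by
  have hs0 : s ≠ 0 := by rcases hs with rfl | rfl <;> norm_num
  have hsabs : |s| = 1 := by rcases hs with rfl | rfl <;> norm_num
  obtain ⟨N₁, hN₁⟩ : ∃ z : ℤ, z = ((x + k : ℕ) : ℤ) ^ (x + k) := ⟨_, rfl⟩
  obtain ⟨N₂, hN₂⟩ : ∃ z : ℤ, z = ((u + l : ℕ) : ℤ) ^ (u + l) := ⟨_, rfl⟩
  have hN₁p : 1 ≤ N₁ := by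
    rw [hN₁]; exact one_le_pow₀ (by exact_mod_cast (by omega : 1 ≤ x + k))
  have hN₂p : 1 ≤ N₂ := by
    rw [hN₂]; exact one_le_pow₀ (by exact_mod_cast (by omega : 1 ≤ u + l))
  obtain ⟨c₁, hc₁⟩ : ∃ z : ℤ, z = (-(s * x)) ^ x * (s * k) ^ k := ⟨_, rfl⟩
  obtain ⟨c₂, hc₂⟩ : ∃ z : ℤ, z = (-(s * u)) ^ u * (s * l) ^ l := ⟨_, rfl⟩
  have hc₁0 : c₁ ≠ 0 := by
    rw [hc₁]
    refine mul_ne_zero (pow_ne_zero _ (neg_ne_zero.2 (mul_ne_zero hs0 ?_)))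
      (pow_ne_zero _ (mul_ne_zero hs0 ?_)) <;> exact_mod_cast (by omega)
  have hc₂0 : c₂ ≠ 0 := by
    rw [hc₂]
    refine mul_ne_zero (pow_ne_zero _ (neg_ne_zero.2 (mul_ne_zero hs0 ?_)))
      (pow_ne_zero _ (mul_ne_zero hs0 ?_)) <;> exact_mod_cast (by omega)
  obtain ⟨A, hA⟩ : ∃ z : ℤ, z = c₁ ^ l * N₂ ^ k := ⟨_, rfl⟩
  obtain ⟨B, hB⟩ : ∃ z : ℤ, z = c₂ ^ k * N₁ ^ l := ⟨_, rfl⟩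
  have hA0 : A ≠ 0 := hA ▸ mul_ne_zero (pow_ne_zero _ hc₁0) (pow_ne_zero _ (by omega))
  have hB0 : B ≠ 0 := hB ▸ mul_ne_zero (pow_ne_zero _ hc₂0) (pow_ne_zero _ (by omega))
  have hAB : A ≠ B := by
    intro h
    apply hne
    apply mul_eq_mul_of_critical_value_eq hx hk hu hl
    have h2 := congrArg (fun z : ℤ => |z|) h
    simp only [hA, hB, hc₁, hc₂, hN₁, hN₂, abs_mul, abs_pow, abs_neg, hsabs, one_mul,
      Nat.abs_cast] at h2
    exact_mod_cast h2
  have hkl : (0 : ℝ) < (k * l : ℕ) := by exact_mod_cast Nat.mul_pos hk hl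
  set e := min 1 (ε / (k * l : ℕ)) with he
  have he0 : 0 < e := lt_min one_pos (div_pos hε hkl)
  have hekl : e * (k * l : ℕ) ≤ ε := by
    have := min_le_right 1 (ε / (k * l : ℕ))
    rw [← he] at this
    rwa [le_div_iff₀ hkl] at this
  have he1 : e ≤ 1 := min_le_left _ _
  obtain ⟨κ, hκ, hmain⟩ := habc.log_le_of_ne hA0 hB0 hAB he0 (by linarith)
  set M : ℝ := Real.log ((N₁ ^ l * N₂ ^ k : ℤ) : ℝ) with hM
  have hM0 : 0 ≤ M := Real.log_nonneg (by
    exact_mod_cast one_le_mul_of_one_le_of_one_le (one_le_pow₀ hN₁p) (one_le_pow₀ hN₂p))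
  have hN₁l : 0 ≤ Real.log (N₁ : ℝ) := Real.log_nonneg (by exact_mod_cast hN₁p)
  have hN₂l : 0 ≤ Real.log (N₂ : ℝ) := Real.log_nonneg (by exact_mod_cast hN₂p)
  have hl2 : 0 ≤ Real.log 2 := Real.log_nonneg (by norm_num)
  have hABl : 0 ≤ Real.log ((|A| + |B| : ℤ) : ℝ) := Real.log_nonneg (by
    have := abs_pos.2 hA0
    have := abs_pos.2 hB0
    exact_mod_cast (by omega : 1 ≤ |A| + |B|))
  refine ⟨κ + M + Real.log N₁ + Real.log N₂ + 3 * Real.log 2 + Real.log ((|A| + |B| : ℤ) : ℝ),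
    by positivity, fun g h hg hh heq => ?_⟩
  obtain ⟨bg1, bg2, bg3⟩ := pow_add_sign_bounds hs hg hk
  obtain ⟨bh1, bh2, bh3⟩ := pow_add_sign_bounds hs hh hl
  have hg1 : (1 : ℤ) ≤ g := by exact_mod_cast (by omega : 1 ≤ g)
  have hh1 : (1 : ℤ) ≤ h := by exact_mod_cast (by omega : 1 ≤ h)
  obtain ⟨d, hd⟩ : ∃ z : ℤ, z = (g : ℤ) ^ x * ((g : ℤ) ^ k + s) := ⟨_, rfl⟩
  rw [← hd] at heq ⊢
  have hd1 : 1 ≤ d := hd ▸ one_le_mul_of_one_le_of_one_le (one_le_pow₀ hg1) bg1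
  have hld : 0 ≤ Real.log (d : ℝ) := Real.log_nonneg (by exact_mod_cast hd1)
  have hgl : 0 ≤ Real.log (g : ℝ) := Real.log_nonneg (by exact_mod_cast hg1)
  have hhd : (h : ℤ) ^ l ≤ d := by
    have : (2 : ℤ) ≤ (h : ℤ) ^ u := by
      have h1 := Nat.pow_le_pow_left hh u
      have h2 := Nat.pow_le_pow_right (by norm_num : 0 < 2) hu
      exact_mod_cast (by omega : 2 ≤ h ^ u)
    nlinarith
  have hlhd : l * Real.log h ≤ Real.log d := by
    rw [← Real.log_pow]
    refine Real.log_le_log (by have : 0 < h := by omega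
                               positivity) (by exact_mod_cast hhd)
  obtain ⟨W, hW⟩ : ∃ z : ℤ, z = N₁ ^ l * N₂ ^ k * d ^ (k * l) := ⟨_, rfl⟩
  have hdW : d ≤ W := by
    have h1 : d ≤ d ^ (k * l) := le_self_pow₀ hd1 (Nat.mul_pos hk hl).ne'
    have h2 : 1 ≤ N₁ ^ l * N₂ ^ k :=
      one_le_mul_of_one_le_of_one_le (one_le_pow₀ hN₁p) (one_le_pow₀ hN₂p)
    nlinarith
  by_cases hWAB : W ≤ |A| + |B|
  · have : Real.log (d : ℝ) ≤ Real.log ((|A| + |B| : ℤ) : ℝ) :=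
      Real.log_le_log (by exact_mod_cast hd1) (by exact_mod_cast hdW.trans hWAB)
    have : 0 ≤ ε * Real.log (d : ℝ) := by positivity
    linarith
  push Not at hWAB
  have hW0 : 0 < W := by omega
  obtain ⟨T₁, hT₁⟩ : ∃ z : ℤ, z = ((x + k : ℕ) : ℤ) * (g : ℤ) ^ k + s * x := ⟨_, rfl⟩
  obtain ⟨T₂, hT₂⟩ : ∃ z : ℤ, z = ((u + l : ℕ) : ℤ) * (h : ℤ) ^ l + s * u := ⟨_, rfl⟩
  have hT₁g : (g : ℤ) ^ k ≤ T₁ :=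
    hT₁ ▸ pow_le_critical x hk hg1 (by omega)
  have hT₂h : (h : ℤ) ^ l ≤ T₂ :=
    hT₂ ▸ pow_le_critical u hl hh1 (by omega)
  have hgk : 1 ≤ (g : ℤ) ^ k := one_le_pow₀ hg1
  have hhl : 1 ≤ (h : ℤ) ^ l := one_le_pow₀ hh1
  obtain ⟨a, ha⟩ : T₁ ^ 2 ∣ W - A := by
    have := (critical_sq_dvd s x k g l hx hk).mul_right (N₂ ^ k)
    rw [← hd, ← hN₁, ← hc₁, ← hT₁] at this
    have e1 : W - A = (N₁ ^ l * d ^ (k * l) - c₁ ^ l) * N₂ ^ k := by rw [hW, hA]; ring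
    rw [e1]
    exact this
  obtain ⟨b, hb⟩ : T₂ ^ 2 ∣ W - B := by
    have := (critical_sq_dvd s u l h k hu hl).mul_right (N₁ ^ l)
    rw [← heq, ← hN₂, ← hc₂, ← hT₂] at this
    have e1 : W - B = (N₂ ^ k * d ^ (l * k) - c₂ ^ k) * N₁ ^ l := by rw [hW, hB]; ring
    rw [e1]
    exact this
  have hAl := neg_abs_le A
  have hBl := neg_abs_le B
  have hAu := le_abs_self A
  have hBu := le_abs_self B
  have hAn := abs_nonneg A
  have hBn := abs_nonneg B
  have ha0 : 0 < a := by
    by_contra hcon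
    have := mul_nonpos_of_nonneg_of_nonpos (sq_nonneg T₁) (not_lt.1 hcon)
    omega
  have hb0 : 0 < b := by
    by_contra hcon
    have := mul_nonpos_of_nonneg_of_nonpos (sq_nonneg T₂) (not_lt.1 hcon)
    omega
  have hT₁0 : 0 < T₁ := by omega
  have hT₂0 : 0 < T₂ := by omega
  obtain ⟨R, hR⟩ : ∃ z : ℤ, z = N₁ * N₂ * (g * ((g : ℤ) ^ k + s)) * (T₁ * a) * (T₂ * b) := ⟨_, rfl⟩
  have hR0 : 0 < R := by
    have : 0 < (g : ℤ) ^ k + s := by omega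
    have : (0 : ℤ) < g := by omega
    have : 0 < N₁ := by omega
    have : 0 < N₂ := by omega
    rw [hR]
    positivity
  have h1 := hmain W hW0 hWAB R.natAbs (by omega) (fun r hr hrd => by
    have hr' : Prime (r : ℤ) := Nat.prime_iff_prime_int.1 hr
    refine Int.natCast_dvd.1 ?_
    rw [ha, hb] at hrd
    rw [hR]
    rcases hr'.dvd_or_dvd hrd with hrd | hrd
    · rcases hr'.dvd_or_dvd hrd with hrd | hrd
      · have hcases : (r : ℤ) ∣ N₁ * N₂ * (g * ((g : ℤ) ^ k + s)) := by
          rw [hW] at hrd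
          rcases hr'.dvd_or_dvd hrd with hrd | hrd
          · rcases hr'.dvd_or_dvd hrd with hrd | hrd
            · exact ((hr'.dvd_of_dvd_pow hrd).mul_right _).mul_right _
            · exact ((hr'.dvd_of_dvd_pow hrd).mul_left _).mul_right _
          · have hrd := hr'.dvd_of_dvd_pow hrd
            rw [hd] at hrd
            rcases hr'.dvd_or_dvd hrd with hrd | hrd
            · exact ((hr'.dvd_of_dvd_pow hrd).mul_right _).mul_left _
            · exact (hrd.mul_left _).mul_left _
        exact (hcases.mul_right _).mul_right _
      · have : (r : ℤ) ∣ T₁ * a := by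
          rcases hr'.dvd_or_dvd hrd with hrd | hrd
          · exact (hr'.dvd_of_dvd_pow hrd).mul_right _
          · exact hrd.mul_left _
        exact (this.mul_left _).mul_right _
    · have : (r : ℤ) ∣ T₂ * b := by
        rcases hr'.dvd_or_dvd hrd with hrd | hrd
        · exact (hr'.dvd_of_dvd_pow hrd).mul_right _
        · exact hrd.mul_left _
      exact this.mul_left _)
  have hRr : ((R.natAbs : ℕ) : ℝ) = (R : ℝ) := by
    rw [Nat.cast_natAbs, abs_of_pos hR0]
  have pN₁ : (0 : ℝ) < N₁ := by exact_mod_cast hN₁p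
  have pN₂ : (0 : ℝ) < N₂ := by exact_mod_cast hN₂p
  have pg : (0 : ℝ) < g := by exact_mod_cast hg1
  have ph : (0 : ℝ) < h := by exact_mod_cast hh1
  have pgs : (0 : ℝ) < (((g : ℤ) ^ k + s : ℤ) : ℝ) := by exact_mod_cast bg1
  have pT₁ : (0 : ℝ) < T₁ := by exact_mod_cast hT₁0
  have pT₂ : (0 : ℝ) < T₂ := by exact_mod_cast hT₂0
  have pa : (0 : ℝ) < a := by exact_mod_cast ha0
  have pb : (0 : ℝ) < b := by exact_mod_cast hb0
  have pW : (0 : ℝ) < W := by exact_mod_cast hW0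
  have pd : (0 : ℝ) < d := by exact_mod_cast hd1
  have hlR : Real.log R = Real.log N₁ + Real.log N₂ +
      (Real.log g + Real.log (((g : ℤ) ^ k + s : ℤ) : ℝ)) + (Real.log T₁ + Real.log a)
      + (Real.log T₂ + Real.log b) := by
    have : (R : ℝ) = N₁ * N₂ * (g * (((g : ℤ) ^ k + s : ℤ) : ℝ)) * (T₁ * a) * (T₂ * b) := by
      rw [hR]; push_cast; ring
    rw [this, Real.log_mul (by positivity) (by positivity),
      Real.log_mul (by positivity) (by positivity), Real.log_mul (by positivity) (by positivity),
      Real.log_mul (by positivity) (by positivity), Real.log_mul (by positivity) (by positivity),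
      Real.log_mul (by positivity) (by positivity), Real.log_mul (by positivity) (by positivity)]
  have q1 : 2 * Real.log T₁ + Real.log a ≤ Real.log 2 + Real.log W := by
    have e1 : 2 * Real.log T₁ + Real.log a = Real.log ((T₁ : ℝ) ^ 2 * a) := by
      rw [Real.log_mul (by positivity) (by positivity), Real.log_pow]; norm_num
    rw [e1, ← Real.log_mul (by norm_num) pW.ne']
    refine Real.log_le_log (by positivity) ?_
    exact_mod_cast (by rw [← ha]; omega : T₁ ^ 2 * a ≤ 2 * W)
  have q2 : 2 * Real.log T₂ + Real.log b ≤ Real.log 2 + Real.log W := by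
    have e1 : 2 * Real.log T₂ + Real.log b = Real.log ((T₂ : ℝ) ^ 2 * b) := by
      rw [Real.log_mul (by positivity) (by positivity), Real.log_pow]; norm_num
    rw [e1, ← Real.log_mul (by norm_num) pW.ne']
    refine Real.log_le_log (by positivity) ?_
    exact_mod_cast (by rw [← hb]; omega : T₂ ^ 2 * b ≤ 2 * W)
  have q3 : k * Real.log g ≤ Real.log T₁ := by
    rw [← Real.log_pow]
    exact Real.log_le_log (by positivity) (by exact_mod_cast hT₁g)
  have q4 : l * Real.log h ≤ Real.log T₂ := by
    rw [← Real.log_pow]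
    exact Real.log_le_log (by positivity) (by exact_mod_cast hT₂h)
  have q5 : Real.log (((g : ℤ) ^ k + s : ℤ) : ℝ) ≤ Real.log 2 + k * Real.log g := by
    rw [← Real.log_pow, ← Real.log_mul (by norm_num) (by positivity)]
    exact Real.log_le_log pgs (by exact_mod_cast bg3)
  have q6 : Real.log W = M + (k * l : ℕ) * Real.log d := by
    rw [hM, ← Real.log_pow, ← Real.log_mul (by
      have : (0 : ℤ) < N₁ ^ l * N₂ ^ k := by positivity
      exact_mod_cast this.ne') (by positivity)]
    rw [hW]; push_cast; rfl
  rw [hRr, hlR] at h1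
  have q7 : e * Real.log W ≤ M + ε * Real.log d := by
    rw [q6]
    nlinarith [mul_le_mul_of_nonneg_right hekl hld]
  have q8 : (2 - e) * Real.log W = 2 * Real.log W - e * Real.log W := by ring
  linarith

lemma eq_of_pow_eq_pow_of_not_isPerfectPow {g h k l : ℕ} (hg : 2 ≤ g) (hh : 2 ≤ h)
    (hgp : ¬ IsPerfectPow g) (hhp : ¬ IsPerfectPow h) (hk : 0 < k)
    (e : g ^ k = h ^ l) : g = h ∧ k = l := by
  have one : ∀ {n c m : ℕ}, 2 ≤ n → ¬ IsPerfectPow n → n = c ^ m → m = 1 := by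
    intro n c m hn hnp hc
    by_contra hm
    have h0 : m ≠ 0 := by rintro rfl; simp at hc; omega
    refine hnp ⟨c, m, ?_, by omega, hc⟩
    by_contra hc2
    have : c = 0 ∨ c = 1 := by omega
    rcases this with rfl | rfl
    · rw [zero_pow h0] at hc; omega
    · rw [one_pow] at hc; omega
  obtain ⟨c, hc1, hc2⟩ := Nat.exists_eq_pow_of_pow_eq_pow (Or.inl hk.ne') e
  have h1 := one hg hgp hc1
  have h2 := one hh hhp hc2
  have hgh : g = h := by rw [hc1, hc2, h1, h2]
  subst hgh
  exact ⟨rfl, Nat.pow_right_injective hg e⟩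

lemma not_pow_lt_pow_of_proportional {s : ℤ} (hs : s = 1 ∨ s = -1) {g h x k u l : ℕ}
    (hg : 2 ≤ g) (hu : 0 < u) (hk : 0 < k) (hp : x * l = u * k)
    (e : (g : ℤ) ^ x * ((g : ℤ) ^ k + s) = (h : ℤ) ^ u * ((h : ℤ) ^ l + s)) :
    ¬ g ^ k < h ^ l := by
  intro hlt
  have h1 : g ^ x < h ^ u := by
    refine lt_of_pow_lt_pow_left₀ l (Nat.zero_le _) ?_
    rw [← pow_mul, hp, mul_comm u k, pow_mul, ← pow_mul h, mul_comm u l, pow_mul]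
    exact Nat.pow_lt_pow_left hlt hu.ne'
  have h2 : (g : ℤ) ^ k + s < (h : ℤ) ^ l + s := by
    have : (g : ℤ) ^ k < (h : ℤ) ^ l := by exact_mod_cast hlt
    linarith
  have h3 : (g : ℤ) ^ x < (h : ℤ) ^ u := by exact_mod_cast h1
  have h4 := (pow_add_sign_bounds hs hg hk).1
  exact (mul_lt_mul'' h3 h2 (by positivity) (by linarith)).ne e

/-- Solutions with proportional exponents coincide. -/
lemma eq_of_proportional {s : ℤ} (hs : s = 1 ∨ s = -1) {g h x k u l : ℕ}
    (hg : 2 ≤ g) (hh : 2 ≤ h) (hgp : ¬ IsPerfectPow g) (hhp : ¬ IsPerfectPow h)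
    (hx : 0 < x) (hk : 0 < k) (hu : 0 < u) (hl : 0 < l) (hp : x * l = u * k)
    (e : (g : ℤ) ^ x * ((g : ℤ) ^ k + s) = (h : ℤ) ^ u * ((h : ℤ) ^ l + s)) :
    g = h ∧ x = u ∧ k = l := by
  have h1 := not_pow_lt_pow_of_proportional hs hg hu hk hp e
  have h2 := not_pow_lt_pow_of_proportional hs hh hx hl hp.symm e.symm
  obtain ⟨rfl, rfl⟩ := eq_of_pow_eq_pow_of_not_isPerfectPow (l := l) hg hh hgp hhp hk (by omega)
  exact ⟨rfl, Nat.eq_of_mul_eq_mul_right hk hp, rfl⟩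

lemma log_value_bounds {s : ℤ} (hs : s = 1 ∨ s = -1) {g x k : ℕ} (hg : 2 ≤ g) (hk : 0 < k) :
    (x + k) * Real.log g ≤ Real.log (((g : ℤ) ^ x * ((g : ℤ) ^ k + s) : ℤ) : ℝ) + 1 ∧
    Real.log (((g : ℤ) ^ x * ((g : ℤ) ^ k + s) : ℤ) : ℝ) ≤ (x + k) * Real.log g + 1 := by
  obtain ⟨h1, h2, h3⟩ := pow_add_sign_bounds hs hg hk
  have hl2 : Real.log 2 ≤ 1 := by linarith [Real.log_two_lt_d9]
  have pg : (0 : ℝ) < g := by exact_mod_cast (by omega : 0 < g)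
  have p1 : (0 : ℝ) < (((g : ℤ) ^ k + s : ℤ) : ℝ) := by exact_mod_cast h1
  have e : Real.log (((g : ℤ) ^ x * ((g : ℤ) ^ k + s) : ℤ) : ℝ)
      = x * Real.log g + Real.log (((g : ℤ) ^ k + s : ℤ) : ℝ) := by
    rw [← Real.log_pow, ← Real.log_mul (by positivity) p1.ne']
    push_cast; rfl
  have q2 : k * Real.log g ≤ Real.log 2 + Real.log (((g : ℤ) ^ k + s : ℤ) : ℝ) := by
    rw [← Real.log_pow, ← Real.log_mul (by norm_num) p1.ne']
    exact Real.log_le_log (by positivity) (by exact_mod_cast h2)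
  have q3 : Real.log (((g : ℤ) ^ k + s : ℤ) : ℝ) ≤ Real.log 2 + k * Real.log g := by
    rw [← Real.log_pow, ← Real.log_mul (by norm_num) (by positivity)]
    exact Real.log_le_log p1 (by exact_mod_cast h3)
  rw [e]
  constructor <;> linarith

set_option maxHeartbeats 800000 in
/-- For fixed non-proportional exponents, ABC bounds the common values of
`g^x (g^k + s)` and `h^u (h^l + s)`. -/
lemma ABCConjecture.exists_bound_fixed_exponents (habc : ABCConjecture) {s : ℤ}
    (hs : s = 1 ∨ s = -1) (x k u l : ℕ) :
    ∃ L₀ : ℝ, 0 < x → 0 < k → 0 < u → 0 < l → x * l ≠ u * k → ∀ g h : ℕ, 2 ≤ g → 2 ≤ h →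
      (g : ℤ) ^ x * ((g : ℤ) ^ k + s) = (h : ℤ) ^ u * ((h : ℤ) ^ l + s) →
      Real.log (((g : ℤ) ^ x * ((g : ℤ) ^ k + s) : ℤ) : ℝ) ≤ L₀ := by
  by_cases hpos : 0 < x ∧ 0 < k ∧ 0 < u ∧ 0 < l ∧ x * l ≠ u * k
  swap
  · exact ⟨0, fun h1 h2 h3 h4 h5 => absurd ⟨h1, h2, h3, h4, h5⟩ hpos⟩
  obtain ⟨hx, hk, hu, hl, hne⟩ := hpos
  have hx' : (1 : ℝ) ≤ x := by exact_mod_cast hx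
  have hk' : (1 : ℝ) ≤ k := by exact_mod_cast hk
  have hu' : (1 : ℝ) ≤ u := by exact_mod_cast hu
  have hl' : (1 : ℝ) ≤ l := by exact_mod_cast hl
  set S : ℝ := x + k + u + l with hS
  have hS0 : 0 < S := by positivity
  set ε : ℝ := 1 / (4 * S ^ 2) with hε
  have hε0 : 0 < ε := by positivity
  have hεS : ε * S ^ 2 = 1 / 4 := by rw [hε]; field_simp
  obtain ⟨κ₁, hκ₁, f₁⟩ := habc.fixed_exponents_le hs hx hk hu hl hne hε0
  obtain ⟨κ₂, hκ₂, f₂⟩ := habc.fixed_exponents_le hs hu hl hx hk hne.symm hε0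
  refine ⟨4 * S ^ 2 * (κ₁ + κ₂ + 1), fun _ _ _ _ _ g h hg hh e => ?_⟩
  have a₁ := f₁ g h hg hh e
  have a₂ := f₂ h g hh hg e.symm
  obtain ⟨b₁, b₂⟩ := log_value_bounds (x := x) hs hg hk
  obtain ⟨b₃, b₄⟩ := log_value_bounds (x := u) hs hh hl
  rw [← e] at a₂ b₃ b₄
  have hG : 0 ≤ Real.log g := Real.log_natCast_nonneg g
  have hH : 0 ≤ Real.log h := Real.log_natCast_nonneg h
  generalize Real.log (((g : ℤ) ^ x * ((g : ℤ) ^ k + s) : ℤ) : ℝ) = L at *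
  generalize Real.log (g : ℝ) = G at *
  generalize Real.log (h : ℝ) = H at *
  have hS4 : 4 ≤ S := by linarith
  rcases le_or_gt L 0 with hL | hL
  · exact hL.trans (by positivity)
  set κ := κ₁ + κ₂ with hκ
  have hκ0 : 0 ≤ κ := by positivity
  have hδ : 0 < ε * L := by positivity
  have hSS : ε * L * S ^ 2 = L / 4 := by linear_combination L * hεS
  have hSδ : ε * L * S ≤ L / 16 := by
    have := mul_le_mul_of_nonneg_left hS4 (by positivity : 0 ≤ ε * L * S)
    linarith
  have hSκ : S * κ ≤ S ^ 2 * κ :=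
    mul_le_mul_of_nonneg_right (le_self_pow₀ (by linarith) two_ne_zero) hκ0
  have hkG : G ≤ k * G := le_mul_of_one_le_left hG hk'
  have hlH : H ≤ l * H := le_mul_of_one_le_left hH hl'
  have hxS : (x + k) * G ≤ S * G := mul_le_mul_of_nonneg_right (by linarith) hG
  have huS : (u + l) * H ≤ S * H := mul_le_mul_of_nonneg_right (by linarith) hH
  have fin : ∀ t : ℝ, t ≤ 2 * (ε * L) + κ → L ≤ S * t + 1 → L ≤ 4 * S ^ 2 * (κ + 1) := by
    intro t h1 h2
    have h3 := mul_le_mul_of_nonneg_left h1 hS0.le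
    have h4 : 0 ≤ S ^ 2 * κ := by positivity
    have h5 : 16 ≤ S ^ 2 := by nlinarith
    linarith
  have fin' : ∀ t : ℝ, t ≤ 2 + S * (ε * L + κ) → L ≤ S * t + 1 → L ≤ 4 * S ^ 2 * (κ + 1) := by
    intro t h1 h2
    have h3 := mul_le_mul_of_nonneg_left h1 hS0.le
    have h4 : 0 ≤ S ^ 2 * κ := by positivity
    have h5 : 4 * S ≤ S ^ 2 := by nlinarith
    linarith
  by_cases hk2 : 2 ≤ k
  · have hk2' : (2 : ℝ) ≤ k := by exact_mod_cast hk2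
    have : 2 * G ≤ k * G := mul_le_mul_of_nonneg_right hk2' hG
    exact fin G (by linarith) (by linarith)
  by_cases hl2 : 2 ≤ l
  · have hl2' : (2 : ℝ) ≤ l := by exact_mod_cast hl2
    have : 2 * H ≤ l * H := mul_le_mul_of_nonneg_right hl2' hH
    exact fin H (by linarith) (by linarith)
  have hk1 : k = 1 := by omega
  have hl1 : l = 1 := by omega
  rw [hk1, hl1] at hne
  subst hk1 hl1
  push_cast at *
  rcases lt_or_gt_of_ne (by omega : x ≠ u) with hlt | hlt
  · have hlt' : (x : ℝ) + 1 ≤ u := by exact_mod_cast hlt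
    have i1 : (x + 1) * G ≤ (x + 1) * (H + (ε * L + κ)) :=
      mul_le_mul_of_nonneg_left (by linarith) (by positivity)
    have i2 : (x + 1) * (ε * L + κ) ≤ S * (ε * L + κ) :=
      mul_le_mul_of_nonneg_right (by linarith) (by positivity)
    have i3 : (x + 1 + 1) * H ≤ (u + 1) * H := mul_le_mul_of_nonneg_right (by linarith) hH
    exact fin' H (by linarith) (by linarith)
  · have hlt' : (u : ℝ) + 1 ≤ x := by exact_mod_cast hlt
    have i1 : (u + 1) * H ≤ (u + 1) * (G + (ε * L + κ)) :=
      mul_le_mul_of_nonneg_left (by linarith) (by positivity)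
    have i2 : (u + 1) * (ε * L + κ) ≤ S * (ε * L + κ) :=
      mul_le_mul_of_nonneg_right (by linarith) (by positivity)
    have i3 : (u + 1 + 1) * G ≤ (x + 1) * G := mul_le_mul_of_nonneg_right (by linarith) hG
    exact fin' G (by linarith) (by linarith)

/-- Logarithmic inequalities satisfied by a coincidence `g^x (g^k + s) = h^u (h^l + s)`, where
`g = g₁ g₂`, `h = h₁ h₂`, `g₁^x = h₁^u`, `h₂^u m = g^k + s`, `g₂^x m = h^l + s`; here
`γ, a, η, b, M` are the logarithms of `g₁, g₂, h₁, h₂, m` and `ρ` that of the radical of `g₁`. -/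
structure LogConfiguration (κ : ℝ) (x k u l : ℕ) (ρ a b γ η M : ℝ) : Prop where
  x_pos : 1 ≤ x
  k_pos : 1 ≤ k
  u_pos : 1 ≤ u
  l_pos : 1 ≤ l
  rho_nonneg : 0 ≤ ρ
  rho_le_left : ρ ≤ γ
  rho_le_right : ρ ≤ η
  left_discrete : a = 0 ∨ 1 / 2 ≤ a
  right_discrete : b = 0 ∨ 1 / 2 ≤ b
  nondegenerate : a ≠ 0 ∨ b ≠ 0
  left_large : 1 / 2 ≤ γ + a
  right_large : 1 / 2 ≤ η + b
  M_nonneg : 0 ≤ M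
  common : x * γ = u * η
  left_eq : |k * (γ + a) - (u * b + M)| ≤ 1
  right_eq : |l * (η + b) - (x * a + M)| ≤ 1
  left_abc : k * (γ + a) ≤ κ + 1001 / 1000 * (ρ + a + b + M)
  right_abc : l * (η + b) ≤ κ + 1001 / 1000 * (ρ + a + b + M)
  main_abc : x * a + u * b + M ≤ κ + 1001 / 1000 * (ρ + a + b + max (x * a) (u * b))
  left_divisor : k = 1 → 2 * ρ ≤ γ ∨
    (2 * γ ≤ l * η ∧ (2 * γ ≤ 1 + max (x * a) (u * b) ∨ γ ≤ 1 + a + u * b))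
  right_divisor : l = 1 → 2 * ρ ≤ η ∨
    (2 * η ≤ k * γ ∧ (2 * η ≤ 1 + max (u * b) (x * a) ∨ η ≤ 1 + b + x * a))
  left_square : x = 1 → k = 1 →
    (l + u) * (η + b) ≤ κ + 1001 / 1000 * ((γ + a) + (η + b) + u * (η + b))
  right_square : u = 1 → l = 1 →
    (k + x) * (γ + a) ≤ κ + 1001 / 1000 * ((η + b) + (γ + a) + x * (γ + a))
  left_cofactor : x = 1 → k = 1 →
    l * (η + b) ≤ κ + 1001 / 1000 * ((η + b) + M + max M γ)
  right_cofactor : u = 1 → l = 1 →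
    k * (γ + a) ≤ κ + 1001 / 1000 * ((γ + a) + M + max M η)

namespace LogConfiguration

variable {κ : ℝ} {x k u l : ℕ} {ρ a b γ η M : ℝ}

lemma symm (c : LogConfiguration κ x k u l ρ a b γ η M) :
    LogConfiguration κ u l x k ρ b a η γ M where
  x_pos := c.u_pos
  k_pos := c.l_pos
  u_pos := c.x_pos
  l_pos := c.k_pos
  rho_nonneg := c.rho_nonneg
  rho_le_left := c.rho_le_right
  rho_le_right := c.rho_le_left
  left_discrete := c.right_discrete
  right_discrete := c.left_discrete
  nondegenerate := c.nondegenerate.symm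
  left_large := c.right_large
  right_large := c.left_large
  M_nonneg := c.M_nonneg
  common := c.common.symm
  left_eq := c.right_eq
  right_eq := c.left_eq
  left_abc := by linarith [c.right_abc]
  right_abc := by linarith [c.left_abc]
  main_abc := by rw [max_comm]; linarith [c.main_abc]
  left_divisor := c.right_divisor
  right_divisor := c.left_divisor
  left_square := c.right_square
  right_square := c.left_square
  left_cofactor := c.right_cofactor
  right_cofactor := c.left_cofactor

lemma left_nonneg (c : LogConfiguration κ x k u l ρ a b γ η M) : 0 ≤ a := by
  rcases c.left_discrete with h | h <;> linarith

lemma bound_of_le (c : LogConfiguration κ x k u l ρ a b γ η M) (hκ : 0 ≤ κ)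
    (h : x * a ≤ u * b) :
    u * b ≤ 1003 / 1000 * (ρ + a + b) + 2 * (κ + 1) ∧
      x * a + M ≤ 1003 / 1000 * (ρ + a + b) + 2 * (κ + 1) := by
  have h1 := c.main_abc
  rw [max_eq_right h] at h1
  have h2 := c.left_abc
  have h3 := (abs_le.1 c.left_eq).1
  have h4 := c.left_nonneg
  have h5 := c.symm.left_nonneg
  have h6 := c.rho_nonneg
  have h7 : 0 ≤ x * a := by positivity
  have h8 := c.M_nonneg
  constructor <;> linarith

lemma bounds (c : LogConfiguration κ x k u l ρ a b γ η M) (hκ : 0 ≤ κ) :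
    x * a ≤ 1003 / 1000 * (ρ + a + b) + 2 * (κ + 1) ∧
    u * b ≤ 1003 / 1000 * (ρ + a + b) + 2 * (κ + 1) ∧
    M ≤ 1003 / 1000 * (ρ + a + b) + 2 * (κ + 1) := by
  have h4 := c.left_nonneg
  have h5 := c.symm.left_nonneg
  have h7 : 0 ≤ x * a := by positivity
  have h8 : 0 ≤ u * b := by positivity
  rcases le_total ((x : ℝ) * a) (u * b) with h | h
  · obtain ⟨h1, h2⟩ := c.bound_of_le hκ h
    refine ⟨?_, ?_, ?_⟩ <;> linarith
  · obtain ⟨h1, h2⟩ := c.symm.bound_of_le hκ h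
    refine ⟨?_, ?_, ?_⟩ <;> linarith

/-- The size of the conductor beyond which the additive constants are negligible. -/
def threshold (κ : ℝ) : ℝ := 1000 * (2 * κ + 3)

lemma exponents_le_of_small (c : LogConfiguration κ x k u l ρ a b γ η M) (hκ : 0 ≤ κ)
    (hσ : ρ + a + b < threshold κ) :
    (k : ℝ) ≤ 30 * threshold κ ^ 2 ∧ (x : ℝ) ≤ 30 * threshold κ ^ 2 := by
  have hT : 3000 ≤ threshold κ := by unfold threshold; linarith
  have hTκ : 2 * (κ + 1) ≤ threshold κ / 1000 := by unfold threshold; linarith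
  generalize threshold κ = T at *
  obtain ⟨b1, b2, b3⟩ := c.bounds hκ
  have hT2 : 3000 * T ≤ T ^ 2 := by nlinarith
  have e1 := (abs_le.1 c.left_eq).2
  have e2 := (abs_le.1 c.right_eq).2
  have hkG : k * (γ + a) ≤ 3 * T := by linarith
  have hlH : l * (η + b) ≤ 3 * T := by linarith
  have hk : (k : ℝ) * (1 / 2) ≤ k * (γ + a) :=
    mul_le_mul_of_nonneg_left c.left_large (by positivity)
  refine ⟨by linarith, ?_⟩
  by_contra! hx
  have hx4 : 4 * T < x := by linarith
  have ha : a = 0 := by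
    rcases c.left_discrete with h | h
    · exact h
    · have := mul_le_mul_of_nonneg_left h (by positivity : (0 : ℝ) ≤ x)
      linarith
  have hb : 1 / 2 ≤ b := c.right_discrete.resolve_left fun hb => by
    rcases c.nondegenerate with h | h <;> contradiction
  have hu : (u : ℝ) * (1 / 2) ≤ u * b := mul_le_mul_of_nonneg_left hb (by positivity)
  have hu4 : (u : ℝ) ≤ 4 * T := by linarith
  have hγ : 1 / 2 ≤ γ := by linarith [c.left_large]
  have hη : 0 ≤ η := c.rho_nonneg.trans c.rho_le_right
  have hl1 : (1 : ℝ) ≤ l := by exact_mod_cast c.l_pos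
  have hη3 : η ≤ 3 * T := by
    have := le_mul_of_one_le_left hη hl1
    have := mul_nonneg (by positivity : (0 : ℝ) ≤ l) (by linarith : 0 ≤ b)
    linarith
  have h1 : (x : ℝ) * (1 / 2) ≤ x * γ := mul_le_mul_of_nonneg_left hγ (by positivity)
  have h2 : (u : ℝ) * η ≤ 4 * T * (3 * T) := mul_le_mul hu4 hη3 hη (by linarith)
  have := c.common
  nlinarith

lemma false_of_large_of_le (c : LogConfiguration κ x k u l ρ a b γ η M) (hκ : 0 ≤ κ)
    (hσ : threshold κ ≤ ρ + a + b) (hx : 100 ≤ x) (hu : 100 ≤ u) (h : x * a ≤ u * b) : False := by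
  have hT : 3000 ≤ threshold κ := by unfold threshold; linarith
  have hTκ : 2 * (κ + 1) ≤ threshold κ / 1000 := by unfold threshold; linarith
  generalize threshold κ = T at *
  obtain ⟨b1, b2⟩ := c.bound_of_le hκ h
  have ha := c.left_nonneg
  have hb := c.symm.left_nonneg
  have hM := c.M_nonneg
  have hx' : 100 * a ≤ x * a := mul_le_mul_of_nonneg_right (by exact_mod_cast hx) ha
  have hu' : 100 * b ≤ u * b := mul_le_mul_of_nonneg_right (by exact_mod_cast hu) hb
  have hγ := c.rho_le_left
  have hη := c.rho_le_right
  have e1 := (abs_le.1 c.left_eq).2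
  have e2 := (abs_le.1 c.right_eq).2
  have hlb : 0 ≤ l * b := by positivity
  have hka : 0 ≤ k * a := by positivity
  have hl : l = 1 := by
    by_contra hl
    have hl2 : 2 ≤ l := by have := c.l_pos; omega
    have : 2 * η ≤ l * η := mul_le_mul_of_nonneg_right (by exact_mod_cast hl2) (by linarith)
    linarith
  have hlη : (l : ℝ) * η = η := by rw [hl]; simp
  rcases c.right_divisor hl with h1 | ⟨h1, h2 | h2⟩
  · linarith
  · rw [max_eq_left h] at h2
    linarith
  · linarith

lemma le_of_large_of_lt (c : LogConfiguration κ x k u l ρ a b γ η M) (hκ : 0 ≤ κ)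
    (hσ : threshold κ ≤ ρ + a + b) (hx : x < 100) :
    (x : ℝ) ≤ 30 * threshold κ ^ 2 ∧ (k : ℝ) ≤ 30 * threshold κ ^ 2 ∧
      (u : ℝ) ≤ 30 * threshold κ ^ 2 ∧ (l : ℝ) ≤ 30 * threshold κ ^ 2 := by
  have hT : 3000 ≤ threshold κ := by unfold threshold; linarith
  have hTκ : 2 * (κ + 1) ≤ threshold κ / 1000 := by unfold threshold; linarith
  generalize threshold κ = T at *
  obtain ⟨σ, hσ'⟩ : ∃ σ : ℝ, σ = ρ + a + b := ⟨_, rfl⟩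
  obtain ⟨b1, b2, b3⟩ := c.bounds hκ
  rw [← hσ'] at b1 b2 b3 hσ
  have ha := c.left_nonneg
  have hb := c.symm.left_nonneg
  have hρ := c.rho_nonneg
  have hM := c.M_nonneg
  have hγρ := c.rho_le_left
  have hηρ := c.rho_le_right
  have hγ : 0 ≤ γ := hρ.trans hγρ
  have hη : 0 ≤ η := hρ.trans hηρ
  have hσ0 : 0 < σ := by linarith
  have hT2 : 3000 * T ≤ T ^ 2 := by nlinarith
  have e1 := abs_le.1 c.left_eq
  have e2 := abs_le.1 c.right_eq
  have hx99 : (x : ℝ) ≤ 99 := by exact_mod_cast (by omega : x ≤ 99)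
  have hxT : (x : ℝ) ≤ 30 * T ^ 2 := by linarith
  have hxa : 0 ≤ x * a := by positivity
  have hub : 0 ≤ u * b := by positivity
  have hka : 0 ≤ k * a := by positivity
  have hkγ : 0 ≤ k * γ := by positivity
  have hlb : 0 ≤ l * b := by positivity
  have hlη : 0 ≤ l * η := by positivity
  have cancel : ∀ (n : ℕ) (t B : ℝ), σ / 10000 ≤ t → n * t ≤ B * σ → (n : ℝ) ≤ 10000 * B := by
    intro n t B h1 h2
    have h3 := mul_le_mul_of_nonneg_left h1 (by positivity : (0 : ℝ) ≤ n)
    refine le_of_mul_le_mul_right ?_ hσ0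
    linarith
  rcases le_or_gt (σ / 10000) ρ with hc | hρs
  · have hk := cancel k γ 3 (by linarith) (by linarith)
    have hl := cancel l η 3 (by linarith) (by linarith)
    have hk1 : γ ≤ k * γ := le_mul_of_one_le_left hγ (by exact_mod_cast c.k_pos)
    have hxγ : x * γ ≤ 99 * γ := mul_le_mul_of_nonneg_right hx99 hγ
    have hu := cancel u η 300 (by linarith) (by linarith [c.common])
    refine ⟨hxT, ?_, ?_, ?_⟩ <;> linarith
  rcases le_or_gt (σ / 10000) b with hbl | hbs
  · have hu := cancel u b 3 hbl (by linarith)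
    have hl := cancel l b 3 hbl (by linarith)
    refine ⟨hxT, ?_, by linarith, by linarith⟩
    rcases le_or_gt (σ / 10000) a with hal | has
    · have hk := cancel k a 3 hal (by linarith)
      linarith
    have hu1 : u = 1 := by
      by_contra hne
      have hu2 : 2 ≤ u := by have := c.u_pos; omega
      have : 2 * b ≤ u * b := mul_le_mul_of_nonneg_right (by exact_mod_cast hu2) hb
      linarith
    have hxa99 : x * a ≤ 99 * a := mul_le_mul_of_nonneg_right hx99 ha
    have hub1 : (u : ℝ) * b = b := by rw [hu1]; simp
    have b4 := (c.bound_of_le hκ (by linarith)).2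
    rw [← hσ'] at b4
    have hl1 : l = 1 := by
      by_contra hne
      have hl2 : 2 ≤ l := by have := c.l_pos; omega
      have : 2 * b ≤ l * b := mul_le_mul_of_nonneg_right (by exact_mod_cast hl2) hb
      linarith
    have s1 := c.right_square hu1 hl1
    have com := c.common
    rw [hl1] at e2
    rw [hu1] at com e1
    push_cast at com e1 e2
    have hG := c.left_large
    have hxG : x * (γ + a) ≤ 99 * (γ + a) := mul_le_mul_of_nonneg_right hx99 (by linarith)
    have hkG : (k : ℝ) * (γ + a) ≤ (5 * κ + 210) * (γ + a) := by
      have hκG : κ * (1 / 2) ≤ κ * (γ + a) := mul_le_mul_of_nonneg_left hG hκ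
      have hxG0 : 0 ≤ x * (γ + a) := mul_nonneg (by positivity) (by linarith)
      linarith
    have := le_of_mul_le_mul_right hkG (by linarith)
    linarith
  exfalso
  have hx1 : x = 1 := by
    by_contra hne
    have hx2 : 2 ≤ x := by have := c.x_pos; omega
    have : 2 * a ≤ x * a := mul_le_mul_of_nonneg_right (by exact_mod_cast hx2) ha
    linarith
  have hxa1 : (x : ℝ) * a = a := by rw [hx1]; simp
  have hkG : k * (γ + a) ≤ 101 / 100 * σ := by
    rcases le_total ((x : ℝ) * a) (u * b) with h | h
    · obtain ⟨h1, h2⟩ := c.bound_of_le hκ h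
      linarith
    · obtain ⟨h1, h2⟩ := c.symm.bound_of_le hκ h
      linarith
  have hk1 : k = 1 := by
    by_contra hne
    have hk2 : 2 ≤ k := by have := c.k_pos; omega
    have : 2 * a ≤ k * a := mul_le_mul_of_nonneg_right (by exact_mod_cast hk2) ha
    linarith
  have s2 := c.left_square hx1 hk1
  have v1 := c.left_cofactor hx1 hk1
  have com := c.common
  have hu1 : η ≤ u * η := le_mul_of_one_le_left hη (by exact_mod_cast c.u_pos)
  rw [hk1] at e1 hkG
  rw [hx1] at com
  push_cast at com e1 hkG
  have hubl : 97 / 100 * σ ≤ u * b := by linarith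
  have hMs : M ≤ 5 / 100 * σ := by linarith
  have hmax : max M γ ≤ 5 / 100 * σ := max_le hMs (by linarith)
  linarith

lemma exponents_le (c : LogConfiguration κ x k u l ρ a b γ η M) (hκ : 0 ≤ κ) :
    (x : ℝ) ≤ 30 * threshold κ ^ 2 ∧ (k : ℝ) ≤ 30 * threshold κ ^ 2 ∧
      (u : ℝ) ≤ 30 * threshold κ ^ 2 ∧ (l : ℝ) ≤ 30 * threshold κ ^ 2 := by
  rcases lt_or_ge (ρ + a + b) (threshold κ) with hσ | hσ
  · obtain ⟨h1, h2⟩ := c.exponents_le_of_small hκ hσ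
    obtain ⟨h3, h4⟩ := c.symm.exponents_le_of_small hκ (by linarith)
    exact ⟨h2, h1, h4, h3⟩
  by_cases hx : x < 100
  · exact c.le_of_large_of_lt hκ hσ hx
  by_cases hu : u < 100
  · obtain ⟨h1, h2, h3, h4⟩ := c.symm.le_of_large_of_lt hκ (by linarith) hu
    exact ⟨h3, h4, h1, h2⟩
  rcases le_total ((x : ℝ) * a) (u * b) with h | h
  · exact (c.false_of_large_of_le hκ hσ (by omega) (by omega) h).elim
  · exact (c.symm.false_of_large_of_le hκ (by linarith) (by omega) (by omega) h).elim

end LogConfiguration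

/-- The ABC inequality in logarithmic form with exponent `1 + 1/1000`. -/
def LogABC (κ : ℝ) : Prop :=
  ∀ (A B : ℕ) (C : ℤ), A ≠ 0 → B ≠ 0 → C ≠ 0 → (A : ℤ) - B = C → ∀ R : ℕ, R ≠ 0 →
    (∀ p : ℕ, p.Prime → p ∣ A * B → p ∣ R) →
    Real.log A ≤ κ + 1001 / 1000 * (Real.log R + Real.log |(C : ℝ)|)

lemma ABCConjecture.exists_logABC (habc : ABCConjecture) : ∃ κ : ℝ, 0 ≤ κ ∧ LogABC κ := by
  obtain ⟨κ, hκ, h⟩ := habc.log_le (ε := 1 / 1000) (by norm_num)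
  refine ⟨κ, hκ, fun A B C hA hB hC e R hR hp => ?_⟩
  have := h A (-(B : ℤ)) C (by exact_mod_cast hA) (by simpa using hB) hC (by linarith) R hR
    (fun p hpp hd => hp p hpp (by
      rw [mul_neg, dvd_neg] at hd
      exact_mod_cast hd))
  norm_num at this ⊢
  exact this

lemma exists_mul_coprime_part (h : ℕ) {g : ℕ} (hg : g ≠ 0) :
    ∃ g₁ g₂ : ℕ, g = g₁ * g₂ ∧ Nat.Coprime g₂ h ∧ ∀ p : ℕ, p.Prime → p ∣ g₁ → p ∣ h := by
  induction g using Nat.strong_induction_on with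
  | _ g ih =>
    by_cases hc : Nat.Coprime g h
    · exact ⟨1, g, by simp, hc, fun p hp h1 => absurd (Nat.dvd_one.1 h1) hp.ne_one⟩
    · obtain ⟨p, hp, hpg, hph⟩ := Nat.Prime.not_coprime_iff_dvd.1 hc
      obtain ⟨n, rfl⟩ := hpg
      have hn : n ≠ 0 := right_ne_zero_of_mul hg
      obtain ⟨g₁, g₂, rfl, h2, h3⟩ := ih n
        (lt_mul_of_one_lt_left (Nat.pos_of_ne_zero hn) hp.one_lt) hn
      refine ⟨p * g₁, g₂, by ring, h2, fun q hq hd => ?_⟩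
      rcases hq.dvd_mul.1 hd with hd | hd
      · rwa [(Nat.prime_dvd_prime_iff_eq hq hp).1 hd]
      · exact h3 q hq hd

/-- A coincidence `g^x (g^k + s) = h^u (h^l + s)` with `g = g₁ g₂` and `h = h₁ h₂`, after
separating the common prime factors of `g` and `h`. -/
structure Coincidence (s : ℤ) (x k u l g₁ g₂ h₁ h₂ m : ℕ) : Prop where
  sign : s = 1 ∨ s = -1
  x_pos : 0 < x
  k_pos : 0 < k
  u_pos : 0 < u
  l_pos : 0 < l
  left_ge : 2 ≤ g₁ * g₂
  right_ge : 2 ≤ h₁ * h₂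
  coprime : Nat.Coprime g₂ h₂
  common : g₁ ^ x = h₁ ^ u
  left_eq : ((g₁ * g₂ : ℕ) : ℤ) ^ k + s = h₂ ^ u * m
  right_eq : ((h₁ * h₂ : ℕ) : ℤ) ^ l + s = g₂ ^ x * m
  ne : x * l ≠ u * k

lemma coprime_of_pow_add_sign {s : ℤ} (hs : s = 1 ∨ s = -1) {g k P q : ℕ} (hk : 0 < k)
    (hP : (P : ℤ) = (g : ℤ) ^ k + s) (hq : ∀ p : ℕ, p.Prime → p ∣ q → p ∣ g) :
    Nat.Coprime q P := by
  refine Nat.coprime_of_dvd fun p hp h1 h2 => ?_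
  have h3 : (p : ℤ) ∣ (g : ℤ) ^ k := dvd_pow (by exact_mod_cast hq p hp h1) hk.ne'
  have h4 : (p : ℤ) ∣ (g : ℤ) ^ k + s := hP ▸ (by exact_mod_cast h2)
  have h5 : (p : ℤ) ∣ s := (dvd_add_right h3).1 h4
  have h6 : (p : ℤ) ∣ 1 := by
    rcases hs with rfl | rfl
    · exact h5
    · exact (dvd_neg.1 h5)
  exact hp.ne_one (Nat.dvd_one.1 (by exact_mod_cast h6))

lemma exists_coincidence {s : ℤ} (hs : s = 1 ∨ s = -1) {g h x k u l : ℕ}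
    (hg : 2 ≤ g) (hh : 2 ≤ h) (hx : 0 < x) (hk : 0 < k) (hu : 0 < u) (hl : 0 < l)
    (hne : x * l ≠ u * k)
    (e : (g : ℤ) ^ x * ((g : ℤ) ^ k + s) = (h : ℤ) ^ u * ((h : ℤ) ^ l + s)) :
    ∃ g₁ g₂ h₁ h₂ m : ℕ, Coincidence s x k u l g₁ g₂ h₁ h₂ m := by
  obtain ⟨P, hP⟩ := Int.eq_ofNat_of_zero_le
    (by linarith [(pow_add_sign_bounds hs hg hk).1] : 0 ≤ (g : ℤ) ^ k + s)
  obtain ⟨Q, hQ⟩ := Int.eq_ofNat_of_zero_le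
    (by linarith [(pow_add_sign_bounds hs hh hl).1] : 0 ≤ (h : ℤ) ^ l + s)
  obtain ⟨g₁, g₂, hg12, hcg, hpg⟩ := exists_mul_coprime_part h (by omega : g ≠ 0)
  obtain ⟨h₁, h₂, hh12, hch, hph⟩ := exists_mul_coprime_part g (by omega : h ≠ 0)
  have cg : Nat.Coprime g₁ Q := coprime_of_pow_add_sign hs hl hQ.symm hpg
  have ch : Nat.Coprime h₁ P := coprime_of_pow_add_sign hs hk hP.symm hph
  have e1 : g ^ x * P = h ^ u * Q := by rw [hP, hQ] at e; exact_mod_cast e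
  have e2 : g₁ ^ x * (g₂ ^ x * P) = h₁ ^ u * (h₂ ^ u * Q) := by
    rw [← mul_assoc, ← mul_assoc, ← mul_pow, ← mul_pow, ← hg12, ← hh12, e1]
  have c1 : Nat.Coprime g₁ h₂ := (hch.coprime_dvd_right ⟨g₂, hg12⟩).symm
  have c2 : Nat.Coprime h₁ g₂ := (hcg.coprime_dvd_right ⟨h₂, hh12⟩).symm
  have c3 : Nat.Coprime g₂ h₂ := hcg.coprime_dvd_right ⟨h₁, by rw [hh12, mul_comm]⟩
  have hcom : g₁ ^ x = h₁ ^ u := by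
    refine Nat.dvd_antisymm ?_ ?_
    · exact ((c1.pow_right u).mul_right cg).pow_left x |>.dvd_of_dvd_mul_right ⟨_, e2.symm⟩
    · exact ((c2.pow_right x).mul_right ch).pow_left u |>.dvd_of_dvd_mul_right ⟨_, e2⟩
  have hg10 : 0 < g₁ := Nat.pos_of_ne_zero (by rintro rfl; simp at hg12; omega)
  have hg20 : 0 < g₂ := Nat.pos_of_ne_zero (by rintro rfl; simp at hg12; omega)
  have e3 : g₂ ^ x * P = h₂ ^ u * Q := by
    rw [hcom] at e2
    exact Nat.eq_of_mul_eq_mul_left (hcom ▸ pow_pos hg10 x) e2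
  obtain ⟨m, hm⟩ : g₂ ^ x ∣ Q :=
    (c3.pow x u).dvd_of_dvd_mul_left ⟨_, e3.symm⟩
  have e4 : P = h₂ ^ u * m := by
    rw [hm] at e3
    refine Nat.eq_of_mul_eq_mul_left (pow_pos hg20 x) ?_
    rw [e3]; ring
  refine ⟨g₁, g₂, h₁, h₂, m, hs, hx, hk, hu, hl, hg12 ▸ hg, hh12 ▸ hh, c3, hcom, ?_, ?_, hne⟩
  · rw [← hg12, hP, e4]; push_cast; rfl
  · rw [← hh12, hQ, hm]; push_cast; rfl

namespace Coincidence

variable {s : ℤ} {x k u l g₁ g₂ h₁ h₂ m : ℕ}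

lemma symm (c : Coincidence s x k u l g₁ g₂ h₁ h₂ m) : Coincidence s u l x k h₁ h₂ g₁ g₂ m where
  sign := c.sign
  x_pos := c.u_pos
  k_pos := c.l_pos
  u_pos := c.x_pos
  l_pos := c.k_pos
  left_ge := c.right_ge
  right_ge := c.left_ge
  coprime := c.coprime.symm
  common := c.common.symm
  left_eq := c.right_eq
  right_eq := c.left_eq
  ne := c.ne.symm

lemma left_pos (c : Coincidence s x k u l g₁ g₂ h₁ h₂ m) : 0 < g₁ ∧ 0 < g₂ := by
  have := c.left_ge
  constructor <;> refine Nat.pos_of_ne_zero ?_ <;> rintro rfl <;> simp at this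

lemma m_pos (c : Coincidence s x k u l g₁ g₂ h₁ h₂ m) : 0 < m := by
  refine Nat.pos_of_ne_zero ?_
  rintro rfl
  have h1 := (pow_add_sign_bounds c.sign c.left_ge c.k_pos).1
  rw [c.left_eq] at h1
  simp at h1

lemma radical_eq (c : Coincidence s x k u l g₁ g₂ h₁ h₂ m) :
    ∏ p ∈ h₁.primeFactors, p = ∏ p ∈ g₁.primeFactors, p := by
  rw [← Nat.primeFactors_pow h₁ c.u_pos.ne', ← c.common, Nat.primeFactors_pow g₁ c.x_pos.ne']

lemma nondegenerate (c : Coincidence s x k u l g₁ g₂ h₁ h₂ m) : g₂ ≠ 1 ∨ h₂ ≠ 1 := by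
  by_contra! hcon
  obtain ⟨h1, h2⟩ := hcon
  have e1 := c.left_eq
  have e2 := c.right_eq
  rw [h1, h2] at e1 e2
  simp only [mul_one, Nat.cast_one, one_pow, one_mul] at e1 e2
  have e3 : g₁ ^ k = h₁ ^ l := by
    have : (g₁ : ℤ) ^ k = (h₁ : ℤ) ^ l := by linarith
    exact_mod_cast this
  have hg := c.left_ge
  rw [h1, mul_one] at hg
  apply c.ne
  refine Nat.pow_right_injective hg ?_
  change g₁ ^ (x * l) = g₁ ^ (u * k)
  rw [pow_mul, c.common, mul_comm u k, pow_mul g₁, e3, ← pow_mul, ← pow_mul, mul_comm]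

lemma pow_ne_pow (c : Coincidence s x k u l g₁ g₂ h₁ h₂ m) : g₂ ^ x ≠ h₂ ^ u := by
  intro h
  have h1 := c.coprime.pow x u
  rw [h, Nat.coprime_self] at h1
  rw [h1] at h
  have h2 := (Nat.pow_eq_one.1 h).resolve_right c.x_pos.ne'
  have h3 := (Nat.pow_eq_one.1 h1).resolve_right c.u_pos.ne'
  rcases c.nondegenerate with h | h <;> contradiction

lemma log_left_eq (c : Coincidence s x k u l g₁ g₂ h₁ h₂ m) :
    |k * (Real.log g₁ + Real.log g₂) - (u * Real.log h₂ + Real.log m)| ≤ 1 := by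
  obtain ⟨h1, h2, h3⟩ := pow_add_sign_bounds c.sign c.left_ge c.k_pos
  rw [c.left_eq] at h2 h3
  have hl2 : Real.log 2 ≤ 1 := by linarith [Real.log_two_lt_d9]
  have p1 : (0 : ℝ) < g₁ := by exact_mod_cast c.left_pos.1
  have p2 : (0 : ℝ) < g₂ := by exact_mod_cast c.left_pos.2
  have p3 : (0 : ℝ) < h₂ := by exact_mod_cast c.symm.left_pos.2
  have p4 : (0 : ℝ) < m := by exact_mod_cast c.m_pos
  have e1 : k * (Real.log g₁ + Real.log g₂) = Real.log (((g₁ * g₂ : ℕ) : ℝ) ^ k) := by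
    push_cast
    rw [Real.log_pow, Real.log_mul p1.ne' p2.ne']
  have e2 : u * Real.log h₂ + Real.log m = Real.log ((h₂ : ℝ) ^ u * m) := by
    rw [Real.log_mul (by positivity) p4.ne', Real.log_pow]
  have q1 : (0 : ℝ) < ((g₁ * g₂ : ℕ) : ℝ) ^ k := by push_cast; positivity
  have q2 : (0 : ℝ) < (h₂ : ℝ) ^ u * m := by positivity
  have i1 : Real.log (((g₁ * g₂ : ℕ) : ℝ) ^ k) ≤ Real.log (2 * ((h₂ : ℝ) ^ u * m)) :=
    Real.log_le_log q1 (by exact_mod_cast h2)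
  have i2 : Real.log ((h₂ : ℝ) ^ u * m) ≤ Real.log (2 * ((g₁ * g₂ : ℕ) : ℝ) ^ k) :=
    Real.log_le_log q2 (by exact_mod_cast h3)
  rw [Real.log_mul (by norm_num) q2.ne'] at i1
  rw [Real.log_mul (by norm_num) q1.ne'] at i2
  rw [e1, e2, abs_le]
  constructor <;> linarith

lemma radical_pos (n : ℕ) : 0 < ∏ p ∈ n.primeFactors, p :=
  Finset.prod_pos fun _ hp => (Nat.prime_of_mem_primeFactors hp).pos

lemma dvd_radical {n p : ℕ} (hn : n ≠ 0) (hp : p.Prime) (h : p ∣ n) :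
    p ∣ ∏ q ∈ n.primeFactors, q :=
  Finset.dvd_prod_of_mem _ (Nat.mem_primeFactors.2 ⟨hp, h, hn⟩)

lemma log_left_abc {κ : ℝ} (hκ : LogABC κ) (c : Coincidence s x k u l g₁ g₂ h₁ h₂ m) :
    k * (Real.log g₁ + Real.log g₂) ≤ κ + 1001 / 1000 *
      (Real.log (∏ p ∈ g₁.primeFactors, p : ℕ) + Real.log g₂ + Real.log h₂ + Real.log m) := by
  have n1 := c.left_pos.1.ne'
  have n2 := c.left_pos.2.ne'
  have n3 := c.symm.left_pos.2.ne'
  have n4 := c.m_pos.ne'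
  have hs0 : s ≠ 0 := by rcases c.sign with h | h <;> rw [h] <;> norm_num
  have hs1 : |(s : ℝ)| = 1 := by rcases c.sign with h | h <;> rw [h] <;> norm_num
  have n5 := (radical_pos g₁).ne'
  have hr := fun p => dvd_radical (p := p) n1
  generalize ∏ p ∈ g₁.primeFactors, p = r at *
  have e := c.left_eq
  have := hκ ((g₁ * g₂) ^ k) (h₂ ^ u * m) (-s) (by positivity) (by positivity) (by simpa using hs0)
    (by push_cast at e ⊢; linarith) (r * g₂ * h₂ * m) (by positivity) (fun p hp hd => by
      have d1 : p ∣ (g₁ * g₂) ^ k → p ∣ g₁ * g₂ := hp.dvd_of_dvd_pow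
      have d2 : p ∣ h₂ ^ u → p ∣ h₂ := hp.dvd_of_dvd_pow
      have d3 := hr p hp
      simp only [hp.dvd_mul] at hd d1 d2 ⊢
      tauto)
  push_cast at this
  rw [abs_neg, hs1, Real.log_one, Real.log_pow, Real.log_mul (by positivity) (by positivity),
    Real.log_mul (by positivity) (by positivity), Real.log_mul (by positivity) (by positivity),
    Real.log_mul (by positivity) (by positivity), add_zero] at this
  exact this

set_option maxHeartbeats 800000 in
lemma log_main_abc {κ : ℝ} (hκ : LogABC κ) (c : Coincidence s x k u l g₁ g₂ h₁ h₂ m) :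
    x * Real.log g₂ + u * Real.log h₂ + Real.log m ≤ κ + 1 + 1001 / 1000 *
      (Real.log (∏ p ∈ g₁.primeFactors, p : ℕ) + Real.log g₂ + Real.log h₂ +
        max (x * Real.log g₂) (u * Real.log h₂)) := by
  have n1 := c.left_pos.1.ne'
  have n2 := c.left_pos.2.ne'
  have n3 := c.symm.left_pos.2.ne'
  have n6 := c.symm.left_pos.1.ne'
  have n4 := c.m_pos.ne'
  have hs0 : s ≠ 0 := by rcases c.sign with h | h <;> rw [h] <;> norm_num
  have hs1 : |(s : ℝ)| = 1 := by rcases c.sign with h | h <;> rw [h] <;> norm_num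
  have hl := c.log_left_eq
  have n5 := (radical_pos g₁).ne'
  have hr := fun p => dvd_radical (p := p) n1
  have hr' := fun p => dvd_radical (p := p) n6
  rw [c.radical_eq] at hr'
  generalize ∏ p ∈ g₁.primeFactors, p = r at *
  have e1 := c.left_eq
  have e2 := c.right_eq
  have hC : s * ((h₂ : ℤ) ^ u - (g₂ : ℤ) ^ x) ≠ 0 := by
    refine mul_ne_zero hs0 (sub_ne_zero.2 ?_)
    exact_mod_cast c.pow_ne_pow.symm
  have := hκ ((g₁ * g₂) ^ k * g₂ ^ x) ((h₁ * h₂) ^ l * h₂ ^ u) _ (by positivity) (by positivity) hC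
    (by push_cast at e1 e2 ⊢
        linear_combination (g₂ : ℤ) ^ x * e1 - (h₂ : ℤ) ^ u * e2)
    (r * g₂ * h₂) (by positivity) (fun p hp hd => by
      have d1 : p ∣ (g₁ * g₂) ^ k → p ∣ g₁ * g₂ := hp.dvd_of_dvd_pow
      have d2 : p ∣ h₂ ^ u → p ∣ h₂ := hp.dvd_of_dvd_pow
      have d3 : p ∣ (h₁ * h₂) ^ l → p ∣ h₁ * h₂ := hp.dvd_of_dvd_pow
      have d4 : p ∣ g₂ ^ x → p ∣ g₂ := hp.dvd_of_dvd_pow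
      have d5 := hr p hp
      have d6 := hr' p hp
      simp only [hp.dvd_mul] at hd d1 d2 d3 d4 ⊢
      tauto)
  push_cast at this
  rw [abs_mul, hs1, one_mul, Real.log_mul (by positivity) (by positivity), Real.log_pow,
    Real.log_mul (by positivity) (by positivity), Real.log_pow,
    Real.log_mul (by positivity) (by positivity), Real.log_mul (by positivity) (by positivity)]
    at this
  have hmax : Real.log |(h₂ : ℝ) ^ u - (g₂ : ℝ) ^ x|
      ≤ max (x * Real.log g₂) (u * Real.log h₂) := by
    have hpos : 0 < |(h₂ : ℝ) ^ u - (g₂ : ℝ) ^ x| := by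
      refine abs_pos.2 (sub_ne_zero.2 ?_)
      exact_mod_cast c.pow_ne_pow.symm
    have q1 : (0 : ℝ) < (h₂ : ℝ) ^ u := by positivity
    have q2 : (0 : ℝ) < (g₂ : ℝ) ^ x := by positivity
    rw [← Real.log_pow, ← Real.log_pow]
    rcases le_total ((g₂ : ℝ) ^ x) ((h₂ : ℝ) ^ u) with h | h
    · refine le_max_of_le_right (Real.log_le_log hpos ?_)
      rw [abs_of_nonneg (by linarith)]; linarith
    · refine le_max_of_le_left (Real.log_le_log hpos ?_)
      rw [abs_of_nonpos (by linarith)]; linarith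
  have hl' := (abs_le.1 hl).1
  linarith

lemma log_right_square {κ : ℝ} (hκ : LogABC κ) (c : Coincidence s x k u l g₁ g₂ h₁ h₂ m)
    (hu : u = 1) (hl : l = 1) :
    (k + x) * (Real.log g₁ + Real.log g₂) ≤ κ + 6 + 1001 / 1000 *
      ((Real.log h₁ + Real.log h₂) + (Real.log g₁ + Real.log g₂)
        + x * (Real.log g₁ + Real.log g₂)) := by
  subst hu hl
  have n1 := c.left_pos.1
  have n2 := c.left_pos.2
  have n3 := c.symm.left_pos.2
  have n6 := c.symm.left_pos.1
  have e1 := c.left_eq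
  have e2 := c.right_eq
  have e3 := c.common
  have hs2 : s ^ 2 = 1 := by rcases c.sign with h | h <;> rw [h] <;> norm_num
  have hs1 : |(s : ℝ)| = 1 := by rcases c.sign with h | h <;> rw [h] <;> norm_num
  have hh := c.right_ge
  rw [pow_one] at e1 e2 e3
  have lg : Real.log g₁ + Real.log g₂ = Real.log ((g₁ * g₂ : ℕ) : ℝ) := by
    push_cast
    rw [Real.log_mul (by positivity) (by positivity)]
  have lh : Real.log h₁ + Real.log h₂ = Real.log ((h₁ * h₂ : ℕ) : ℝ) := by
    push_cast
    rw [Real.log_mul (by positivity) (by positivity)]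
  rw [lg, lh]
  have e4 : ((g₁ * g₂ : ℕ) : ℤ) ^ x * (((g₁ * g₂ : ℕ) : ℤ) ^ k + s)
      = ((h₁ * h₂ : ℕ) : ℤ) * (((h₁ * h₂ : ℕ) : ℤ) + s) := by
    have e3' : (g₁ : ℤ) ^ x = h₁ := by exact_mod_cast e3
    rw [e1, e2]
    push_cast
    rw [mul_pow, e3']
    ring
  have hg1 : 0 < g₁ * g₂ := Nat.mul_pos n1 n2
  generalize g₁ * g₂ = g at *
  generalize h₁ * h₂ = h at *
  have hsle : s ≤ 1 := by rcases c.sign with h | h <;> omega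
  have hsge : -1 ≤ s := by rcases c.sign with h | h <;> omega
  obtain ⟨t, ht⟩ := Int.eq_ofNat_of_zero_le (by omega : 0 ≤ 2 * (h : ℤ) + s)
  have ht0 : 0 < t := by omega
  have ht3 : t ≤ 3 * h := by omega
  have hC : -(4 * s * (g : ℤ) ^ x + 1) ≠ 0 := by
    generalize (g : ℤ) ^ x = z
    rcases c.sign with h | h <;> rw [h] <;> omega
  have := hκ (4 * g ^ (x + k)) (t ^ 2) _ (by positivity) (by positivity) hC
    (by push_cast
        rw [← ht, pow_add]
        linear_combination 4 * e4 - hs2)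
    (2 * g * t) (by positivity) (fun p hp hd => by
      have d1 : p ∣ g ^ (x + k) → p ∣ g := hp.dvd_of_dvd_pow
      have d2 : p ∣ t ^ 2 → p ∣ t := hp.dvd_of_dvd_pow
      have d3 : p ∣ 4 → p ∣ 2 := fun h => hp.dvd_of_dvd_pow (n := 2) h
      simp only [hp.dvd_mul] at hd d1 d2 ⊢
      tauto)
  have pg : (0 : ℝ) < g := by exact_mod_cast hg1
  have pt : (0 : ℝ) < t := by exact_mod_cast ht0
  have hg1' : (1 : ℝ) ≤ g ^ x := one_le_pow₀ (by exact_mod_cast hg1)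
  push_cast at this
  rw [Real.log_mul (by norm_num) (by positivity), Real.log_mul (by positivity) pt.ne',
    Real.log_mul (by norm_num) pg.ne', Real.log_pow, abs_neg] at this
  have l4 : 0 ≤ Real.log 4 := Real.log_nonneg (by norm_num)
  have l2 : Real.log 2 ≤ 1 := by linarith [Real.log_two_lt_d9]
  have l8 : Real.log 8 ≤ 5 / 2 := by
    rw [show (8 : ℝ) = 2 ^ 3 by norm_num, Real.log_pow]
    push_cast
    linarith [Real.log_two_lt_d9]
  have l5 : Real.log 5 ≤ 2 := by
    have : Real.log 5 + Real.log (8 / 5) = Real.log 8 := by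
      rw [← Real.log_mul (by norm_num) (by norm_num)]; norm_num
    have h4 : Real.log 2 ≤ 2 * Real.log (8 / 5) := by
      rw [← Nat.cast_two, ← Real.log_pow]
      exact Real.log_le_log (by norm_num) (by norm_num)
    have h5 : Real.log 8 = 3 * Real.log 2 := by
      rw [show (8 : ℝ) = 2 ^ 3 by norm_num, Real.log_pow]; norm_num
    linarith [Real.log_two_lt_d9]
  have l3 : Real.log 3 ≤ 2 :=
    (Real.log_le_log (by norm_num) (by norm_num : (3 : ℝ) ≤ 5)).trans l5
  have i1 : Real.log t ≤ 2 + Real.log h := by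
    have : Real.log t ≤ Real.log (3 * h) :=
      Real.log_le_log pt (by exact_mod_cast ht3)
    rw [Real.log_mul (by norm_num) (by positivity)] at this
    linarith
  have i2 : Real.log |4 * (s : ℝ) * g ^ x + 1| ≤ 2 + x * Real.log g := by
    have habs : |4 * (s : ℝ) * g ^ x + 1| ≤ 5 * g ^ x := by
      refine (abs_add_le _ _).trans ?_
      rw [abs_mul, abs_mul, hs1, abs_of_pos (by positivity : (0 : ℝ) < g ^ x)]
      norm_num
      linarith
    have hpos : 0 < |4 * (s : ℝ) * g ^ x + 1| := by
      refine abs_pos.2 ?_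
      have := neg_ne_zero.1 hC
      exact_mod_cast this
    have := Real.log_le_log hpos habs
    rw [Real.log_mul (by norm_num) (by positivity), Real.log_pow] at this
    linarith
  push_cast at this
  linarith

lemma log_right_cofactor {κ : ℝ} (hκ : LogABC κ) (c : Coincidence s x k u l g₁ g₂ h₁ h₂ m)
    (hu : u = 1) (hl : l = 1) :
    k * (Real.log g₁ + Real.log g₂) ≤ κ + 2 + 1001 / 1000 *
      ((Real.log g₁ + Real.log g₂) + Real.log m + max (Real.log m) (Real.log h₁)) := by
  subst hu hl
  have n1 := c.left_pos.1
  have n2 := c.left_pos.2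
  have n3 := c.symm.left_pos.2
  have n6 := c.symm.left_pos.1
  have n4 := c.m_pos
  have e1 := c.left_eq
  have e2 := c.right_eq
  have e3 := c.common
  have hs0 : s ≠ 0 := by rcases c.sign with h | h <;> rw [h] <;> norm_num
  have hs1 : |(s : ℝ)| = 1 := by rcases c.sign with h | h <;> rw [h] <;> norm_num
  rw [pow_one] at e1 e2 e3
  have e3' : (g₁ : ℤ) ^ x = h₁ := by exact_mod_cast e3
  have hC : -(s * ((m : ℤ) + h₁)) ≠ 0 :=
    neg_ne_zero.2 (mul_ne_zero hs0 (by positivity))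
  have := hκ (g₁ ^ x * (g₁ * g₂) ^ k) (g₂ ^ x * m ^ 2) _ (by positivity) (by positivity) hC
    (by push_cast at e1 e2 ⊢
        rw [e3']
        linear_combination (h₁ : ℤ) * e1 + (m : ℤ) * e2)
    (g₁ * g₂ * m) (by positivity) (fun p hp hd => by
      have d1 : p ∣ (g₁ * g₂) ^ k → p ∣ g₁ * g₂ := hp.dvd_of_dvd_pow
      have d2 : p ∣ m ^ 2 → p ∣ m := hp.dvd_of_dvd_pow
      have d3 : p ∣ g₁ ^ x → p ∣ g₁ := hp.dvd_of_dvd_pow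
      have d4 : p ∣ g₂ ^ x → p ∣ g₂ := hp.dvd_of_dvd_pow
      simp only [hp.dvd_mul] at hd d1 d2 d3 d4 ⊢
      tauto)
  have p1 : (1 : ℝ) ≤ g₁ := by exact_mod_cast n1
  have p4 : (0 : ℝ) < m := by exact_mod_cast n4
  have p6 : (0 : ℝ) < h₁ := by exact_mod_cast n6
  push_cast at this
  rw [abs_neg, abs_mul, hs1, one_mul, abs_of_pos (by positivity),
    Real.log_mul (by positivity) (by positivity), Real.log_mul (by positivity) (by positivity),
    Real.log_mul (by positivity) (by positivity), Real.log_pow, Real.log_pow,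
    Real.log_mul (by positivity) (by positivity)] at this
  have l2 : Real.log 2 ≤ 1 := by linarith [Real.log_two_lt_d9]
  have hx0 : 0 ≤ x * Real.log g₁ := mul_nonneg (by positivity) (Real.log_nonneg p1)
  have hmax : Real.log ((m : ℝ) + h₁) ≤ 1 + max (Real.log m) (Real.log h₁) := by
    rcases le_total (m : ℝ) h₁ with h | h
    · have := Real.log_le_log (by positivity) (by linarith : (m : ℝ) + h₁ ≤ 2 * h₁)
      rw [Real.log_mul (by norm_num) (by positivity)] at this
      linarith [le_max_right (Real.log m) (Real.log h₁)]
    · have := Real.log_le_log (by positivity) (by linarith : (m : ℝ) + h₁ ≤ 2 * m)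
      rw [Real.log_mul (by norm_num) (by positivity)] at this
      linarith [le_max_left (Real.log m) (Real.log h₁)]
  linarith

/-- If `l = 1`, then the square of the radical of `h₁` divides `h₁`, or `h₁ ^ 2` divides
`g₁ ^ k`. -/
lemma radical_sq_dvd_or (c : Coincidence s x k u l g₁ g₂ h₁ h₂ m) (hl : l = 1) :
    (∏ p ∈ h₁.primeFactors, p) ^ 2 ∣ h₁ ∨ h₁ ^ 2 ∣ g₁ ^ k := by
  have n1 := c.left_pos.1.ne'
  have n2 := c.symm.left_pos.1.ne'
  by_cases h : ∀ p ∈ h₁.primeFactors, 2 ≤ h₁.factorization p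
  · left
    conv_rhs => rw [← Nat.prod_factorization_pow_eq_self n2]
    rw [← Finset.prod_pow, Finsupp.prod, Nat.support_factorization]
    exact Finset.prod_dvd_prod_of_dvd _ _ fun p hp => pow_dvd_pow p (h p hp)
  · right
    push Not at h
    obtain ⟨p, hp, hlt⟩ := h
    have hpos : 0 < h₁.factorization p := by
      obtain ⟨hpp, hd, -⟩ := Nat.mem_primeFactors.1 hp
      exact hpp.factorization_pos_of_dvd n2 hd
    have h1 := congrArg (fun n => n.factorization p) c.common
    simp only [Nat.factorization_pow, Finsupp.smul_apply, smul_eq_mul] at h1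
    rw [show h₁.factorization p = 1 by omega, mul_one] at h1
    set q := g₁.factorization p
    have hq : q ≠ 0 := by rintro hq; rw [hq] at h1; have := c.u_pos; omega
    have h2 : g₁ = h₁ ^ q := by
      have := c.common
      rw [← h1, mul_comm, pow_mul] at this
      exact Nat.pow_left_injective c.x_pos.ne' this
    rw [h2, ← pow_mul]
    refine pow_dvd_pow _ ?_
    by_contra! hcon
    have hqk : q * k = 1 := by
      have := Nat.mul_pos (Nat.pos_of_ne_zero hq) c.k_pos
      omega
    have hq1 := Nat.eq_one_of_mul_eq_one_right hqk
    have hk1 := Nat.eq_one_of_mul_eq_one_left hqk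
    apply c.ne
    rw [← h1, hl, hq1, hk1, mul_one, mul_one]

lemma le_or_le_of_dvd (c : Coincidence s x k u l g₁ g₂ h₁ h₂ m) (hl : l = 1)
    (hd : h₁ ^ 2 ∣ g₁ ^ k) :
    h₁ ^ 2 ≤ 2 * max (h₂ ^ u) (g₂ ^ x) ∨ h₁ ≤ 2 * (h₂ * g₂ ^ x) := by
  subst hl
  have n2 := c.symm.left_pos.1
  have n3 := c.symm.left_pos.2
  have n4 := c.left_pos.2
  obtain ⟨w, hw⟩ := hd
  have hw' : (g₁ : ℤ) ^ k = h₁ ^ 2 * w := by exact_mod_cast hw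
  have e1 := c.left_eq
  have e2 := c.right_eq
  push_cast at e1 e2
  rw [mul_pow, hw'] at e1
  have hs2 : s * s = 1 := by rcases c.sign with h | h <;> rw [h] <;> norm_num
  have hkey : (h₁ : ℤ) * (h₁ * w * g₂ ^ (k + x) - h₂ ^ (u + 1))
      = s * ((h₂ : ℤ) ^ u - g₂ ^ x) := by
    rw [pow_add, pow_succ]
    linear_combination (g₂ : ℤ) ^ x * e1 - (h₂ : ℤ) ^ u * e2
  set j : ℤ := s * (h₁ * w * g₂ ^ (k + x) - h₂ ^ (u + 1)) with hj
  have hj1 : (h₁ : ℤ) * j = (h₂ : ℤ) ^ u - g₂ ^ x := by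
    rw [hj]
    linear_combination s * hkey + ((h₂ : ℤ) ^ u - g₂ ^ x) * hs2
  have hdvd : (h₁ : ℤ) ∣ s * j + h₂ * g₂ ^ x := by
    refine ⟨w * g₂ ^ (k + x) - h₂ * j, ?_⟩
    have : s * j = h₁ * w * g₂ ^ (k + x) - h₂ ^ (u + 1) := by
      rw [hj]
      linear_combination (h₁ * w * g₂ ^ (k + x) - h₂ ^ (u + 1) : ℤ) * hs2
    rw [this, pow_succ]
    linear_combination (h₂ : ℤ) * hj1
  have hne : s * j + h₂ * g₂ ^ x ≠ 0 := by
    intro h0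
    have hj2 : j = -(s * (h₂ * g₂ ^ x)) := by linear_combination s * h0 - j * hs2
    rw [hj2] at hj1
    have d1 : (h₂ : ℤ) ∣ g₂ ^ x := by
      have : (g₂ : ℤ) ^ x = h₂ ^ u + h₂ * (h₁ * s * g₂ ^ x) := by linear_combination hj1
      rw [this]
      exact dvd_add (dvd_pow_self _ c.u_pos.ne') (dvd_mul_right _ _)
    have d2 : (g₂ : ℤ) ^ x ∣ h₂ ^ u := by
      refine ⟨1 - h₁ * s * h₂, ?_⟩
      linear_combination -hj1
    have d1' : h₂ ∣ g₂ ^ x := by exact_mod_cast d1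
    have d2' : g₂ ^ x ∣ h₂ ^ u := by exact_mod_cast d2
    have hh1 : h₂ = 1 := (c.coprime.pow_left x).symm.eq_one_of_dvd d1'
    have hg1 : g₂ ^ x = 1 := (c.coprime.pow x u).eq_one_of_dvd d2'
    have hg1' : (g₂ : ℤ) ^ x = 1 := by exact_mod_cast hg1
    rw [hh1, hg1'] at hj1
    have : (h₁ : ℤ) = 0 := by
      simp only [Nat.cast_one, one_pow, mul_one, sub_self] at hj1
      linear_combination -s * hj1 - (h₁ : ℤ) * hs2
    omega
  have hle : (h₁ : ℤ) ≤ |j| + h₂ * g₂ ^ x := by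
    refine (Int.le_of_dvd (abs_pos.2 hne) ((dvd_abs _ _).2 hdvd)).trans ?_
    refine (abs_add_le _ _).trans ?_
    have hs1 : |s| = 1 := by rcases c.sign with h | h <;> rw [h] <;> norm_num
    rw [abs_mul, hs1, one_mul, abs_of_nonneg (by positivity : (0 : ℤ) ≤ h₂ * g₂ ^ x)]
  by_cases hcase : h₁ ≤ 2 * (h₂ * g₂ ^ x)
  · exact Or.inr hcase
  left
  have hcase' : 2 * ((h₂ : ℤ) * g₂ ^ x) < h₁ := by exact_mod_cast not_le.1 hcase
  have h2j : (h₁ : ℤ) ≤ 2 * |j| := by linarith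
  have hmax : |(h₁ : ℤ) * j| ≤ max ((h₂ : ℤ) ^ u) ((g₂ : ℤ) ^ x) := by
    rw [hj1]
    have q1 : (0 : ℤ) < (h₂ : ℤ) ^ u := by positivity
    have q2 : (0 : ℤ) < (g₂ : ℤ) ^ x := by positivity
    rw [abs_le]
    constructor
    · linarith [le_max_right ((h₂ : ℤ) ^ u) ((g₂ : ℤ) ^ x)]
    · linarith [le_max_left ((h₂ : ℤ) ^ u) ((g₂ : ℤ) ^ x)]
  have hfin : (h₁ : ℤ) ^ 2 ≤ 2 * max ((h₂ : ℤ) ^ u) ((g₂ : ℤ) ^ x) := by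
    rw [abs_mul, Nat.abs_cast] at hmax
    have := mul_le_mul_of_nonneg_left h2j (by positivity : (0 : ℤ) ≤ h₁)
    linarith
  exact_mod_cast hfin

lemma log_right_divisor (c : Coincidence s x k u l g₁ g₂ h₁ h₂ m) (hl : l = 1) :
    2 * Real.log (∏ p ∈ g₁.primeFactors, p : ℕ) ≤ Real.log h₁ ∨
      (2 * Real.log h₁ ≤ k * Real.log g₁ ∧
        (2 * Real.log h₁ ≤ 1 + max (u * Real.log h₂) (x * Real.log g₂) ∨
          Real.log h₁ ≤ 1 + Real.log h₂ + x * Real.log g₂)) := by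
  have n1 := c.left_pos.1
  have n4 := c.left_pos.2
  have n2 := c.symm.left_pos.1
  have n3 := c.symm.left_pos.2
  have hr := radical_pos g₁
  have l2 : Real.log 2 ≤ 1 := by linarith [Real.log_two_lt_d9]
  have key := c.radical_sq_dvd_or hl
  rw [c.radical_eq] at key
  generalize ∏ p ∈ g₁.primeFactors, p = r at *
  rcases key with h | h
  · left
    have := Real.log_le_log (by positivity)
      (by exact_mod_cast Nat.le_of_dvd n2 h : (r : ℝ) ^ 2 ≤ h₁)
    rw [Real.log_pow] at this
    exact_mod_cast this
  · right
    constructor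
    · have := Real.log_le_log (by positivity)
        (by exact_mod_cast Nat.le_of_dvd (by positivity) h : (h₁ : ℝ) ^ 2 ≤ (g₁ : ℝ) ^ k)
      rw [Real.log_pow, Real.log_pow] at this
      exact_mod_cast this
    · rcases c.le_or_le_of_dvd hl h with h | h
      · left
        have h' : (h₁ : ℝ) ^ 2 ≤ 2 * max ((h₂ : ℝ) ^ u) ((g₂ : ℝ) ^ x) := by exact_mod_cast h
        rcases le_total ((h₂ : ℝ) ^ u) ((g₂ : ℝ) ^ x) with hle | hle
        · rw [max_eq_right hle] at h'
          have := Real.log_le_log (by positivity) h'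
          rw [Real.log_mul (by norm_num) (by positivity), Real.log_pow, Real.log_pow] at this
          push_cast at this
          linarith [le_max_right (u * Real.log h₂) (x * Real.log g₂)]
        · rw [max_eq_left hle] at h'
          have := Real.log_le_log (by positivity) h'
          rw [Real.log_mul (by norm_num) (by positivity), Real.log_pow, Real.log_pow] at this
          push_cast at this
          linarith [le_max_left (u * Real.log h₂) (x * Real.log g₂)]
      · right
        have h' : (h₁ : ℝ) ≤ 2 * (h₂ * (g₂ : ℝ) ^ x) := by exact_mod_cast h
        have := Real.log_le_log (by positivity) h'
        rw [Real.log_mul (by norm_num) (by positivity),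
          Real.log_mul (by positivity) (by positivity), Real.log_pow] at this
        linarith

lemma log_radical_le (n : ℕ) (hn : n ≠ 0) :
    Real.log (∏ p ∈ n.primeFactors, p : ℕ) ≤ Real.log n :=
  Real.log_le_log (by exact_mod_cast radical_pos n)
    (by exact_mod_cast Nat.le_of_dvd (Nat.pos_of_ne_zero hn) (Nat.prod_primeFactors_dvd n))

lemma half_le_log {n : ℕ} (hn : 2 ≤ n) : 1 / 2 ≤ Real.log n := by
  have : Real.log 2 ≤ Real.log n := Real.log_le_log (by norm_num) (by exact_mod_cast hn)
  linarith [Real.log_two_gt_d9]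

lemma log_discrete {n : ℕ} (hn : 0 < n) : Real.log n = 0 ∨ 1 / 2 ≤ Real.log n := by
  by_cases h : n = 1
  · left; simp [h]
  · exact Or.inr (half_le_log (by omega))

lemma half_le_log_add (c : Coincidence s x k u l g₁ g₂ h₁ h₂ m) :
    1 / 2 ≤ Real.log g₁ + Real.log g₂ := by
  have h1 := c.left_pos.1
  have h2 := c.left_pos.2
  rw [← Real.log_mul (by positivity) (by positivity)]
  exact_mod_cast half_le_log c.left_ge

lemma logConfiguration {κ : ℝ} (hκ : LogABC κ) (c : Coincidence s x k u l g₁ g₂ h₁ h₂ m) :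
    LogConfiguration (κ + 6) x k u l (Real.log (∏ p ∈ g₁.primeFactors, p : ℕ))
      (Real.log g₂) (Real.log h₂) (Real.log g₁) (Real.log h₁) (Real.log m) where
  x_pos := c.x_pos
  k_pos := c.k_pos
  u_pos := c.u_pos
  l_pos := c.l_pos
  rho_nonneg := Real.log_natCast_nonneg _
  rho_le_left := log_radical_le _ c.left_pos.1.ne'
  rho_le_right := c.radical_eq ▸ log_radical_le _ c.symm.left_pos.1.ne'
  left_discrete := log_discrete c.left_pos.2
  right_discrete := log_discrete c.symm.left_pos.2
  nondegenerate := by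
    refine c.nondegenerate.imp (fun h => ?_) (fun h => ?_)
    · have := half_le_log (by have := c.left_pos.2; omega : 2 ≤ g₂)
      linarith
    · have := half_le_log (by have := c.symm.left_pos.2; omega : 2 ≤ h₂)
      linarith
  left_large := c.half_le_log_add
  right_large := c.symm.half_le_log_add
  M_nonneg := Real.log_natCast_nonneg _
  common := by
    rw [← Real.log_pow, ← Real.log_pow]
    exact_mod_cast congrArg (fun n : ℕ => Real.log n) c.common
  left_eq := c.log_left_eq
  right_eq := c.symm.log_left_eq
  left_abc := by linarith [c.log_left_abc hκ]
  right_abc := by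
    have := c.symm.log_left_abc hκ
    rw [c.radical_eq] at this
    linarith
  main_abc := by linarith [c.log_main_abc hκ]
  left_divisor := fun hk => by
    have := c.symm.log_right_divisor hk
    rwa [c.radical_eq] at this
  right_divisor := c.log_right_divisor
  left_square := c.symm.log_right_square hκ
  right_square := c.log_right_square hκ
  left_cofactor := fun hx hk => by linarith [c.symm.log_right_cofactor hκ hx hk]
  right_cofactor := fun hu hl => by linarith [c.log_right_cofactor hκ hu hl]

end Coincidence

/-- ABC bounds the exponents in a coincidence with non-proportional exponents. -/
lemma ABCConjecture.exists_exponent_bound (habc : ABCConjecture) :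
    ∃ B : ℕ, ∀ s : ℤ, (s = 1 ∨ s = -1) → ∀ g h x k u l : ℕ, 2 ≤ g → 2 ≤ h →
      0 < x → 0 < k → 0 < u → 0 < l → x * l ≠ u * k →
      (g : ℤ) ^ x * ((g : ℤ) ^ k + s) = (h : ℤ) ^ u * ((h : ℤ) ^ l + s) →
      x ≤ B ∧ k ≤ B ∧ u ≤ B ∧ l ≤ B := by
  obtain ⟨κ, hκ, habc'⟩ := habc.exists_logABC
  refine ⟨⌊30 * LogConfiguration.threshold (κ + 6) ^ 2⌋₊,
    fun s hs g h x k u l hg hh hx hk hu hl hne e => ?_⟩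
  obtain ⟨g₁, g₂, h₁, h₂, m, c⟩ := exists_coincidence hs hg hh hx hk hu hl hne e
  obtain ⟨b1, b2, b3, b4⟩ := (c.logConfiguration habc').exponents_le (by linarith)
  exact ⟨Nat.le_floor b1, Nat.le_floor b2, Nat.le_floor b3, Nat.le_floor b4⟩

/-- Under ABC, two representations of a large integer have proportional exponents. -/
lemma ABCConjecture.exists_proportional_bound (habc : ABCConjecture) :
    ∃ D : ℕ, ∀ s : ℤ, (s = 1 ∨ s = -1) → ∀ g h x k u l : ℕ, 2 ≤ g → 2 ≤ h →
      0 < x → 0 < k → 0 < u → 0 < l →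
      (g : ℤ) ^ x * ((g : ℤ) ^ k + s) = (h : ℤ) ^ u * ((h : ℤ) ^ l + s) →
      (D : ℤ) ≤ (g : ℤ) ^ x * ((g : ℤ) ^ k + s) → x * l = u * k := by
  obtain ⟨B, hB⟩ := habc.exists_exponent_bound
  choose L₁ hL₁ using habc.exists_bound_fixed_exponents (s := 1) (Or.inl rfl)
  choose L₂ hL₂ using habc.exists_bound_fixed_exponents (s := -1) (Or.inr rfl)
  set I := Finset.range (B + 1) ×ˢ Finset.range (B + 1) ×ˢ Finset.range (B + 1) ×ˢ
    Finset.range (B + 1)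
  set f : ℕ × ℕ × ℕ × ℕ → ℝ := fun t =>
    |L₁ t.1 t.2.1 t.2.2.1 t.2.2.2| + |L₂ t.1 t.2.1 t.2.2.1 t.2.2.2| with hf
  have hf0 : ∀ t, 0 ≤ f t := fun t => by positivity
  set S := ∑ t ∈ I, f t
  refine ⟨⌈Real.exp S⌉₊ + 1, fun s hs g h x k u l hg hh hx hk hu hl e hD => ?_⟩
  by_contra hne
  obtain ⟨b1, b2, b3, b4⟩ := hB s hs g h x k u l hg hh hx hk hu hl hne e
  have hmem : (x, k, u, l) ∈ I := by
    simp only [I, Finset.mem_product, Finset.mem_range]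
    omega
  have hle : f (x, k, u, l) ≤ S := Finset.single_le_sum (fun t _ => hf0 t) hmem
  simp only [hf] at hle
  have hlog : Real.log (((g : ℤ) ^ x * ((g : ℤ) ^ k + s) : ℤ) : ℝ) ≤ S := by
    rcases hs with rfl | rfl
    · have := hL₁ x k u l hx hk hu hl hne g h hg hh e
      linarith [le_abs_self (L₁ x k u l), abs_nonneg (L₂ x k u l)]
    · have := hL₂ x k u l hx hk hu hl hne g h hg hh e
      linarith [le_abs_self (L₂ x k u l), abs_nonneg (L₁ x k u l)]
  generalize (g : ℤ) ^ x * ((g : ℤ) ^ k + s) = d at *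
  have hd : ((⌈Real.exp S⌉₊ : ℝ) + 1) ≤ d := by exact_mod_cast hD
  have h1 := Nat.le_ceil (Real.exp S)
  have h2 := Real.exp_pos S
  have h3 := Real.log_lt_log h2 (by linarith : Real.exp S < d)
  rw [Real.log_exp] at h3
  linarith

theorem stmt16 (habc : ABCConjecture) :
    ∃ D : ℕ, ∀ d : ℕ, D ≤ d → Nplus d ≤ 1 ∧ Nminus d ≤ 1 := by
  obtain ⟨D, hD⟩ := habc.exists_proportional_bound
  have key : ∀ s : ℤ, (s = 1 ∨ s = -1) → ∀ d : ℕ, D ≤ d → ∀ S : Set (ℕ × ℕ × ℕ),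
      (∀ T ∈ S, 2 ≤ T.1 ∧ 1 ≤ T.2.1 ∧ T.2.1 < T.2.2 ∧ ¬ IsPerfectPow T.1 ∧
        (T.1 : ℤ) ^ T.2.2 + s * (T.1 : ℤ) ^ T.2.1 = d) → S.ncard ≤ 1 := by
    intro s hs d hd S hS
    have hsub : S.Subsingleton := by
      rintro ⟨g, x, y⟩ hT ⟨h, u, v⟩ hT'
      obtain ⟨hg, hx, hxy, hgp, e⟩ := hS _ hT
      obtain ⟨hh, hu, huv, hhp, e'⟩ := hS _ hT'
      dsimp only at *
      obtain ⟨k, rfl⟩ := Nat.exists_eq_add_of_lt hxy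
      obtain ⟨l, rfl⟩ := Nat.exists_eq_add_of_lt huv
      have e1 : (g : ℤ) ^ x * ((g : ℤ) ^ (k + 1) + s) = d := by
        rw [← e, add_assoc, pow_add]; ring
      have e2 : (h : ℤ) ^ u * ((h : ℤ) ^ (l + 1) + s) = d := by
        rw [← e', add_assoc, pow_add]; ring
      have hp := hD s hs g h x (k + 1) u (l + 1) hg hh hx k.succ_pos hu l.succ_pos
        (e1.trans e2.symm) (by rw [e1]; exact_mod_cast hd)
      obtain ⟨rfl, rfl, hkl⟩ := eq_of_proportional hs hg hh hgp hhp hx k.succ_pos hu l.succ_pos hp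
        (e1.trans e2.symm)
      rw [Nat.succ_injective hkl]
    exact (Set.ncard_le_one hsub.finite).2 fun a ha b hb => hsub ha hb
  refine ⟨D, fun d hd => ⟨key 1 (Or.inl rfl) d hd _ ?_, key (-1) (Or.inr rfl) d hd _ ?_⟩⟩
  · rintro T ⟨h1, h2, h3, h4, h5⟩
    exact ⟨h1, h2, h3, h4, by rw [one_mul]; exact_mod_cast h5⟩
  · rintro T ⟨h1, h2, h3, h4, h5⟩
    refine ⟨h1, h2, h3, h4, ?_⟩
    have : (T.1 : ℤ) ^ T.2.2 = (T.1 : ℤ) ^ T.2.1 + d := by exact_mod_cast h5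
    rw [this]; ring
end

section
/- Assume the ABC conjecture. Then there exists a positive integer C₁ such that M(d) ≤ C₁ for every positive integer d. -/
theorem prod_primeFactors_le_of_forall_prime_dvd {n N : ℕ} (hN : N ≠ 0)
    (h : ∀ p : ℕ, p.Prime → p ∣ n → p ∣ N) : ∏ p ∈ n.primeFactors, p ≤ N := by
  have hsub : n.primeFactors ⊆ N.primeFactors := fun p hp =>
    Nat.mem_primeFactors.2 ⟨Nat.prime_of_mem_primeFactors hp,
      h p (Nat.prime_of_mem_primeFactors hp) (Nat.dvd_of_mem_primeFactors hp), hN⟩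
  exact Nat.le_of_dvd (Nat.pos_of_ne_zero hN)
    ((Finset.prod_dvd_prod_of_subset _ _ _ hsub).trans (Nat.prod_primeFactors_dvd N))

theorem ABCConjecture.exists_log_le (habc : ABCConjecture) {ε : ℝ} (hε : 0 < ε) :
    ∃ κ : ℝ, 0 ≤ κ ∧ ∀ A B C : ℤ, A ≠ 0 → B ≠ 0 → C ≠ 0 → A + B = C → Int.gcd A B = 1 →
      ∀ N : ℕ, N ≠ 0 → (∀ p : ℕ, p.Prime → p ∣ (A * B * C).natAbs → p ∣ N) →
        Real.log A ≤ κ + (1 + ε) * Real.log N := by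
  obtain ⟨K, hK, hall⟩ := habc ε hε
  refine ⟨max 0 (Real.log K), le_max_left _ _, fun A B C hA hB hC hsum hgcd N hN hp => ?_⟩
  have h1 := hall A B C hA hB hC hsum hgcd
  have h2 : ((∏ p ∈ (A * B * C).natAbs.primeFactors, p : ℕ) : ℝ) ≤ N := by
    exact_mod_cast prod_primeFactors_le_of_forall_prime_dvd hN hp
  have hN0 : (0 : ℝ) < N := by exact_mod_cast Nat.pos_of_ne_zero hN
  have h3 : |(A : ℝ)| ≤ K * (N : ℝ) ^ (1 + ε) := by
    calc |(A : ℝ)| = ((|A| : ℤ) : ℝ) := by push_cast; rfl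
      _ ≤ ((max (max |A| |B|) |C| : ℤ) : ℝ) := by
        exact_mod_cast (le_max_left |A| |B|).trans (le_max_left _ _)
      _ ≤ _ := h1.trans (by gcongr)
  have hA' : 0 < |(A : ℝ)| := abs_pos.2 (by exact_mod_cast hA)
  have h4 := Real.log_le_log hA' h3
  rw [Real.log_abs, Real.log_mul hK.ne' (by positivity), Real.log_rpow hN0] at h4
  linarith [le_max_right 0 (Real.log K)]

/-- A form of the ABC bound that does not require `A` and `B` to be coprime. -/
theorem ABCConjecture.exists_log_le_log_add_log (habc : ABCConjecture) {ε : ℝ} (hε : 0 < ε) :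
    ∃ κ : ℝ, 0 ≤ κ ∧ ∀ A B C : ℤ, A ≠ 0 → B ≠ 0 → C ≠ 0 → A + B = C →
      ∀ g h : ℕ, g ≠ 0 → h ≠ 0 → (∀ p : ℕ, p.Prime → (p : ℤ) ∣ A → p ∣ g) →
        (∀ p : ℕ, p.Prime → (p : ℤ) ∣ B → p ∣ h) →
        Real.log A ≤ κ + (1 + ε) * (Real.log g + Real.log h + Real.log C) := by
  obtain ⟨κ, hκ, hall⟩ := habc.exists_log_le hε
  refine ⟨κ, hκ, fun A B C hA hB hC hsum g h hg hh hAg hBh => ?_⟩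
  obtain ⟨D, A', B', hD, hcop, rfl, rfl⟩ : ∃ D A' B' : ℤ, 0 < D ∧ Int.gcd A' B' = 1 ∧
      A = D * A' ∧ B = D * B' := by
    have hpos : 0 < Int.gcd A B := Int.gcd_pos_of_ne_zero_left _ hA
    obtain ⟨A', B', h1, h2, h3⟩ := Int.exists_gcd_one hpos
    exact ⟨(Int.gcd A B : ℤ), A', B', by exact_mod_cast hpos, h1, by rw [mul_comm]; exact h2,
      by rw [mul_comm]; exact h3⟩
  have hA' := right_ne_zero_of_mul hA
  have hB' := right_ne_zero_of_mul hB
  obtain rfl : C = D * (A' + B') := by rw [← hsum]; ring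
  have hC' := right_ne_zero_of_mul hC
  have key := hall A' B' (A' + B') hA' hB' hC' rfl hcop (g * h * (A' + B').natAbs)
    (by simp [hg, hh, hC']) (by
      intro p hp hdvd
      rw [Int.natAbs_mul, Int.natAbs_mul] at hdvd
      rcases hp.dvd_mul.1 hdvd with hdvd | hdvd
      · rcases hp.dvd_mul.1 hdvd with hdvd | hdvd
        · exact Dvd.dvd.mul_right (Dvd.dvd.mul_right
            (hAg p hp (Dvd.dvd.mul_left (Int.natCast_dvd.2 hdvd) _)) _) _
        · exact Dvd.dvd.mul_right (Dvd.dvd.mul_left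
            (hBh p hp (Dvd.dvd.mul_left (Int.natCast_dvd.2 hdvd) _)) _) _
      · exact Dvd.dvd.mul_left hdvd _)
  have hDR : (0 : ℝ) < D := by exact_mod_cast hD
  have hAR : (A' : ℝ) ≠ 0 := by exact_mod_cast hA'
  have hCR : ((A' + B' : ℤ) : ℝ) ≠ 0 := by exact_mod_cast hC'
  have hgR : (g : ℝ) ≠ 0 := by exact_mod_cast hg
  have hhR : (h : ℝ) ≠ 0 := by exact_mod_cast hh
  have hD1 : 0 ≤ Real.log D := Real.log_nonneg (by exact_mod_cast hD)
  have hnat : Real.log (((A' + B').natAbs : ℕ) : ℝ) = Real.log ((A' + B' : ℤ) : ℝ) := by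
    rw [Nat.cast_natAbs, Int.cast_abs, Real.log_abs]
  rw [Nat.cast_mul, Nat.cast_mul, Real.log_mul (mul_ne_zero hgR hhR) (by
    rw [Nat.cast_natAbs, Int.cast_abs]; exact abs_ne_zero.2 hCR), Real.log_mul hgR hhR, hnat] at key
  rw [Int.cast_mul, Int.cast_mul, Real.log_mul hDR.ne' hAR, Real.log_mul hDR.ne' hCR]
  nlinarith [mul_nonneg hε.le hD1]

/-- `d = ± g ^ x + g ^ (x + n)`, the sign being `s`. -/
structure IsPowSum (d g x n : ℕ) (s : ℤ) : Prop where
  two_le : 2 ≤ g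
  one_le_exp : 1 ≤ x
  one_le_gap : 1 ≤ n
  sign : s = 1 ∨ s = -1
  eq : (g : ℤ) ^ x * ((g : ℤ) ^ n + s) = d

theorem IsPowSum.exists_cofactor {d g x n : ℕ} {s : ℤ} (H : IsPowSum d g x n s) :
    ∃ c : ℕ, 0 < c ∧ (g : ℤ) ^ n + s = c ∧ g ^ x * c = d ∧ Nat.Coprime g c := by
  have hg : (2 : ℤ) ≤ g := by exact_mod_cast H.two_le
  have hgn : (2 : ℤ) ≤ (g : ℤ) ^ n := hg.trans (le_self_pow₀ (by linarith) (by have := H.one_le_gap; omega))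
  have hpos : 0 < (g : ℤ) ^ n + s := by rcases H.sign with h | h <;> rw [h] <;> linarith
  obtain ⟨c, hc⟩ := Int.eq_ofNat_of_zero_le hpos.le
  refine ⟨c, by rw [hc] at hpos; exact_mod_cast hpos, hc, ?_, ?_⟩
  · have := H.eq
    rw [hc] at this
    exact_mod_cast this
  · rw [← Nat.isCoprime_iff_coprime, ← hc]
    obtain ⟨k, rfl⟩ : ∃ k, n = k + 1 := ⟨n - 1, by have := H.one_le_gap; omega⟩
    rcases H.sign with h | h <;> rw [h]
    · exact ⟨-(g : ℤ) ^ k, 1, by ring⟩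
    · exact ⟨(g : ℤ) ^ k, -1, by ring⟩

theorem exists_common_root {a b x u : ℕ} (hx : 0 < x) (hu : 0 < u) (h : a ^ x = b ^ u) :
    ∃ t α β : ℕ, 0 < α ∧ 0 < β ∧ a = t ^ α ∧ b = t ^ β ∧ α * x = β * u := by
  obtain ⟨t, h1, h2⟩ := Nat.exists_eq_pow_of_pow_eq_pow (Or.inl hx.ne') h
  refine ⟨t, _, _, Nat.div_pos (Nat.le_of_dvd hu (Nat.gcd_dvd_right _ _)) (Nat.gcd_pos_of_pos_left _ hx),
    Nat.div_pos (Nat.le_of_dvd hx (Nat.gcd_dvd_left _ _)) (Nat.gcd_pos_of_pos_left _ hx), h1, h2, ?_⟩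
  rw [Nat.div_mul_right_comm (Nat.gcd_dvd_right _ _), Nat.div_mul_right_comm (Nat.gcd_dvd_left _ _),
    mul_comm]

theorem Nat.exists_eq_mul_of_coprime_of_mul_eq_pow {g x P Q : ℕ} (hx : x ≠ 0) (hPQ : Nat.Coprime P Q)
    (h : g ^ x = P * Q) : ∃ a b : ℕ, g = a * b ∧ P = a ^ x ∧ Q = b ^ x := by
  obtain ⟨a, ha⟩ := exists_eq_pow_of_mul_eq_pow (Nat.isUnit_iff.2 hPQ) h.symm
  obtain ⟨b, hb⟩ := exists_eq_pow_of_mul_eq_pow (Nat.isUnit_iff.2 hPQ.symm)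
    ((mul_comm Q P).trans h.symm)
  exact ⟨a, b, Nat.pow_left_injective hx (by simp only [h, ha, hb, mul_pow]), ha, hb⟩

/-- The common structure of two representations of the same `d`. -/
structure IsSplit (g x n : ℕ) (s : ℤ) (h u m : ℕ) (s' : ℤ) (t α β g₂ h₂ e : ℕ) : Prop where
  hx : 0 < x
  hu : 0 < u
  hn : 0 < n
  hm : 0 < m
  hs : s = 1 ∨ s = -1
  hs' : s' = 1 ∨ s' = -1
  ht : 0 < t
  hα : 0 < α
  hβ : 0 < β
  hg₂ : 0 < g₂
  hh₂ : 0 < h₂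
  he : 0 < e
  hg : g = t ^ α * g₂
  hh : h = t ^ β * h₂
  hxu : α * x = β * u
  hgn : (g : ℤ) ^ n + s = (h₂ : ℤ) ^ u * e
  hhm : (h : ℤ) ^ m + s' = (g₂ : ℤ) ^ x * e
  htg : Nat.Coprime t g₂
  hth : Nat.Coprime t h₂
  hgh : Nat.Coprime g₂ h₂

theorem IsSplit.symm {g x n : ℕ} {s : ℤ} {h u m : ℕ} {s' : ℤ} {t α β g₂ h₂ e : ℕ}
    (H : IsSplit g x n s h u m s' t α β g₂ h₂ e) : IsSplit h u m s' g x n s t β α h₂ g₂ e where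
  hx := H.hu
  hu := H.hx
  hn := H.hm
  hm := H.hn
  hs := H.hs'
  hs' := H.hs
  ht := H.ht
  hα := H.hβ
  hβ := H.hα
  hg₂ := H.hh₂
  hh₂ := H.hg₂
  he := H.he
  hg := H.hh
  hh := H.hg
  hxu := H.hxu.symm
  hgn := H.hhm
  hhm := H.hgn
  htg := H.hth
  hth := H.htg
  hgh := H.hgh.symm

theorem IsPowSum.exists_isSplit {d g x n h u m : ℕ} {s s' : ℤ} (H : IsPowSum d g x n s)
    (H' : IsPowSum d h u m s') :
    ∃ t α β g₂ h₂ e : ℕ, IsSplit g x n s h u m s' t α β g₂ h₂ e := by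
  obtain ⟨c, hc0, hc, hgc, hcop⟩ := H.exists_cofactor
  obtain ⟨c', hc0', hc', hhc, hcop'⟩ := H'.exists_cofactor
  have hx : 0 < x := H.one_le_exp
  have hu : 0 < u := H'.one_le_exp
  have hg0 : 0 < g := lt_of_lt_of_le two_pos H.two_le
  have hh0 : 0 < h := lt_of_lt_of_le two_pos H'.two_le
  have hcx : Nat.Coprime (g ^ x) c := hcop.pow_left x
  have hcu : Nat.Coprime (h ^ u) c' := hcop'.pow_left u
  have heq : g ^ x * c = h ^ u * c' := hgc.trans hhc.symm
  set P := Nat.gcd (g ^ x) (h ^ u) with hP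
  set Q := Nat.gcd (g ^ x) c' with hQ
  set Q' := Nat.gcd (h ^ u) c with hQ'
  have h1 : g ^ x = P * Q := by
    rw [hP, hQ, ← hcu.gcd_mul, ← heq]
    simp
  have h2 : h ^ u = P * Q' := by
    rw [hP, hQ', Nat.gcd_comm (g ^ x), ← hcx.gcd_mul, heq]
    simp
  have hPQ : Nat.Coprime P Q :=
    (hcu.coprime_dvd_left (Nat.gcd_dvd_right _ _)).coprime_dvd_right (Nat.gcd_dvd_right _ _)
  have hPQ' : Nat.Coprime P Q' :=
    (hcx.coprime_dvd_left (Nat.gcd_dvd_left _ _)).coprime_dvd_right (Nat.gcd_dvd_right _ _)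
  have hQQ' : Nat.Coprime Q Q' :=
    (hcx.coprime_dvd_left (Nat.gcd_dvd_left _ _)).coprime_dvd_right (Nat.gcd_dvd_right _ _)
  obtain ⟨g₁, g₂, rfl, hPg, hQg⟩ := Nat.exists_eq_mul_of_coprime_of_mul_eq_pow hx.ne' hPQ h1
  obtain ⟨h₁, h₂, rfl, hPh, hQh⟩ := Nat.exists_eq_mul_of_coprime_of_mul_eq_pow hu.ne' hPQ' h2
  obtain ⟨t, α, β, hα, hβ, rfl, rfl, hxu⟩ := exists_common_root hx hu (hPg.symm.trans hPh)
  have hP0 : 0 < P := Nat.gcd_pos_of_pos_left _ (pow_pos hg0 _)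
  have hQ0 : 0 < Q := Nat.gcd_pos_of_pos_left _ (pow_pos hg0 _)
  have ht : 0 < t := by
    rcases Nat.eq_zero_or_pos t with rfl | h0
    · simp [hα.ne'] at hg0
    · exact h0
  have hg₂ : 0 < g₂ := Nat.pos_of_mul_pos_left hg0
  have hh₂ : 0 < h₂ := Nat.pos_of_mul_pos_left hh0
  have hQc : Q * c = Q' * c' := by
    apply Nat.eq_of_mul_eq_mul_left hP0
    rw [← mul_assoc, ← mul_assoc, ← h1, ← h2, heq]
  obtain ⟨e, he⟩ : Q' ∣ c := Nat.gcd_dvd_right _ _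
  have he' : c' = Q * e := by
    have hQ0' : 0 < Q' := Nat.gcd_pos_of_pos_left _ (pow_pos hh0 _)
    apply Nat.eq_of_mul_eq_mul_left hQ0'
    rw [← hQc, he]; ring
  refine ⟨t, α, β, g₂, h₂, e, ⟨hx, hu, H.one_le_gap, H'.one_le_gap, H.sign, H'.sign, ht, hα, hβ,
    hg₂, hh₂, ?_, rfl, rfl, hxu, ?_, ?_, ?_, ?_, ?_⟩⟩
  · rcases Nat.eq_zero_or_pos e with rfl | h0
    · simp at he; omega
    · exact h0
  · rw [hc, he, hQh]; push_cast; ring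
  · rw [hc', he', hQg]; push_cast; ring
  · rw [hPg, hQg] at hPQ
    exact (Nat.coprime_pow_left_iff hα _ _).1
      ((Nat.coprime_pow_left_iff hx _ _).1 ((Nat.coprime_pow_right_iff hx _ _).1 hPQ))
  · rw [hPh, hQh] at hPQ'
    exact (Nat.coprime_pow_left_iff hβ _ _).1
      ((Nat.coprime_pow_left_iff hu _ _).1 ((Nat.coprime_pow_right_iff hu _ _).1 hPQ'))
  · rw [hQg, hQh] at hQQ'
    exact (Nat.coprime_pow_left_iff hx _ _).1 ((Nat.coprime_pow_right_iff hu _ _).1 hQQ')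

section IsSplit

variable {g x n : ℕ} {s : ℤ} {h u m : ℕ} {s' : ℤ} {t α β g₂ h₂ e : ℕ}

theorem IsSplit.gap_mul (H : IsSplit g x n s h u m s' t α β g₂ h₂ e) {j : ℕ}
    (hj : β * m = α * n + j) :
    (t : ℤ) ^ (α * n) * ((t : ℤ) ^ j * (h₂ : ℤ) ^ (u + m) - (g₂ : ℤ) ^ (x + n)) =
      s * (g₂ : ℤ) ^ x - s' * (h₂ : ℤ) ^ u := by
  have h1 := H.hgn
  have h2 := H.hhm
  rw [H.hg] at h1
  rw [H.hh] at h2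
  push_cast at h1 h2
  rw [mul_pow, ← pow_mul] at h1 h2
  rw [hj, pow_add] at h2
  rw [pow_add, pow_add]
  linear_combination (h₂ : ℤ) ^ u * h2 - (g₂ : ℤ) ^ x * h1

theorem IsSplit.gap_mul_cofactor (H : IsSplit g x n s h u m s' t α β g₂ h₂ e) {j : ℕ}
    (hj : β * m = α * n + j) :
    ((t : ℤ) ^ j * (h₂ : ℤ) ^ (u + m) - (g₂ : ℤ) ^ (x + n)) * e =
      s * ((t : ℤ) ^ j * (h₂ : ℤ) ^ m) - s' * (g₂ : ℤ) ^ n := by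
  have h1 := H.hgn
  have h2 := H.hhm
  rw [H.hg] at h1
  rw [H.hh] at h2
  push_cast at h1 h2
  rw [mul_pow, ← pow_mul] at h1 h2
  rw [hj, pow_add] at h2
  rw [pow_add, pow_add]
  linear_combination (g₂ : ℤ) ^ n * h2 - (t : ℤ) ^ j * (h₂ : ℤ) ^ m * h1

theorem IsSplit.eq_one_of_gap_eq_zero (H : IsSplit g x n s h u m s' t α β g₂ h₂ e) {j : ℕ}
    (h0 : (t : ℤ) ^ j * (h₂ : ℤ) ^ (u + m) - (g₂ : ℤ) ^ (x + n) = 0) : g₂ = 1 ∧ h₂ = 1 := by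
  have h1 : t ^ j * h₂ ^ (u + m) = g₂ ^ (x + n) := by exact_mod_cast sub_eq_zero.1 h0
  have hcop : Nat.Coprime (t ^ j * h₂ ^ (u + m)) (g₂ ^ (x + n)) :=
    Nat.Coprime.mul_left (H.htg.pow _ _) (H.hgh.symm.pow _ _)
  have hxn : x + n ≠ 0 := by have := H.hx; omega
  have hum : u + m ≠ 0 := by have := H.hu; omega
  have h2 : g₂ ^ (x + n) = 1 := by rw [h1] at hcop; exact (Nat.coprime_self _).1 hcop
  rw [h2] at h1
  exact ⟨(Nat.pow_eq_one.1 h2).resolve_right hxn,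
    (Nat.pow_eq_one.1 (Nat.dvd_one.1 (Dvd.intro_left _ h1))).resolve_right hum⟩

theorem IsSplit.pow_eq_pow (H : IsSplit g x n s h u m s' t α β g₂ h₂ e) (h1 : g₂ = 1 ∧ h₂ = 1) :
    g ^ x = h ^ u := by
  rw [H.hg, H.hh, h1.1, h1.2, mul_one, mul_one, ← pow_mul, ← pow_mul, H.hxu]

theorem pow_add_pow_lt_of_pow_lt {a b x n u m : ℕ} (hn : 0 < n)
    (hxm : x * m = u * n) (hu : 3 * m ≤ u) (hlt : a ^ n < b ^ m) (ha : 0 < a) (hb : 0 < b) :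
    a ^ (x + n) + (b ^ m + a ^ n) < b ^ (u + m) := by
  have h1 : a ^ x ≤ b ^ u := by
    refine (Nat.pow_le_pow_iff_left hn.ne').1 ?_
    calc (a ^ x) ^ n = (a ^ n) ^ x := by rw [← pow_mul, ← pow_mul, mul_comm]
      _ ≤ (b ^ m) ^ x := Nat.pow_le_pow_left hlt.le x
      _ = (b ^ u) ^ n := by rw [← pow_mul, ← pow_mul, mul_comm, hxm]
  have h2 : (b ^ m) ^ 3 ≤ b ^ u := by
    rw [← pow_mul, mul_comm]
    exact Nat.pow_le_pow_right hb hu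
  have ha' : 0 < a ^ n := pow_pos ha n
  rw [pow_add, pow_add]
  generalize a ^ n = G at *
  generalize b ^ m = B at *
  have h3 : a ^ x * G + b ^ u ≤ b ^ u * B := by
    calc a ^ x * G + b ^ u ≤ b ^ u * G + b ^ u := by gcongr
      _ = b ^ u * (G + 1) := by ring
      _ ≤ b ^ u * B := Nat.mul_le_mul_left _ hlt
  have h4 : 4 * B ≤ B ^ 3 := by
    have : 2 ≤ B := by omega
    calc 4 * B = 2 * 2 * B := by ring
      _ ≤ B * B * B := by gcongr
      _ = B ^ 3 := by ring
  omega

theorem abs_sign_mul_sub_le {σ σ' a b : ℤ} (h1 : σ = 1 ∨ σ = -1) (h2 : σ' = 1 ∨ σ' = -1)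
    (ha : 0 ≤ a) (hb : 0 ≤ b) : |σ * a - σ' * b| ≤ a + b := by
  rw [abs_le]
  rcases h1 with rfl | rfl <;> rcases h2 with rfl | rfl <;> constructor <;> linarith

theorem IsSplit.abs_gap_mul_le (H : IsSplit g x n s h u m s' t α β g₂ h₂ e) {j : ℕ}
    (hj : β * m = α * n + j) :
    |(t : ℤ) ^ j * (h₂ : ℤ) ^ (u + m) - (g₂ : ℤ) ^ (x + n)| * e ≤
      (t : ℤ) ^ j * (h₂ : ℤ) ^ m + (g₂ : ℤ) ^ n := by
  have h1 := congrArg abs (H.gap_mul_cofactor hj)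
  rw [abs_mul, Nat.abs_cast] at h1
  rw [h1]
  exact abs_sign_mul_sub_le H.hs H.hs' (by positivity) (by positivity)

theorem IsSplit.eq_one_of_mul_eq (H : IsSplit g x n s h u m s' t α β g₂ h₂ e)
    (hj : β * m = α * n) (hx : 3 * n ≤ x) (hu : 3 * m ≤ u) : g₂ = 1 ∧ h₂ = 1 := by
  have hxm : x * m = u * n := by
    have h1 : (α * β) * (x * m) = (α * β) * (u * n) := by
      calc (α * β) * (x * m) = (α * x) * (β * m) := by ring
        _ = (α * β) * (u * n) := by rw [H.hxu, hj]; ring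
    exact Nat.eq_of_mul_eq_mul_left (Nat.mul_pos H.hα H.hβ) h1
  have hle := H.abs_gap_mul_le (j := 0) (by omega)
  have he : (1 : ℤ) ≤ e := by exact_mod_cast H.he
  have hle' := (le_mul_of_one_le_right (abs_nonneg _) he).trans hle
  rw [pow_zero, one_mul, one_mul, abs_le] at hle'
  rcases lt_trichotomy (g₂ ^ n) (h₂ ^ m) with hlt | heq | hlt
  · have := pow_add_pow_lt_of_pow_lt H.hn hxm hu hlt H.hg₂ H.hh₂
    zify at this
    linarith [hle'.2]
  · have hcop : Nat.Coprime (g₂ ^ n) (h₂ ^ m) := H.hgh.pow _ _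
    have h2 : h₂ ^ m = 1 := by rw [heq] at hcop; exact (Nat.coprime_self _).1 hcop
    rw [h2] at heq
    exact ⟨(Nat.pow_eq_one.1 heq).resolve_right H.hn.ne', (Nat.pow_eq_one.1 h2).resolve_right H.hm.ne'⟩
  · have := pow_add_pow_lt_of_pow_lt H.hm hxm.symm hx hlt H.hh₂ H.hg₂
    zify at this
    linarith [hle'.1]

theorem IsSplit.dvd_gap_add (H : IsSplit g x n s h u m s' t α β g₂ h₂ e) {j : ℕ}
    (hj : β * m = α * n + j) (hj0 : j ≠ 0) (hn1 : n = 1) :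
    (t : ℤ) ∣ ((t : ℤ) ^ j * (h₂ : ℤ) ^ (u + m) - (g₂ : ℤ) ^ (x + n)) +
      s * s' * (g₂ * (h₂ : ℤ) ^ u) := by
  subst hn1
  have h1 := H.gap_mul hj
  have hss : s * s = 1 := by rcases H.hs with h | h <;> rw [h] <;> norm_num
  obtain ⟨i, rfl⟩ := Nat.exists_eq_succ_of_ne_zero hj0
  obtain ⟨a, ha⟩ := Nat.exists_eq_succ_of_ne_zero H.hα.ne'
  rw [ha] at h1
  set k := (t : ℤ) ^ (i.succ) * (h₂ : ℤ) ^ (u + m) - (g₂ : ℤ) ^ (x + 1) with hk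
  refine ⟨(t : ℤ) ^ i * (h₂ : ℤ) ^ (u + m) - s * g₂ * (t : ℤ) ^ a * k, ?_⟩
  have h2 : (g₂ : ℤ) ^ (x + 1) = g₂ * (s * s * (g₂ : ℤ) ^ x) := by rw [hss]; ring
  have h3 : (t : ℤ) ^ i.succ = t * (t : ℤ) ^ i := by rw [Nat.succ_eq_add_one]; ring
  have h4 : (t : ℤ) ^ (a.succ * 1) = t * (t : ℤ) ^ a := by rw [Nat.succ_eq_add_one]; ring
  rw [h4] at h1
  rw [h2, h3] at hk
  linear_combination hk + s * g₂ * h1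

theorem IsSplit.eq_one_of_gap_add_eq_zero (H : IsSplit g x n s h u m s' t α β g₂ h₂ e) {j : ℕ}
    (h0 : ((t : ℤ) ^ j * (h₂ : ℤ) ^ (u + m) - (g₂ : ℤ) ^ (x + n)) +
      s * s' * (g₂ * (h₂ : ℤ) ^ u) = 0) : g₂ = 1 ∧ h₂ = 1 := by
  obtain ⟨a, ha⟩ : ∃ a, u = a + 1 := ⟨u - 1, by have := H.hu; omega⟩
  obtain ⟨b, hb⟩ : ∃ b, x = b + 1 := ⟨x - 1, by have := H.hx; omega⟩
  have h1 : (g₂ : ℤ) ∣ ((t ^ j * h₂ ^ (u + m) : ℕ) : ℤ) := by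
    refine ⟨(g₂ : ℤ) ^ (b + n) - s * s' * (h₂ : ℤ) ^ u, ?_⟩
    rw [hb] at h0
    push_cast
    linear_combination h0
  have h2 : (h₂ : ℤ) ∣ ((g₂ ^ (x + n) : ℕ) : ℤ) := by
    refine ⟨(t : ℤ) ^ j * (h₂ : ℤ) ^ (a + m) + s * s' * (g₂ * (h₂ : ℤ) ^ a), ?_⟩
    rw [ha] at h0
    push_cast
    linear_combination -h0
  rw [Int.natCast_dvd_natCast] at h1 h2
  exact ⟨Nat.eq_one_of_dvd_coprimes (Nat.Coprime.mul_left (H.htg.pow_left _) (H.hgh.symm.pow_left _))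
      h1 dvd_rfl,
    Nat.eq_one_of_dvd_coprimes (H.hgh.pow_left _) h2 dvd_rfl⟩

end IsSplit

theorem add_le_two_mul_mul {a b : ℝ} (ha : 1 ≤ a) (hb : 1 ≤ b) : a + b ≤ 2 * (a * b) := by
  nlinarith

set_option maxHeartbeats 800000 in
theorem ABCConjecture.exists_eq_one_of_isSplit_of_le (habc : ABCConjecture) :
    ∃ δ : ℝ, 0 < δ ∧ ∀ (g x n : ℕ) (s : ℤ) (h u m : ℕ) (s' : ℤ) (t α β g₂ h₂ e : ℕ),
      IsSplit g x n s h u m s' t α β g₂ h₂ e → α * n ≤ β * m →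
      Real.log g₂ ≤ δ * Real.log g → Real.log h₂ ≤ δ * Real.log h → 3 * n ≤ x → 3 * m ≤ u →
      g₂ = 1 ∧ h₂ = 1 := by
  obtain ⟨κ, hκ, hall⟩ := habc.exists_log_le (ε := 1 / 100) (by norm_num)
  refine ⟨1 / (1000 * (κ + 10)), by positivity, ?_⟩
  intro g x n s h u m s' t α β g₂ h₂ e H hle hδg hδh hxn hum
  by_contra hne
  obtain ⟨j, hj⟩ := Nat.exists_eq_add_of_le hle
  have hj0 : j ≠ 0 := by
    rintro rfl
    exact hne (H.eq_one_of_mul_eq hj hxn hum)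
  have hk0 := fun h0 => hne (H.eq_one_of_gap_eq_zero (j := j) h0)
  have hk1 := fun h0 => hne (H.eq_one_of_gap_add_eq_zero (j := j) h0)
  have hkdvd := H.dvd_gap_add hj hj0
  have hkle := H.abs_gap_mul_le hj
  generalize (t : ℤ) ^ j * (h₂ : ℤ) ^ (u + m) - (g₂ : ℤ) ^ (x + n) = k at hk0 hk1 hkdvd hkle
  have ht1 : (1 : ℝ) ≤ t := by exact_mod_cast H.ht
  have hg1 : (1 : ℝ) ≤ g₂ := by exact_mod_cast H.hg₂
  have hh1 : (1 : ℝ) ≤ h₂ := by exact_mod_cast H.hh₂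
  have he1 : (1 : ℝ) ≤ e := by exact_mod_cast H.he
  have hn1 : (1 : ℝ) ≤ n := by exact_mod_cast H.hn
  have hm1 : (1 : ℝ) ≤ m := by exact_mod_cast H.hm
  have hu1 : (1 : ℝ) ≤ u := by exact_mod_cast H.hu
  have hα1 : (1 : ℝ) ≤ α := by exact_mod_cast H.hα
  have hβ1 : (1 : ℝ) ≤ β := by exact_mod_cast H.hβ
  have hlogg : Real.log g = α * Real.log t + Real.log g₂ := by
    rw [H.hg]; push_cast
    rw [Real.log_mul (by positivity) (by positivity), Real.log_pow]
  have hlogh : Real.log h = β * Real.log t + Real.log h₂ := by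
    rw [H.hh]; push_cast
    rw [Real.log_mul (by positivity) (by positivity), Real.log_pow]
  have hgR : (1 : ℝ) ≤ g := by
    rw [H.hg]; push_cast; exact one_le_mul_of_one_le_of_one_le (one_le_pow₀ ht1) hg1
  have hhR : (1 : ℝ) ≤ h := by
    rw [H.hh]; push_cast; exact one_le_mul_of_one_le_of_one_le (one_le_pow₀ ht1) hh1
  have hl2 := Real.log_two_lt_d9
  have hl2' := Real.log_two_gt_d9
  -- the radical of `h ^ m + s'`
  have hrad : m * Real.log h ≤ κ + (1 + 1 / 100) *
      (Real.log t + Real.log g₂ + Real.log h₂ + Real.log e) := by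
    have h1 := hall ((h : ℤ) ^ m) s' ((h : ℤ) ^ m + s')
      (pow_ne_zero _ (by have : (0:ℝ) < h := by linarith
                         exact_mod_cast this.ne'))
      (by rcases H.hs' with h | h <;> rw [h] <;> norm_num)
      (by rw [H.hhm]; have := H.hg₂; have := H.he; positivity) rfl
      (by rcases H.hs' with h | h <;> rw [h] <;> simp)
      (t * g₂ * h₂ * e)
      (by have := H.ht; have := H.hg₂; have := H.hh₂; have := H.he; positivity) (by
        intro p hp hd
        rw [H.hhm, Int.natAbs_mul, Int.natAbs_mul, Int.natAbs_mul, Int.natAbs_pow, Int.natAbs_pow,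
          Int.natAbs_natCast, Int.natAbs_natCast, Int.natAbs_natCast] at hd
        rcases hp.dvd_mul.1 hd with hd | hd
        · rcases hp.dvd_mul.1 hd with hd | hd
          · have h2 := hp.dvd_of_dvd_pow hd
            rw [H.hh] at h2
            rcases hp.dvd_mul.1 h2 with h2 | h2
            · have h3 := hp.dvd_of_dvd_pow h2
              exact ((h3.mul_right _).mul_right _).mul_right _
            · exact (h2.mul_left _).mul_right _
          · have : s'.natAbs = 1 := by rcases H.hs' with h | h <;> rw [h] <;> rfl
            rw [this] at hd
            exact absurd (Nat.dvd_one.1 hd) hp.one_lt.ne'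
        · rcases hp.dvd_mul.1 hd with hd | hd
          · exact (((hp.dvd_of_dvd_pow hd).mul_left _).mul_right _).mul_right _
          · exact hd.mul_left _)
    push_cast at h1
    rwa [Real.log_pow, Real.log_mul (by positivity) (by positivity),
      Real.log_mul (by positivity) (by positivity), Real.log_mul (by positivity) (by positivity)] at h1
  have hcof : u * Real.log h₂ + Real.log e ≤ n * Real.log g + 1 := by
    have h1 : (h₂ : ℝ) ^ u * e ≤ 2 * (g : ℝ) ^ n := by
      have h2 : (g : ℝ) ^ n + s = (h₂ : ℝ) ^ u * e := by exact_mod_cast H.hgn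
      have h3 : (s : ℝ) ≤ 1 := by rcases H.hs with h | h <;> rw [h] <;> norm_num
      have h4 : 1 ≤ (g : ℝ) ^ n := one_le_pow₀ hgR
      linarith
    have h2 := Real.log_le_log (by positivity) h1
    rw [Real.log_mul (by positivity) (by positivity), Real.log_mul (by positivity) (by positivity),
      Real.log_pow, Real.log_pow] at h2
    linarith
  have hklog : Real.log |(k : ℝ)| + Real.log e ≤
      1 + n * Real.log g₂ + m * Real.log h₂ + j * Real.log t := by
    have h1 : |(k : ℝ)| * e ≤ 2 * ((g₂ : ℝ) ^ n * ((h₂ : ℝ) ^ m * (t : ℝ) ^ j)) := by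
      have h2 : |(k : ℝ)| * e ≤ (t : ℝ) ^ j * (h₂ : ℝ) ^ m + (g₂ : ℝ) ^ n := by exact_mod_cast hkle
      have h3 : 1 ≤ (g₂ : ℝ) ^ n := one_le_pow₀ hg1
      have h4 : 1 ≤ (h₂ : ℝ) ^ m * (t : ℝ) ^ j :=
        one_le_mul_of_one_le_of_one_le (one_le_pow₀ hh1) (one_le_pow₀ ht1)
      linarith only [h2, add_le_two_mul_mul h3 h4]
    have hkpos : 0 < |(k : ℝ)| := abs_pos.2 (by exact_mod_cast hk0)
    have h2 := Real.log_le_log (by positivity) h1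
    rw [Real.log_mul (by positivity) (by positivity), Real.log_mul (by positivity) (by positivity),
      Real.log_mul (by positivity) (by positivity), Real.log_mul (by positivity) (by positivity),
      Real.log_pow, Real.log_pow, Real.log_pow] at h2
    linarith
  have hkabs : 0 ≤ Real.log |(k : ℝ)| := by
    apply Real.log_nonneg
    have := Int.one_le_abs hk0
    exact_mod_cast this
  have hjR : (β : ℝ) * m = α * n + j := by exact_mod_cast hj
  have hj1 : (1 : ℝ) ≤ j := by exact_mod_cast Nat.one_le_iff_ne_zero.2 hj0
  have hT0 : 0 ≤ Real.log t := Real.log_nonneg ht1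
  have hG0 : 0 ≤ Real.log g₂ := Real.log_nonneg hg1
  have hH0 : 0 ≤ Real.log h₂ := Real.log_nonneg hh1
  have hE0 : 0 ≤ Real.log e := Real.log_nonneg he1
  have hγ0 : 0 ≤ Real.log g := Real.log_nonneg hgR
  have hη0 : 0 ≤ Real.log h := Real.log_nonneg hhR
  have hbig : Real.log 2 ≤ Real.log g₂ ∨ Real.log 2 ≤ Real.log h₂ := by
    by_contra! hcon
    have h1 : (g₂ : ℝ) < 2 := (Real.log_lt_log_iff (by positivity) two_pos).1 hcon.1
    have h2 : (h₂ : ℝ) < 2 := (Real.log_lt_log_iff (by positivity) two_pos).1 hcon.2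
    have h1' : g₂ < 2 := by exact_mod_cast h1
    have h2' : h₂ < 2 := by exact_mod_cast h2
    have := H.hg₂
    have := H.hh₂
    exact hne ⟨by omega, by omega⟩
  -- passing to the quantities `n log g` and `m log h`
  have hδg' : 1000 * (κ + 10) * (n * Real.log g₂) ≤ n * Real.log g := by
    rw [div_mul_eq_mul_div, one_mul, le_div_iff₀ (by positivity)] at hδg
    linarith only [mul_le_mul_of_nonneg_left hδg (zero_le_one.trans hn1)]
  have hδh' : 1000 * (κ + 10) * (m * Real.log h₂) ≤ m * Real.log h := by
    rw [div_mul_eq_mul_div, one_mul, le_div_iff₀ (by positivity)] at hδh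
    linarith only [mul_le_mul_of_nonneg_left hδh (zero_le_one.trans hm1)]
  have hnG : Real.log g₂ ≤ n * Real.log g₂ := le_mul_of_one_le_left hG0 hn1
  have hmH : Real.log h₂ ≤ m * Real.log h₂ := le_mul_of_one_le_left hH0 hm1
  have hN : n * Real.log g = α * n * Real.log t + n * Real.log g₂ := by rw [hlogg]; ring
  have hM : m * Real.log h = α * n * Real.log t + j * Real.log t + m * Real.log h₂ := by
    rw [hlogh]; linear_combination Real.log t * hjR
  have huH : 0 ≤ u * Real.log h₂ := by positivity
  have hτ : Real.log t ≤ α * n * Real.log t :=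
    le_mul_of_one_le_left hT0 (one_le_mul_of_one_le_of_one_le hα1 hn1)
  have hjτ : Real.log t ≤ j * Real.log t := le_mul_of_one_le_left hT0 hj1
  have hg_small : 10000 * (n * Real.log g₂) ≤ n * Real.log g := by
    exact (mul_le_mul_of_nonneg_right (by linarith) (hG0.trans hnG)).trans hδg'
  have hh_small : 10000 * (m * Real.log h₂) ≤ m * Real.log h := by
    exact (mul_le_mul_of_nonneg_right (by linarith) (hH0.trans hmH)).trans hδh'
  have hMN : m * Real.log h ≤ 3 * (n * Real.log g) + 2 * κ + 4 := by
    linarith only [hrad, hcof, hκ, hG0, hH0, hT0, huH, hnG, hmH, hN, hτ, hg_small, hh_small]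
  have hlarge : 100 * (κ + 10) ≤ n * Real.log g := by
    rcases hbig with hb | hb
    · have : (κ + 10) * (1 / 2) ≤ (κ + 10) * (n * Real.log g₂) :=
        mul_le_mul_of_nonneg_left (by linarith only [hb, hl2', hnG]) (by linarith only [hκ])
      linarith only [this, hδg', hκ]
    · have : (κ + 10) * (1 / 2) ≤ (κ + 10) * (m * Real.log h₂) :=
        mul_le_mul_of_nonneg_left (by linarith only [hb, hl2', hmH]) (by linarith only [hκ])
      linarith only [this, hδh', hκ, hMN]
  have hαn : α * n < 2 := by
    by_contra! hcon
    have h2 : (2 : ℝ) ≤ α * n := by exact_mod_cast hcon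
    have h3 : 2 * Real.log t ≤ α * n * Real.log t := mul_le_mul_of_nonneg_right h2 hT0
    linarith only [hrad, hκ, hkabs, hklog, hnG, hmH, hN, hM, h3, hg_small, hh_small, hMN, hlarge]
  have hαn1 : α * n = 1 := by have := Nat.mul_pos H.hα H.hn; omega
  have hn_one : n = 1 := Nat.dvd_one.1 (Dvd.intro_left _ hαn1)
  have hαnR : (α : ℝ) * n = 1 := by exact_mod_cast hαn1
  rw [hαnR, one_mul] at hN hM
  have hdvd := Int.le_of_dvd (abs_pos.2 hk1) ((dvd_abs _ _).2 (hkdvd hn_one))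
  have hτle : Real.log t ≤ 1 + Real.log |(k : ℝ)| + Real.log g₂ + u * Real.log h₂ := by
    have hss : |(s * s' : ℝ)| = 1 := by
      rcases H.hs with h | h <;> rcases H.hs' with h' | h' <;> rw [h, h'] <;> norm_num
    have h1 : (t : ℝ) ≤ |(k : ℝ) + s * s' * (g₂ * (h₂ : ℝ) ^ u)| := by exact_mod_cast hdvd
    have h2 : |(k : ℝ) + s * s' * (g₂ * (h₂ : ℝ) ^ u)| ≤ |(k : ℝ)| + g₂ * (h₂ : ℝ) ^ u := by
      refine (abs_add_le _ _).trans (le_of_eq ?_)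
      rw [abs_mul, hss, one_mul, abs_of_nonneg (by positivity : (0 : ℝ) ≤ g₂ * (h₂ : ℝ) ^ u)]
    have h3 : 1 ≤ |(k : ℝ)| := by exact_mod_cast Int.one_le_abs hk0
    have h4 : 1 ≤ g₂ * (h₂ : ℝ) ^ u := one_le_mul_of_one_le_of_one_le hg1 (one_le_pow₀ hh1)
    have h5 : (t : ℝ) ≤ 2 * (|(k : ℝ)| * (g₂ * (h₂ : ℝ) ^ u)) :=
      h1.trans (h2.trans (add_le_two_mul_mul h3 h4))
    have h6 := Real.log_le_log (by positivity) h5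
    rw [Real.log_mul (by positivity) (by positivity), Real.log_mul (by positivity) (by positivity),
      Real.log_mul (by positivity) (by positivity), Real.log_pow] at h6
    linarith
  linarith only [hrad, hκ, hcof, hklog, hnG, hmH, hjτ, hN, hM, hg_small, hh_small, hlarge, hτle]

theorem ABCConjecture.exists_pow_eq_of_isSplit (habc : ABCConjecture) :
    ∃ δ : ℝ, 0 < δ ∧ ∀ (g x n : ℕ) (s : ℤ) (h u m : ℕ) (s' : ℤ) (t α β g₂ h₂ e : ℕ),
      IsSplit g x n s h u m s' t α β g₂ h₂ e →
      Real.log g₂ ≤ δ * Real.log g → Real.log h₂ ≤ δ * Real.log h → 3 * n ≤ x → 3 * m ≤ u →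
      g ^ x = h ^ u := by
  obtain ⟨δ, hδ, hall⟩ := habc.exists_eq_one_of_isSplit_of_le
  refine ⟨δ, hδ, fun g x n s h u m s' t α β g₂ h₂ e H hg hh hxn hum => ?_⟩
  rcases le_total (α * n) (β * m) with hle | hle
  · exact H.pow_eq_pow (hall _ _ _ _ _ _ _ _ _ _ _ _ _ _ H hle hg hh hxn hum)
  · exact (H.symm.pow_eq_pow (hall _ _ _ _ _ _ _ _ _ _ _ _ _ _ H.symm hle hh hg hum hxn)).symm

namespace IsPowSum

variable {d g x n : ℕ} {s : ℤ}

theorem half_le_log (H : IsPowSum d g x n s) : 1 / 2 ≤ Real.log g := by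
  have h1 : (2 : ℝ) ≤ g := by exact_mod_cast H.two_le
  have h2 := Real.log_le_log two_pos h1
  linarith [Real.log_two_gt_d9]

theorem pow_le (H : IsPowSum d g x n s) : (d : ℝ) ≤ 2 * (g : ℝ) ^ (x + n) := by
  have h1 : (1 : ℝ) ≤ g := by exact_mod_cast one_le_two.trans H.two_le
  have h2 : (g : ℝ) ^ x * ((g : ℝ) ^ n + s) = d := by exact_mod_cast H.eq
  have h3 : (s : ℝ) ≤ 1 := by rcases H.sign with h | h <;> rw [h] <;> norm_num
  have h4 : 1 ≤ (g : ℝ) ^ n := one_le_pow₀ h1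
  rw [← h2, pow_add]
  have h5 : 0 < (g : ℝ) ^ x := by positivity
  nlinarith

theorem le_pow (H : IsPowSum d g x n s) : (g : ℝ) ^ (x + n) ≤ 2 * d := by
  have h1 : (2 : ℝ) ≤ g := by exact_mod_cast H.two_le
  have h2 : (g : ℝ) ^ x * ((g : ℝ) ^ n + s) = d := by exact_mod_cast H.eq
  have h3 : (-1 : ℝ) ≤ s := by rcases H.sign with h | h <;> rw [h] <;> norm_num
  have h4 : 2 ≤ (g : ℝ) ^ n :=
    h1.trans (le_self_pow₀ (by linarith) (by have := H.one_le_gap; omega))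
  rw [← h2, pow_add]
  have h5 : 0 < (g : ℝ) ^ x := by positivity
  nlinarith

theorem log_le_log_add_two (H : IsPowSum d g x n s) {h u m : ℕ} {s' : ℤ}
    (H' : IsPowSum d h u m s') :
    ((x + n : ℕ) : ℝ) * Real.log g ≤ ((u + m : ℕ) : ℝ) * Real.log h + 2 := by
  have hg : (0 : ℝ) < g := by exact_mod_cast two_pos.trans_le H.two_le
  have hh : (0 : ℝ) < h := by exact_mod_cast two_pos.trans_le H'.two_le
  have h1 : (g : ℝ) ^ (x + n) ≤ 2 * 2 * (h : ℝ) ^ (u + m) := by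
    linarith [H.le_pow, H'.pow_le]
  have h2 := Real.log_le_log (by positivity) h1
  rw [Real.log_mul (by positivity) (by positivity), Real.log_mul (by positivity) (by positivity),
    Real.log_pow, Real.log_pow] at h2
  linarith [Real.log_two_lt_d9]

theorem log_le_of_log_le (H : IsPowSum d g x n s) {h u m : ℕ} {s' : ℤ}
    (H' : IsPowSum d h u m s') (hle : u * Real.log h ≤ x * Real.log g) (hne : g ^ x ≠ h ^ u)
    {κ ε : ℝ} (hε : 0 ≤ ε)
    (habc : ∀ A B C : ℤ, A ≠ 0 → B ≠ 0 → C ≠ 0 → A + B = C →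
      ∀ g h : ℕ, g ≠ 0 → h ≠ 0 → (∀ p : ℕ, p.Prime → (p : ℤ) ∣ A → p ∣ g) →
        (∀ p : ℕ, p.Prime → (p : ℤ) ∣ B → p ∣ h) →
        Real.log A ≤ κ + (1 + ε) * (Real.log g + Real.log h + Real.log C)) :
    ((x + n : ℕ) : ℝ) * Real.log g ≤
      κ + (1 + ε) * (Real.log g + Real.log h + (1 + x * Real.log g)) := by
  have hg0 : g ≠ 0 := (two_pos.trans_le H.two_le).ne'
  have hh0 : h ≠ 0 := (two_pos.trans_le H'.two_le).ne'
  have hg : (0 : ℝ) < g := by exact_mod_cast two_pos.trans_le H.two_le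
  have hh : (0 : ℝ) < h := by exact_mod_cast two_pos.trans_le H'.two_le
  have heq : (g : ℤ) ^ (x + n) + -(h : ℤ) ^ (u + m) = s' * (h : ℤ) ^ u - s * (g : ℤ) ^ x := by
    rw [pow_add, pow_add]
    linear_combination H.eq - H'.eq
  have hC0 : s' * (h : ℤ) ^ u - s * (g : ℤ) ^ x ≠ 0 := by
    intro h0
    apply hne
    have h1 := congrArg Int.natAbs (sub_eq_zero.1 h0)
    rw [Int.natAbs_mul, Int.natAbs_mul, Int.natAbs_pow, Int.natAbs_pow, Int.natAbs_natCast,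
      Int.natAbs_natCast] at h1
    rcases H.sign with h | h <;> rcases H'.sign with h' | h' <;> rw [h, h'] at h1 <;>
      simpa using h1.symm
  have h1 := habc _ _ _ (by positivity) (neg_ne_zero.2 (by positivity)) hC0 heq g h hg0 hh0
    (fun p hp hd => by
      have : p ∣ g ^ (x + n) := by exact_mod_cast hd
      exact hp.dvd_of_dvd_pow this)
    (fun p hp hd => by
      have : p ∣ h ^ (u + m) := by exact_mod_cast (dvd_neg.1 hd)
      exact hp.dvd_of_dvd_pow this)
  have h2 : Real.log ((s' * (h : ℤ) ^ u - s * (g : ℤ) ^ x : ℤ) : ℝ) ≤ 1 + x * Real.log g := by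
    have h3 : |((s' * (h : ℤ) ^ u - s * (g : ℤ) ^ x : ℤ) : ℝ)| ≤ (h : ℝ) ^ u + (g : ℝ) ^ x := by
      exact_mod_cast abs_sign_mul_sub_le H'.sign H.sign
        (by positivity : (0 : ℤ) ≤ (h : ℤ) ^ u) (by positivity : (0 : ℤ) ≤ (g : ℤ) ^ x)
    have h4 : (h : ℝ) ^ u ≤ (g : ℝ) ^ x := by
      rw [← Real.log_le_log_iff (by positivity) (by positivity), Real.log_pow, Real.log_pow]
      exact hle
    have h5 : |((s' * (h : ℤ) ^ u - s * (g : ℤ) ^ x : ℤ) : ℝ)| ≤ 2 * (g : ℝ) ^ x := by linarith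
    have h6 := Real.log_le_log (abs_pos.2 (by exact_mod_cast hC0)) h5
    rw [Real.log_abs, Real.log_mul (by positivity) (by positivity), Real.log_pow] at h6
    linarith [Real.log_two_lt_d9]
  rw [Int.cast_pow, Int.cast_natCast, Real.log_pow] at h1
  refine h1.trans ?_
  gcongr

theorem mul_log_le (H : IsPowSum d g x n s) {Y : ℝ} (hY : Y ≤ ((x + n : ℕ) : ℝ)) :
    Y * Real.log g ≤ ((x + n : ℕ) : ℝ) * Real.log g :=
  mul_le_mul_of_nonneg_right hY (by linarith [H.half_le_log])

theorem half_le_mul_log (H : IsPowSum d g x n s) {Y : ℝ} (hY : Y ≤ ((x + n : ℕ) : ℝ)) :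
    Y / 2 ≤ ((x + n : ℕ) : ℝ) * Real.log g := by
  have h1 : (0 : ℝ) ≤ ((x + n : ℕ) : ℝ) := Nat.cast_nonneg _
  nlinarith [H.half_le_log]

end IsPowSum

theorem ABCConjecture.exists_gap_log_le (habc : ABCConjecture) {ξ : ℝ} (hξ : 0 < ξ) (hξ1 : ξ ≤ 1) :
    ∃ Y : ℝ, ∀ (d g x n : ℕ) (s : ℤ) (h u m : ℕ) (s' : ℤ), IsPowSum d g x n s →
      IsPowSum d h u m s' → Y ≤ ((x + n : ℕ) : ℝ) → Y ≤ ((u + m : ℕ) : ℝ) →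
      u * Real.log h ≤ x * Real.log g → g ^ x ≠ h ^ u →
      n * Real.log g ≤ ξ * (((x + n : ℕ) : ℝ) * Real.log g) := by
  obtain ⟨κ, hκ, hall⟩ := habc.exists_log_le_log_add_log (half_pos hξ)
  refine ⟨16 * (κ + 4) / ξ, fun d g x n s h u m s' H H' hY hY' hle hne => ?_⟩
  have h1 := H.log_le_of_log_le H' hle hne (half_pos hξ).le hall
  have h2 := H'.log_le_log_add_two H
  have h3 := H.mul_log_le hY
  have h4 := H'.mul_log_le hY'
  have h5 := H.half_le_mul_log hY
  rw [div_mul_eq_mul_div, div_le_iff₀ hξ] at h3 h4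
  rw [div_div, div_le_iff₀ (by positivity)] at h5
  have h6 := H.half_le_log
  have h7 := H'.half_le_log
  have h8 : ((x + n : ℕ) : ℝ) * Real.log g = x * Real.log g + n * Real.log g := by
    push_cast; ring
  have h9 : 0 ≤ n * Real.log g := by positivity
  have h10 : ((u + m : ℕ) : ℝ) * Real.log h * ξ ≤ (((x + n : ℕ) : ℝ) * Real.log g + 2) * ξ :=
    mul_le_mul_of_nonneg_right h2 hξ.le
  have h11 : 0 ≤ κ * Real.log g := mul_nonneg hκ (by linarith)
  have h12 : 0 ≤ κ * Real.log h := mul_nonneg hκ (by linarith)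
  have h13 : ξ / 2 * (Real.log g + Real.log h + 1) ≤ 1 * (Real.log g + Real.log h + 1) :=
    mul_le_mul_of_nonneg_right (by linarith) (by linarith)
  have h14 : 0 ≤ ξ * (n * Real.log g) := mul_nonneg hξ.le h9
  rw [h8] at h1 h3 h5 h10 ⊢
  linarith

theorem ABCConjecture.exists_gap_log_le_of_gap_log_le (habc : ABCConjecture) {ξ : ℝ} (hξ : 0 < ξ)
    (hξ1 : ξ ≤ 1) :
    ∃ Y : ℝ, ∀ (d g x n : ℕ) (s : ℤ) (h u m : ℕ) (s' : ℤ), IsPowSum d g x n s →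
      IsPowSum d h u m s' → Y ≤ ((x + n : ℕ) : ℝ) → Y ≤ ((u + m : ℕ) : ℝ) →
      n * Real.log g ≤ ξ * (((x + n : ℕ) : ℝ) * Real.log g) →
      m * Real.log h ≤ 8 * ξ * (((u + m : ℕ) : ℝ) * Real.log h) := by
  obtain ⟨κ, hκ, hall⟩ := habc.exists_log_le one_pos
  refine ⟨8 * (κ + 4) / ξ, fun d g x n s h u m s' H H' hY hY' hle => ?_⟩
  obtain ⟨c, hc0, hc, hgc, -⟩ := H.exists_cofactor
  obtain ⟨c', hc0', hc', hhc, -⟩ := H'.exists_cofactor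
  have hg0 : 0 < g := two_pos.trans_le H.two_le
  have hh0 : 0 < h := two_pos.trans_le H'.two_le
  have h1 := hall ((h : ℤ) ^ m) s' c' (by positivity)
    (by rcases H'.sign with h | h <;> rw [h] <;> norm_num) (by positivity) hc'
    (by rcases H'.sign with h | h <;> rw [h] <;> simp) (g * c) (by positivity) (by
      intro p hp hd
      rw [Int.natAbs_mul, Int.natAbs_mul, Int.natAbs_pow, Int.natAbs_natCast,
        Int.natAbs_natCast] at hd
      have hs' : s'.natAbs = 1 := by rcases H'.sign with h | h <;> rw [h] <;> rfl
      rw [hs', mul_one] at hd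
      have hd' : p ∣ g ^ x * c := by
        rw [hgc, ← hhc]
        rcases hp.dvd_mul.1 hd with hd | hd
        · exact ((hp.dvd_of_dvd_pow hd).trans
            (dvd_pow_self _ (by have := H'.one_le_exp; omega))).mul_right _
        · exact hd.mul_left _
      rcases hp.dvd_mul.1 hd' with hd' | hd'
      · exact (hp.dvd_of_dvd_pow hd').mul_right _
      · exact hd'.mul_left _)
  have hgR : (1 : ℝ) ≤ g := by exact_mod_cast hg0
  have hcR : (0 : ℝ) < c := by exact_mod_cast hc0
  have h2 : Real.log c ≤ 1 + n * Real.log g := by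
    have h3 : (c : ℝ) ≤ 2 * (g : ℝ) ^ n := by
      have h4 : (g : ℝ) ^ n + s = c := by exact_mod_cast hc
      have h5 : (s : ℝ) ≤ 1 := by rcases H.sign with h | h <;> rw [h] <;> norm_num
      have h6 : 1 ≤ (g : ℝ) ^ n := one_le_pow₀ hgR
      linarith
    have h4 := Real.log_le_log hcR h3
    rw [Real.log_mul (by positivity) (by positivity), Real.log_pow] at h4
    linarith [Real.log_two_lt_d9]
  rw [Int.cast_pow, Int.cast_natCast, Real.log_pow, Nat.cast_mul,
    Real.log_mul (by positivity) (by positivity)] at h1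
  have h3 := H.mul_log_le hY
  have h4 := H.half_le_mul_log hY
  have h5 := H'.half_le_mul_log hY'
  have h6 := H.log_le_log_add_two H'
  rw [div_mul_eq_mul_div, div_le_iff₀ hξ] at h3
  rw [div_div, div_le_iff₀ (by positivity)] at h4 h5
  have h7 : 0 ≤ κ * Real.log g := mul_nonneg hκ (by linarith [H.half_le_log])
  have h8 := mul_le_mul_of_nonneg_left h6 hξ.le
  linarith [H.half_le_log]

theorem log_le_of_gap_log_le {g x n : ℕ} {s : ℤ} {h u m : ℕ} {s' : ℤ} {t α β g₂ h₂ e d : ℕ}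
    (H : IsPowSum d g x n s) (H' : IsPowSum d h u m s')
    (S : IsSplit g x n s h u m s' t α β g₂ h₂ e) {ξ : ℝ} (hξ : 0 < ξ) (hξ1 : ξ ≤ 1 / 4)
    (hY : 6 / ξ ≤ ((x + n : ℕ) : ℝ))
    (hg : n * Real.log g ≤ ξ * (((x + n : ℕ) : ℝ) * Real.log g))
    (hh : m * Real.log h ≤ ξ * (((u + m : ℕ) : ℝ) * Real.log h)) :
    3 * n ≤ x ∧ Real.log g₂ ≤ 3 * ξ * Real.log g := by
  have hγ : 0 < Real.log g := by linarith [H.half_le_log]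
  have h1 : (n : ℝ) ≤ ξ * ((x + n : ℕ) : ℝ) := by
    rw [← mul_assoc] at hg
    exact le_of_mul_le_mul_right hg hγ
  have hxn0 : (0 : ℝ) < ((x + n : ℕ) : ℝ) := by
    have : 0 < x + n := by have := H.one_le_gap; omega
    exact_mod_cast this
  have h2 : (n : ℝ) ≤ 1 / 4 * ((x + n : ℕ) : ℝ) :=
    h1.trans (mul_le_mul_of_nonneg_right hξ1 hxn0.le)
  have h3 : (3 : ℝ) * n ≤ x := by push_cast at h2; linarith
  refine ⟨by exact_mod_cast h3, ?_⟩
  have hhR : (1 : ℝ) ≤ h := by exact_mod_cast one_le_two.trans H'.two_le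
  have hg₂ : (1 : ℝ) ≤ g₂ := by exact_mod_cast S.hg₂
  have he : (1 : ℝ) ≤ e := by exact_mod_cast S.he
  have h4 : x * Real.log g₂ ≤ m * Real.log h + 1 := by
    have h5 : (g₂ : ℝ) ^ x ≤ 2 * (h : ℝ) ^ m := by
      have h6 : (h : ℝ) ^ m + s' = (g₂ : ℝ) ^ x * e := by exact_mod_cast S.hhm
      have h7 : (s' : ℝ) ≤ 1 := by rcases S.hs' with h | h <;> rw [h] <;> norm_num
      have h8 : 1 ≤ (h : ℝ) ^ m := one_le_pow₀ hhR
      have h9 : (g₂ : ℝ) ^ x ≤ (g₂ : ℝ) ^ x * e := le_mul_of_one_le_right (by positivity) he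
      linarith
    have h6 := Real.log_le_log (by positivity) h5
    rw [Real.log_mul (by positivity) (by positivity), Real.log_pow, Real.log_pow] at h6
    linarith [Real.log_two_lt_d9]
  have h5 := mul_le_mul_of_nonneg_left (H'.log_le_log_add_two H) hξ.le
  have h6 := H.half_le_mul_log hY
  rw [div_div, div_le_iff₀ (by positivity)] at h6
  have h7 : 3 / 4 * ((x + n : ℕ) : ℝ) * Real.log g₂ ≤ x * Real.log g₂ := by
    refine mul_le_mul_of_nonneg_right ?_ (Real.log_nonneg hg₂)
    push_cast at h2 ⊢
    linarith
  have h8 : ((x + n : ℕ) : ℝ) * Real.log g₂ ≤ ((x + n : ℕ) : ℝ) * (3 * ξ * Real.log g) := by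
    linarith
  exact le_of_mul_le_mul_left h8 hxn0

/-- Under ABC, two representations of `d` with large exponents have the same smaller term. -/
theorem ABCConjecture.exists_pow_eq (habc : ABCConjecture) :
    ∃ Y : ℕ, ∀ (d g x n : ℕ) (s : ℤ) (h u m : ℕ) (s' : ℤ), IsPowSum d g x n s →
      IsPowSum d h u m s' → Y ≤ x + n → Y ≤ u + m → g ^ x = h ^ u := by
  obtain ⟨δ, hδ, hcore⟩ := habc.exists_pow_eq_of_isSplit
  obtain ⟨ξ, hξ, hξ1, hξδ⟩ : ∃ ξ : ℝ, 0 < ξ ∧ ξ ≤ 1 / 4 ∧ 3 * ξ ≤ δ :=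
    ⟨min (1 / 4) (δ / 3), lt_min (by norm_num) (by positivity), min_le_left _ _,
      by linarith [min_le_right (1 / 4) (δ / 3)]⟩
  obtain ⟨Y₁, hY₁⟩ := habc.exists_gap_log_le (ξ := ξ / 8) (by positivity) (by linarith)
  obtain ⟨Y₂, hY₂⟩ := habc.exists_gap_log_le_of_gap_log_le (ξ := ξ / 8) (by positivity) (by linarith)
  obtain ⟨Y, hY⟩ := exists_nat_ge (max (max Y₁ Y₂) (6 / ξ))
  have gaps : ∀ (d g x n : ℕ) (s : ℤ) (h u m : ℕ) (s' : ℤ), IsPowSum d g x n s →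
      IsPowSum d h u m s' → (Y : ℝ) ≤ ((x + n : ℕ) : ℝ) → (Y : ℝ) ≤ ((u + m : ℕ) : ℝ) →
      u * Real.log h ≤ x * Real.log g → g ^ x ≠ h ^ u →
      n * Real.log g ≤ ξ * (((x + n : ℕ) : ℝ) * Real.log g) ∧
      m * Real.log h ≤ ξ * (((u + m : ℕ) : ℝ) * Real.log h) := by
    intro d g x n s h u m s' H H' h1 h2 hle hne
    have hY₁' : Y₁ ≤ Y := ((le_max_left _ _).trans (le_max_left _ _)).trans hY
    have hY₂' : Y₂ ≤ Y := ((le_max_right _ _).trans (le_max_left _ _)).trans hY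
    have h3 := hY₁ _ _ _ _ _ _ _ _ _ H H' (hY₁'.trans h1) (hY₁'.trans h2) hle hne
    have h4 := hY₂ _ _ _ _ _ _ _ _ _ H H' (hY₂'.trans h1) (hY₂'.trans h2) h3
    have h5 : 0 ≤ ((x + n : ℕ) : ℝ) * Real.log g :=
      mul_nonneg (Nat.cast_nonneg _) (by linarith [H.half_le_log])
    have h6 := mul_nonneg hξ.le h5
    exact ⟨by linarith, by linarith⟩
  refine ⟨Y, fun d g x n s h u m s' H H' h1 h2 => ?_⟩
  by_contra hne
  have h1' : (Y : ℝ) ≤ ((x + n : ℕ) : ℝ) := by exact_mod_cast h1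
  have h2' : (Y : ℝ) ≤ ((u + m : ℕ) : ℝ) := by exact_mod_cast h2
  have hYξ : 6 / ξ ≤ Y := (le_max_right _ _).trans hY
  obtain ⟨hgap, hgap'⟩ : n * Real.log g ≤ ξ * (((x + n : ℕ) : ℝ) * Real.log g) ∧
      m * Real.log h ≤ ξ * (((u + m : ℕ) : ℝ) * Real.log h) := by
    rcases le_total (u * Real.log h) (x * Real.log g) with hle | hle
    · exact gaps _ _ _ _ _ _ _ _ _ H H' h1' h2' hle hne
    · exact (gaps _ _ _ _ _ _ _ _ _ H' H h2' h1' hle (Ne.symm hne)).symm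
  obtain ⟨t, α, β, g₂, h₂, e, S⟩ := H.exists_isSplit H'
  obtain ⟨hx, hg₂⟩ := log_le_of_gap_log_le H H' S hξ hξ1 (hYξ.trans h1') hgap hgap'
  obtain ⟨hu, hh₂⟩ := log_le_of_gap_log_le H' H S.symm hξ hξ1 (hYξ.trans h2') hgap' hgap
  have hγ : 0 ≤ Real.log g := by linarith [H.half_le_log]
  have hη : 0 ≤ Real.log h := by linarith [H'.half_le_log]
  exact hne (hcore _ _ _ _ _ _ _ _ _ _ _ _ _ _ S
    (hg₂.trans (mul_le_mul_of_nonneg_right hξδ hγ))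
    (hh₂.trans (mul_le_mul_of_nonneg_right hξδ hη)) hx hu)

theorem IsPowSum.unique {d g h x n : ℕ} {s : ℤ} (H : IsPowSum d g x n s)
    (H' : IsPowSum d h x n s) : g = h := by
  have key : ∀ {g h : ℕ}, IsPowSum d g x n s → IsPowSum d h x n s → ¬ g < h := by
    intro g h H H' hlt
    have hlt' : (g : ℤ) < h := by exact_mod_cast hlt
    have h1 : (g : ℤ) ^ x < (h : ℤ) ^ x :=
      pow_lt_pow_left₀ hlt' (Nat.cast_nonneg g) (by have := H.one_le_exp; omega)
    have h2 : (g : ℤ) ^ n < (h : ℤ) ^ n :=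
      pow_lt_pow_left₀ hlt' (Nat.cast_nonneg g) (by have := H.one_le_gap; omega)
    obtain ⟨c, hc, hgc, -⟩ := H.exists_cofactor
    have h3 : (0 : ℤ) < (g : ℤ) ^ n + s := by rw [hgc]; exact_mod_cast hc
    refine (mul_lt_mul'' h1 (add_lt_add_left h2 s) (by positivity) h3.le).ne ?_
    rw [H.eq, H'.eq]
  exact le_antisymm (not_lt.1 (key H' H)) (not_lt.1 (key H H'))

theorem MultDepPair.exists_natAbs_pow_eq {a b : ℤ} (h : MultDepPair a b) (ha : a.natAbs ≠ 1)
    (hb : b.natAbs ≠ 1) : ∃ i j : ℕ, 0 < i ∧ 0 < j ∧ a.natAbs ^ i = b.natAbs ^ j := by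
  obtain ⟨hab, ⟨k, l⟩, hk, h1⟩ := h
  have ha0 := Int.natAbs_ne_zero.2 (left_ne_zero_of_mul hab)
  have hb0 := Int.natAbs_ne_zero.2 (right_ne_zero_of_mul hab)
  have h2 : ((a.natAbs : ℕ) : ℚ) ^ k * ((b.natAbs : ℕ) : ℚ) ^ l = 1 := by
    have := congrArg abs h1
    rwa [abs_mul, abs_zpow, abs_zpow, abs_one, ← Int.cast_abs, ← Int.cast_abs,
      Int.abs_eq_natAbs, Int.abs_eq_natAbs, Int.cast_natCast, Int.cast_natCast] at this
  generalize a.natAbs = A at *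
  generalize b.natAbs = B at *
  have hA : (A : ℚ) ≠ 0 := by exact_mod_cast ha0
  have hB : (B : ℚ) ≠ 0 := by exact_mod_cast hb0
  have of_pow_eq : ∀ i j : ℕ, i ≠ 0 ∨ j ≠ 0 → A ^ i = B ^ j → 0 < i ∧ 0 < j := by
    intro i j hij h
    rcases Nat.eq_zero_or_pos i with rfl | hi
    · have := pow_eq_one_iff.1 (h.symm.trans (pow_zero A))
      tauto
    · rcases Nat.eq_zero_or_pos j with rfl | hj
      · have := pow_eq_one_iff.1 (h.trans (pow_zero B))
        omega
      · exact ⟨hi, hj⟩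
  have not_mul : ∀ i j : ℕ, i ≠ 0 ∨ j ≠ 0 → A ^ i * B ^ j ≠ 1 := by
    intro i j hij h
    obtain ⟨h3, h4⟩ := mul_eq_one.1 h
    have := of_pow_eq i j hij (h3.trans h4.symm)
    exact (pow_eq_one_iff.1 h3).elim ha this.1.ne'
  obtain ⟨i, rfl | rfl⟩ := k.eq_nat_or_neg <;> obtain ⟨j, rfl | rfl⟩ := l.eq_nat_or_neg <;>
    have hij : i ≠ 0 ∨ j ≠ 0 := by
      by_contra! h
      simp [h.1, h.2] at hk
  · exact absurd (by exact_mod_cast h2) (not_mul i j hij)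
  · rw [zpow_neg, zpow_natCast, zpow_natCast, mul_inv_eq_one₀ (pow_ne_zero _ hB)] at h2
    have h3 : A ^ i = B ^ j := by exact_mod_cast h2
    exact ⟨i, j, (of_pow_eq i j hij h3).1, (of_pow_eq i j hij h3).2, h3⟩
  · rw [zpow_neg, zpow_natCast, zpow_natCast, inv_mul_eq_one₀ (pow_ne_zero _ hA)] at h2
    have h3 : A ^ i = B ^ j := by exact_mod_cast h2
    exact ⟨i, j, (of_pow_eq i j hij h3).1, (of_pow_eq i j hij h3).2, h3⟩
  · rw [zpow_neg, zpow_neg, zpow_natCast, zpow_natCast, ← mul_inv, inv_eq_one] at h2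
    exact absurd (by exact_mod_cast h2) (not_mul i j hij)

theorem exists_isPowSum_of_natAbs_eq_pow {a b : ℤ} {d g x y : ℕ} (hd : 0 < d) (hg : 2 ≤ g)
    (hx : 0 < x) (hxy : x < y) (ha : a.natAbs = g ^ x) (hb : b.natAbs = g ^ y) (h : b - a = d) :
    ∃ n s, IsPowSum d g x n s := by
  obtain ⟨n, hn, rfl⟩ : ∃ n, 0 < n ∧ y = x + n := ⟨y - x, by omega, by omega⟩
  have h1 : g ^ x < g ^ (x + n) := Nat.pow_lt_pow_right hg hxy
  have hb' : b = (g : ℤ) ^ x * (g : ℤ) ^ n := by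
    rw [← pow_add, ← Nat.cast_pow, ← hb]
    omega
  have ha' : a = (g : ℤ) ^ x ∨ a = -(g : ℤ) ^ x := by
    rw [← Nat.cast_pow, ← ha]
    omega
  rcases ha' with ha' | ha'
  · exact ⟨n, -1, hg, hx, hn, Or.inr rfl, by rw [← h, hb', ha']; ring⟩
  · exact ⟨n, 1, hg, hx, hn, Or.inl rfl, by rw [← h, hb', ha']; ring⟩

/-- The smaller terms `g ^ x` of the representations `d = ± g ^ x + g ^ (x + n)`. -/
def smallerTerms (d : ℕ) : Set ℕ := {w | ∃ g x n s, IsPowSum d g x n s ∧ w = g ^ x}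

theorem natAbs_mem_of_mem_MSet {d : ℕ} (hd : 0 < d) {p : ℤ × ℤ} (hp : p ∈ MSet d) :
    ∃ w ∈ insert 1 (insert (d / 2) (smallerTerms d)), p.1.natAbs = w ∨ p.2.natAbs = w := by
  obtain ⟨a, b⟩ := p
  obtain ⟨hab, h⟩ := hp
  simp only at hab h ⊢
  by_cases ha : a.natAbs = 1
  · exact ⟨1, Or.inl rfl, Or.inl ha⟩
  by_cases hb : b.natAbs = 1
  · exact ⟨1, Or.inl rfl, Or.inr hb⟩
  obtain ⟨i, j, hi, hj, hij⟩ := hab.exists_natAbs_pow_eq ha hb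
  obtain ⟨g, x, y, hx, hy, hax, hby, -⟩ := exists_common_root hi hj hij
  have ha0 := Int.natAbs_ne_zero.2 (left_ne_zero_of_mul hab.1)
  have hg : 2 ≤ g := by
    rcases Nat.lt_or_ge g 2 with h2 | h2
    · interval_cases g
      · rw [zero_pow hx.ne'] at hax
        contradiction
      · rw [one_pow] at hax
        contradiction
    · exact h2
  rcases lt_trichotomy x y with hxy | rfl | hxy
  · obtain ⟨n, s, H⟩ := exists_isPowSum_of_natAbs_eq_pow hd hg hx hxy hax hby h
    exact ⟨g ^ x, Or.inr (Or.inr ⟨g, x, n, s, H, rfl⟩), Or.inl hax⟩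
  · exact ⟨d / 2, Or.inr (Or.inl rfl), Or.inl (by omega)⟩
  · obtain ⟨n, s, H⟩ := exists_isPowSum_of_natAbs_eq_pow (a := -b) (b := -a) hd hg hy hxy
      (by rwa [Int.natAbs_neg]) (by rwa [Int.natAbs_neg]) (by omega)
    exact ⟨g ^ y, Or.inr (Or.inr ⟨g, y, n, s, H, rfl⟩), Or.inr hby⟩

theorem ABCConjecture.exists_smallerTerms_card_le (habc : ABCConjecture) :
    ∃ N : ℕ, ∀ d, ∃ W : Finset ℕ, smallerTerms d ⊆ W ∧ W.card ≤ N := by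
  classical
  obtain ⟨Y, hY⟩ := habc.exists_pow_eq
  have small : ∀ (d : ℕ) (q : ℕ × ℕ × ℤ), ∃ w, ∀ g, IsPowSum d g q.1 q.2.1 q.2.2 → g ^ q.1 = w := by
    intro d q
    by_cases hq : ∃ g, IsPowSum d g q.1 q.2.1 q.2.2
    · obtain ⟨g, H⟩ := hq
      exact ⟨g ^ q.1, fun h H' => by rw [H.unique H']⟩
    · exact ⟨0, fun g H => absurd ⟨g, H⟩ hq⟩
  have big : ∀ d : ℕ, ∃ w, ∀ g x n s, IsPowSum d g x n s → Y ≤ x + n → g ^ x = w := by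
    intro d
    by_cases hq : ∃ g x n s, IsPowSum d g x n s ∧ Y ≤ x + n
    · obtain ⟨g, x, n, s, H, h⟩ := hq
      exact ⟨g ^ x, fun g' x' n' s' H' h' => hY _ _ _ _ _ _ _ _ _ H' H h' h⟩
    · exact ⟨0, fun g x n s H h => absurd ⟨g, x, n, s, H, h⟩ hq⟩
  choose f hf using small
  choose w hw using big
  let I : Finset (ℕ × ℕ × ℤ) := Finset.range Y ×ˢ Finset.range Y ×ˢ {1, -1}
  refine ⟨I.card + 1, fun d => ⟨insert (w d) (I.image (f d)), ?_, ?_⟩⟩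
  · rintro _ ⟨g, x, n, s, H, rfl⟩
    rw [Finset.mem_coe, Finset.mem_insert, Finset.mem_image]
    rcases le_or_gt Y (x + n) with h | h
    · exact Or.inl (hw d g x n s H h)
    · refine Or.inr ⟨(x, n, s), ?_, (hf d (x, n, s) g H).symm⟩
      simp only [I, Finset.mem_product, Finset.mem_range, Finset.mem_insert, Finset.mem_singleton]
      exact ⟨by omega, by omega, H.sign⟩
  · exact (Finset.card_insert_le _ _).trans (Nat.add_le_add_right Finset.card_image_le 1)

theorem stmt17 (habc : ABCConjecture) :
    ∃ C₁ : ℕ, 0 < C₁ ∧ ∀ d : ℕ, 0 < d → M (d : ℤ) ≤ C₁ := by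
  obtain ⟨N, hN⟩ := habc.exists_smallerTerms_card_le
  refine ⟨(N + 2) * 4, by positivity, fun d hd => ?_⟩
  obtain ⟨W, hW, hWN⟩ := hN d
  let T : ℕ → Finset (ℤ × ℤ) := fun w =>
    {((w : ℤ), (w : ℤ) + d), (-(w : ℤ), -(w : ℤ) + d), ((w : ℤ) - d, (w : ℤ)),
      (-(w : ℤ) - d, -(w : ℤ))}
  have hsub : MSet d ⊆ ((insert 1 (insert (d / 2) W)).biUnion T : Finset (ℤ × ℤ)) := by
    intro p hp
    obtain ⟨w, hw, h⟩ := natAbs_mem_of_mem_MSet hd hp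
    have hd' := hp.2
    rw [Finset.mem_coe, Finset.mem_biUnion]
    refine ⟨w, ?_, ?_⟩
    · rw [Finset.mem_insert, Finset.mem_insert]
      exact hw.imp_right (Or.imp_right (@hW w))
    · simp only [T, Finset.mem_insert, Finset.mem_singleton, Prod.ext_iff]
      omega
  calc M d ≤ ((insert 1 (insert (d / 2) W)).biUnion T).card := by
        rw [M, ← Set.ncard_coe_finset]
        exact Set.ncard_le_ncard hsub (Finset.finite_toSet _)
    _ ≤ (insert 1 (insert (d / 2) W)).card * 4 :=
        Finset.card_biUnion_le_card_mul _ _ _ fun w _ => Finset.card_le_four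
    _ ≤ (N + 2) * 4 := by
        have h1 := Finset.card_insert_le 1 (insert (d / 2) W)
        have h2 := Finset.card_insert_le (d / 2) W
        omega
end
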